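/- There exists N₁ ∈ ℕ such that for every n ≥ N₁ and every σ ∈ S_n with c₁(σ) ≥ 2, the standard representation rules for σ: for every irreducible complex character χ of S_n other than the trivial and sign characters, χ̃(σ) ≤ (c₁(σ)-1)/(n-1). -/

import Mathlib

open CategoryTheory

/-- `c₁(σ)`: the number of fixed points of a permutation. -/
def fixCount {n : ℕ} (σ : Equiv.Perm (Fin n)) : ℕ :=
  (Finset.univ.filter fun x => σ x = x).card

/-- `c_ℓ(σ)`: the number of `ℓ`-cycles of a permutation (for `ℓ ≥ 2`). -/
def cyc {n : ℕ} (ℓ : ℕ) (σ : Equiv.Perm (Fin n)) : ℕ :=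
  Multiset.count ℓ σ.cycleType

/-- The (real-valued) normalized character `χ̃(σ) = χ(σ)/χ(1)` of `V` at `σ`. -/
noncomputable def normChar {n : ℕ} (V : FDRep ℂ (Equiv.Perm (Fin n)))
    (σ : Equiv.Perm (Fin n)) : ℝ :=
  (V.character σ / V.character 1).re

/-- `V` is an irreducible representation whose character is neither the trivial
character nor the sign character. -/
def IsNontrivIrr {n : ℕ} (V : FDRep ℂ (Equiv.Perm (Fin n))) : Prop :=
  Simple V ∧ V.character ≠ (fun _ => 1) ∧
    V.character ≠ (fun σ => ((Equiv.Perm.sign σ : ℤ) : ℂ))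

/-- The maximum of the normalized characters `F₁(σ), …, F₈(σ)` at `σ` of the eight
irreps `EIGHT_n = {(n-1,1), (n-2,2), (n-3,3), (n-3,2,1), (n-4,4),
(n-1,1)ᵗ, (n-2,2)ᵗ, (n-2,1,1)ᵗ}`. -/
noncomputable def maxF (n : ℕ) (σ : Equiv.Perm (Fin n)) : ℝ :=
  let c1 : ℝ := fixCount σ
  let c2 : ℝ := cyc 2 σ
  let c3 : ℝ := cyc 3 σ
  let c4 : ℝ := cyc 4 σ
  let e : ℝ := ((Equiv.Perm.sign σ : ℤ) : ℝ)
  let N : ℝ := n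
  let F1 := (c1 - 1) / (N - 1)
  let F2 := (c1 * (c1 - 3) / 2 + c2) / (N * (N - 3) / 2)
  let F3 := (c1 * (c1 - 1) * (c1 - 5) / 6 + (c1 - 1) * c2 + c3) / (N * (N - 1) * (N - 5) / 6)
  let F4 := (c1 * (c1 - 2) * (c1 - 4) / 3 - c3) / (N * (N - 2) * (N - 4) / 3)
  let F5 := (c1 * (c1 - 1) * (c1 - 2) * (c1 - 7) / 24 + (c1 ^ 2 - 3 * c1 - 1) * c2 / 2
      + c2 ^ 2 / 2 + (c1 - 1) * c3 + c4) / (N * (N - 1) * (N - 2) * (N - 7) / 24)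
  let F6 := e * F1
  let F7 := e * F2
  let F8 := e * ((c1 - 1) * (c1 - 2) / 2 - c2) / ((N - 1) * (N - 2) / 2)
  max (max (max F1 F2) (max F3 F4)) (max (max F5 F6) (max F7 F8))

namespace StdRules

/-- Every element is conjugate to its inverse. -/
class Ambivalent (G : Type) [Group G] : Prop where
  conj_inv : ∀ g : G, IsConj g g⁻¹

/-- The real-valued function `f` is the character of a finite-dimensional representation. -/
def IsRepChar {G : Type} [Group G] (f : G → ℝ) : Prop :=
  ∃ (V : Type) (_ : AddCommGroup V) (_ : Module ℂ V) (_ : FiniteDimensional ℂ V)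
    (ρ : Representation ℂ G V), ∀ g, ρ.character g = f g

/-- The real-valued function `χ` is an irreducible character. -/
def IsIrr {G : Type} [Group G] (χ : G → ℝ) : Prop :=
  ∃ (V : Type) (_ : AddCommGroup V) (_ : Module ℂ V) (_ : FiniteDimensional ℂ V)
    (ρ : Representation ℂ G V), ρ.IsIrreducible ∧ ∀ g, ρ.character g = χ g

section Basic

variable {G : Type} [Group G]

theorem IsIrr.isRepChar {χ : G → ℝ} (h : IsIrr χ) : IsRepChar χ := by
  obtain ⟨V, i1, i2, i3, ρ, _, h⟩ := h
  exact ⟨V, i1, i2, i3, ρ, h⟩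

theorem IsRepChar.apply_mul_comm {χ : G → ℝ} (h : IsRepChar χ) (a b : G) : χ (a * b) = χ (b * a) := by
  obtain ⟨V, i1, i2, i3, ρ, h⟩ := h
  have := ρ.char_mul_comm a b
  rw [h, h] at this
  exact_mod_cast this.symm

theorem IsRepChar.conj {χ : G → ℝ} (h : IsRepChar χ) (a b : G) : χ (a * b * a⁻¹) = χ b := by
  rw [h.apply_mul_comm]; simp

theorem IsRepChar.eq_of_isConj {χ : G → ℝ} (h : IsRepChar χ) {a b : G} (hab : IsConj a b) :
    χ a = χ b := by
  obtain ⟨c, rfl⟩ := isConj_iff.1 hab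
  rw [h.conj]

theorem IsRepChar.inv [Ambivalent G] {χ : G → ℝ} (h : IsRepChar χ) (a : G) : χ a⁻¹ = χ a :=
  (h.eq_of_isConj (Ambivalent.conj_inv a)).symm

theorem IsRepChar.comp {H : Type} [Group H] (φ : H →* G) {χ : G → ℝ} (h : IsRepChar χ) :
    IsRepChar (fun x => χ (φ x)) := by
  obtain ⟨V, i1, i2, i3, ρ, h⟩ := h
  exact ⟨V, i1, i2, i3, ρ.comp φ, fun g => h (φ g)⟩

theorem IsIrr.exists_one {χ : G → ℝ} (h : IsIrr χ) : ∃ d : ℕ, 0 < d ∧ χ 1 = d := by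
  obtain ⟨V, i1, i2, i3, ρ, hi, h⟩ := h
  refine ⟨Module.finrank ℂ V, ?_, ?_⟩
  · rw [Module.finrank_pos_iff]
    by_contra hV
    rw [not_nontrivial_iff_subsingleton] at hV
    have : (⊥ : Subrepresentation ρ) ≠ ⊤ := bot_ne_top
    apply this
    ext x
    have : x = 0 := Subsingleton.elim _ _
    subst this
    simp
  · have := ρ.char_one
    rw [h] at this
    exact_mod_cast this

theorem IsIrr.one_le {χ : G → ℝ} (h : IsIrr χ) : 1 ≤ χ 1 := by
  obtain ⟨d, hd, h⟩ := h.exists_one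
  rw [h]; exact_mod_cast hd

theorem IsIrr.pos {χ : G → ℝ} (h : IsIrr χ) : 0 < χ 1 := lt_of_lt_of_le one_pos h.one_le

end Basic

section Real

variable {G : Type} [Group G] [Finite G]

open scoped ComplexOrder in
theorem trace_inv_eq_star {n : ℕ} (M : G →* Matrix (Fin n) (Fin n) ℂ) (g : G) :
    (M g⁻¹).trace = star (M g).trace := by
  classical
  have := Fintype.ofFinite G
  set P : Matrix (Fin n) (Fin n) ℂ := ∑ h : G, (M h).conjTranspose * M h with hP
  have hpos : P.PosDef := by
    rw [hP, ← Finset.add_sum_erase _ _ (Finset.mem_univ (1 : G))]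
    apply Matrix.PosDef.add_posSemidef
    · simpa using Matrix.PosDef.one
    · exact Matrix.posSemidef_sum _ fun i _ => Matrix.posSemidef_conjTranspose_mul_self _
  have hunit : IsUnit P := hpos.isUnit
  have hinv : (M g).conjTranspose * P * M g = P := by
    rw [hP, Finset.mul_sum, Finset.sum_mul]
    conv_rhs => rw [← Equiv.sum_comp (Equiv.mulRight g)]
    refine Finset.sum_congr rfl fun h _ => ?_
    simp [Matrix.conjTranspose_mul, Matrix.mul_assoc]
  have h1 : M g * M g⁻¹ = 1 := by rw [← map_mul]; simp
  have h2 : (M g).conjTranspose * P = P * M g⁻¹ := by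
    conv_rhs => rw [← hinv]
    rw [Matrix.mul_assoc, h1, Matrix.mul_one]
  have h3 : M g⁻¹ = P⁻¹ * ((M g).conjTranspose * P) := by
    rw [h2, ← Matrix.mul_assoc, Matrix.nonsing_inv_mul _ ((Matrix.isUnit_iff_isUnit_det _).1 hunit),
      Matrix.one_mul]
  rw [h3, Matrix.trace_mul_comm, Matrix.mul_assoc,
    Matrix.mul_nonsing_inv _ ((Matrix.isUnit_iff_isUnit_det _).1 hunit), Matrix.mul_one,
    Matrix.trace_conjTranspose]

theorem character_inv {V : Type} [AddCommGroup V] [Module ℂ V] [FiniteDimensional ℂ V]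
    (ρ : Representation ℂ G V) (g : G) : ρ.character g⁻¹ = star (ρ.character g) := by
  let b := Module.finBasis ℂ V
  let M : G →* Matrix (Fin (Module.finrank ℂ V)) (Fin (Module.finrank ℂ V)) ℂ :=
    ((LinearMap.toMatrixAlgEquiv b : _ →* _)).comp ρ
  have h : ∀ g, ρ.character g = (M g).trace := fun g => by
    simp only [Representation.character]
    rw [LinearMap.trace_eq_matrix_trace ℂ b]
    rfl
  rw [h, h, trace_inv_eq_star]

theorem character_real [Ambivalent G] {V : Type} [AddCommGroup V] [Module ℂ V]
    [FiniteDimensional ℂ V] (ρ : Representation ℂ G V) (g : G) :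
    ρ.character g = ((ρ.character g).re : ℂ) := by
  have h := character_inv ρ g
  obtain ⟨c, hc⟩ := isConj_iff.1 (Ambivalent.conj_inv g)
  rw [← hc, ρ.char_conj] at h
  exact (Complex.conj_eq_iff_re.1 h.symm).symm

end Real

section Decomp

variable {G : Type} [Group G]

theorem character_eq_add_of_isCompl {V : Type} [AddCommGroup V] [Module ℂ V]
    [FiniteDimensional ℂ V] (ρ : Representation ℂ G V) (p q : Subrepresentation ρ)
    (h : IsCompl p q) (g : G) :
    ρ.character g = p.toRepresentation.character g + q.toRepresentation.character g := by
  have h' : IsCompl p.toSubmodule q.toSubmodule := by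
    constructor
    · rw [disjoint_iff]
      have := h.inf_eq_bot
      exact congrArg Subrepresentation.toSubmodule this
    · rw [codisjoint_iff]
      have := h.sup_eq_top
      exact congrArg Subrepresentation.toSubmodule this
  simp only [Representation.character]
  rw [← LinearMap.trace_prodMap', ← LinearMap.trace_conj' _ (Submodule.prodEquivOfIsCompl _ _ h')]
  congr 1
  ext v
  obtain ⟨⟨x, y⟩, rfl⟩ := (Submodule.prodEquivOfIsCompl _ _ h').surjective v
  simp only [LinearEquiv.conj_apply, LinearMap.comp_apply, LinearEquiv.coe_coe,
    LinearEquiv.symm_apply_apply]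
  simp [Subrepresentation.toRepresentation]

variable [Finite G] [Ambivalent G]

theorem exists_decomp_aux (d : ℕ) : ∀ (V : Type) [AddCommGroup V] [Module ℂ V]
    [FiniteDimensional ℂ V] (ρ : Representation ℂ G V), Module.finrank ℂ V = d →
    ∃ (k : ℕ) (ψ : Fin k → G → ℝ), (∀ i, IsIrr (ψ i)) ∧ ∀ g, ρ.character g = ∑ i, (ψ i g : ℂ) := by
  induction d using Nat.strong_induction_on with
  | _ d ih =>
  intro V _ _ _ ρ hd
  by_cases hV : Subsingleton V
  · refine ⟨0, fun _ _ => 0, fun i => i.elim0, fun g => ?_⟩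
    have : ρ g = 0 := Subsingleton.elim _ _
    simp [Representation.character, this]
  by_cases hirr : ρ.IsIrreducible
  · exact ⟨1, fun _ g => (ρ.character g).re, fun _ => ⟨V, _, _, ‹_›, ρ, hirr, character_real ρ⟩,
      fun g => by simpa using character_real ρ g⟩
  have : Nontrivial V := not_subsingleton_iff_nontrivial.1 hV
  have : Nontrivial (Subrepresentation ρ) := by
    refine ⟨⊥, ⊤, fun h => ?_⟩
    have : (⊥ : Submodule ℂ V) = ⊤ := congrArg Subrepresentation.toSubmodule h
    exact bot_ne_top this
  have : ∃ p : Subrepresentation ρ, p ≠ ⊥ ∧ p ≠ ⊤ := by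
    by_contra! hcon
    apply hirr
    exact ⟨fun a => or_iff_not_imp_left.2 (hcon a)⟩
  obtain ⟨p, hp1, hp2⟩ := this
  have : NeZero (Nat.card G : ℂ) := ⟨by exact_mod_cast Nat.card_pos.ne'⟩
  obtain ⟨q, hq⟩ := exists_isCompl p
  have hlt : ∀ r : Subrepresentation ρ, r ≠ ⊤ → Module.finrank ℂ r.toSubmodule < d := by
    intro r hr
    rw [← hd]
    apply Submodule.finrank_lt
    intro h
    exact hr (Subrepresentation.toSubmodule_injective h)
  have hq2 : q ≠ ⊤ := by
    rintro rfl
    exact hp1 (by simpa using hq.inf_eq_bot)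
  obtain ⟨k1, ψ1, h1, h1'⟩ := ih _ (hlt p hp2) _ p.toRepresentation rfl
  obtain ⟨k2, ψ2, h2, h2'⟩ := ih _ (hlt q hq2) _ q.toRepresentation rfl
  refine ⟨k1 + k2, Fin.append ψ1 ψ2, fun i => ?_, fun g => ?_⟩
  · refine Fin.addCases (fun i => ?_) (fun i => ?_) i
    · simpa using h1 i
    · simpa using h2 i
  · rw [character_eq_add_of_isCompl ρ p q hq, h1', h2', Fin.sum_univ_add]
    simp

theorem IsRepChar.decomp {f : G → ℝ} (h : IsRepChar f) :
    ∃ (k : ℕ) (ψ : Fin k → G → ℝ), (∀ i, IsIrr (ψ i)) ∧ ∀ g, f g = ∑ i, ψ i g := by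
  obtain ⟨V, i1, i2, i3, ρ, h⟩ := h
  obtain ⟨k, ψ, h1, h2⟩ := exists_decomp_aux _ V ρ rfl
  refine ⟨k, ψ, h1, fun g => ?_⟩
  have := h2 g
  rw [h] at this
  exact_mod_cast this

end Decomp

section Ortho

variable {G : Type} [Group G] [Fintype G] [Ambivalent G]

open scoped Classical in
theorem IsIrr.sum_mul {χ ψ : G → ℝ} (hχ : IsIrr χ) (hψ : IsIrr ψ) :
    ∑ g, χ g * ψ g = if χ = ψ then (Fintype.card G : ℝ) else 0 := by
  have hpos := hχ.pos
  have hχ' := hχ.isRepChar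
  have hψ' := hψ.isRepChar
  obtain ⟨V, i1, i2, i3, ρ, hi, h⟩ := hχ
  obtain ⟨W, j1, j2, j3, σ, hj, k⟩ := hψ
  let _ : Invertible (Nat.card G : ℂ) := invertibleOfNonzero (by exact_mod_cast Nat.card_pos.ne')
  have key := Representation.char_orthonormal ρ σ
  have e : ∑ g, ρ.character g * σ.character g⁻¹ = ((∑ g, χ g * ψ g : ℝ) : ℂ) := by
    push_cast
    refine Finset.sum_congr rfl fun g _ => ?_
    rw [h, k, hψ'.inv]
  rw [e] at key
  have hc : (Nat.card G : ℂ) ≠ 0 := by exact_mod_cast Nat.card_pos.ne'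
  rw [inv_mul_eq_iff_eq_mul₀ hc] at key
  by_cases hE : Nonempty (σ.Equiv ρ)
  · have heq : χ = ψ := by
      obtain ⟨E⟩ := hE
      funext g
      have := congrFun (Representation.char_iso E) g
      rw [h, k] at this
      exact_mod_cast this.symm
    rw [if_pos hE] at key
    rw [if_pos heq]
    rw [← Nat.card_eq_fintype_card]
    have : ((∑ g, χ g * ψ g : ℝ) : ℂ) = ((Nat.card G : ℝ) : ℂ) := by rw [key]; simp
    exact_mod_cast this
  · rw [if_neg hE, mul_zero] at key
    have key' : ∑ g, χ g * ψ g = 0 := by exact_mod_cast key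
    rw [key', if_neg]
    rintro rfl
    have := (Finset.sum_eq_zero_iff_of_nonneg (fun g _ => mul_self_nonneg (χ g))).1 key' 1
      (Finset.mem_univ _)
    have := mul_self_eq_zero.1 this
    linarith

theorem IsIrr.sum_sq {χ : G → ℝ} (hχ : IsIrr χ) : ∑ g, χ g * χ g = Fintype.card G := by
  classical
  rw [hχ.sum_mul hχ, if_pos rfl]

theorem IsIrr.sum_mul_of_ne {χ ψ : G → ℝ} (hχ : IsIrr χ) (hψ : IsIrr ψ) (h : χ ≠ ψ) :
    ∑ g, χ g * ψ g = 0 := by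
  classical
  rw [hχ.sum_mul hψ, if_neg h]

theorem IsRepChar.exists_mult {f ψ : G → ℝ} (hf : IsRepChar f) (hψ : IsIrr ψ) :
    ∃ m : ℕ, ∑ g, f g * ψ g = Fintype.card G * m := by
  classical
  obtain ⟨k, φ, h1, h2⟩ := hf.decomp
  refine ⟨(Finset.univ.filter fun i => φ i = ψ).card, ?_⟩
  simp_rw [h2, Finset.sum_mul]
  rw [Finset.sum_comm]
  simp_rw [(h1 _).sum_mul hψ]
  rw [← Finset.sum_filter, Finset.sum_const, nsmul_eq_mul, mul_comm]

theorem IsRepChar.isIrr_of_sum_sq {f : G → ℝ} (hf : IsRepChar f)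
    (h : ∑ g, f g * f g = Fintype.card G) : IsIrr f := by
  classical
  obtain ⟨k, φ, h1, h2⟩ := hf.decomp
  have hcard : (0 : ℝ) < Fintype.card G := by exact_mod_cast Fintype.card_pos
  have e : ∑ g, f g * f g = ∑ i, ∑ j, if φ i = φ j then (Fintype.card G : ℝ) else 0 := by
    have : ∀ g, f g * f g = ∑ i, ∑ j, φ i g * φ j g := fun g => by
      rw [h2, Finset.sum_mul_sum]
    simp_rw [this]
    rw [Finset.sum_comm]
    refine Finset.sum_congr rfl fun i _ => ?_
    rw [Finset.sum_comm]
    exact Finset.sum_congr rfl fun j _ => (h1 i).sum_mul (h1 j)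
  have hge : (k : ℝ) * Fintype.card G ≤ ∑ g, f g * f g := by
    rw [e]
    calc (k : ℝ) * Fintype.card G = ∑ i : Fin k, (Fintype.card G : ℝ) := by simp
      _ ≤ _ := by
        refine Finset.sum_le_sum fun i _ => ?_
        have := Finset.single_le_sum (f := fun j => if φ i = φ j then (Fintype.card G : ℝ) else 0)
          (fun j _ => by positivity) (Finset.mem_univ i)
        simpa using this
  rw [h] at hge
  have hk : k ≤ 1 := by
    have : (k : ℝ) ≤ 1 := by
      by_contra hcon
      push Not at hcon
      nlinarith
    exact_mod_cast this
  interval_cases k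
  · simp only [Finset.univ_eq_empty, Finset.sum_empty] at e
    rw [e] at h
    linarith
  · have : f = φ 0 := by
      funext g
      rw [h2]; simp
    rw [this]
    exact h1 0

end Ortho

section Schur

variable {G : Type} [Group G] [Fintype G]

theorem IsIrr.schur {χ : G → ℝ} (hχ : IsIrr χ) (a b : G) :
    χ 1 * ∑ k, χ (a * (k * b * k⁻¹)) = Fintype.card G * (χ a * χ b) := by
  obtain ⟨V, i1, i2, i3, ρ, hi, h⟩ := hχ
  let A : V →ₗ[ℂ] V := ∑ k, ρ (k * b * k⁻¹)
  have hA : ∀ g, A ∘ₗ ρ g = ρ g ∘ₗ A := by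
    intro g
    change A * ρ g = ρ g * A
    simp only [A, Finset.sum_mul, Finset.mul_sum]
    rw [← Equiv.sum_comp (Equiv.mulLeft g)]
    refine Finset.sum_congr rfl fun k _ => ?_
    rw [← map_mul, ← map_mul]
    congr 1
    simp [mul_assoc]
  let F : Representation.IntertwiningMap ρ ρ := ⟨A, hA⟩
  obtain ⟨c, hc⟩ :=
    (Representation.IsIrreducible.algebraMap_intertwiningMap_bijective_of_isAlgClosed
      (ρ := ρ)).2 F
  have hAc : A = c • (1 : V →ₗ[ℂ] V) := by
    have := congrArg Representation.IntertwiningMap.toLinearMap hc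
    ext v
    have := LinearMap.congr_fun this v
    exact this.symm
  have t1 : (Fintype.card G : ℂ) * χ b = c * χ 1 := by
    have := congrArg (LinearMap.trace ℂ V) hAc
    simp only [A, map_sum, map_smul] at this
    have e1 : ∀ k, LinearMap.trace ℂ V (ρ (k * b * k⁻¹)) = χ b := fun k => by
      rw [← h b, ← ρ.char_conj b k]; rfl
    have e2 : LinearMap.trace ℂ V 1 = χ 1 := by
      rw [← h 1]; simp [Representation.character]
    simp only [e1, e2] at this
    simpa using this
  have t2 : (∑ k, χ (a * (k * b * k⁻¹)) : ℂ) = c * χ a := by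
    have : LinearMap.trace ℂ V (ρ a * A) = c * χ a := by
      rw [hAc, mul_smul_comm, map_smul, mul_one, ← h a]; rfl
    rw [← this]
    simp only [A, Finset.mul_sum, map_sum]
    refine Finset.sum_congr rfl fun k _ => ?_
    rw [← h, Representation.character, map_mul]
  have : ((χ 1 * ∑ k, χ (a * (k * b * k⁻¹)) : ℝ) : ℂ)
      = ((Fintype.card G * (χ a * χ b) : ℝ) : ℂ) := by
    push_cast
    rw [t2]
    linear_combination (-χ a : ℂ) * t1
  exact_mod_cast this

end Schur

section Consequences

variable {G : Type} [Group G] [Fintype G] [Ambivalent G]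

theorem IsIrr.abs_le {χ : G → ℝ} (hχ : IsIrr χ) (g : G) : |χ g| ≤ χ 1 := by
  have hpos := hχ.pos
  obtain ⟨m, -, hm⟩ := Finite.exists_max (fun g => |χ g|) |> fun ⟨m, hm⟩ =>
    (⟨m, trivial, hm⟩ : ∃ m, True ∧ ∀ g, |χ g| ≤ |χ m|)
  refine (hm g).trans ?_
  have h := hχ.schur m m
  have hle : ∑ k, χ (m * (k * m * k⁻¹)) ≤ Fintype.card G * |χ m| := by
    calc _ ≤ ∑ k : G, |χ m| := Finset.sum_le_sum fun k _ => (le_abs_self _).trans (hm _)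
      _ = _ := by simp
  have hcard : (0 : ℝ) < Fintype.card G := by exact_mod_cast Fintype.card_pos
  have h2 : (Fintype.card G : ℝ) * (|χ m| * |χ m|) ≤ Fintype.card G * (χ 1 * |χ m|) := by
    rw [abs_mul_abs_self, ← h]
    nlinarith
  have h3 := le_of_mul_le_mul_left h2 hcard
  by_contra hcon
  push Not at hcon
  have : 0 < |χ m| := hpos.trans hcon
  nlinarith

/-- Convolution of irreducible characters. -/
theorem IsIrr.conv {χ ψ : G → ℝ} (hχ : IsIrr χ) (hψ : IsIrr ψ) (k : G) :
    χ 1 * ∑ g, χ (k * g) * ψ g = χ k * ∑ g, χ g * ψ g := by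
  have hcard : (0 : ℝ) < Fintype.card G := by exact_mod_cast Fintype.card_pos
  have e : (Fintype.card G : ℝ) * ∑ g, χ (k * g) * ψ g
      = ∑ g, (∑ h, χ (k * (h * g * h⁻¹))) * ψ g := by
    simp_rw [Finset.sum_mul]
    rw [Finset.sum_comm]
    rw [← nsmul_eq_mul, ← Finset.card_univ, ← Finset.sum_const]
    refine Finset.sum_congr rfl fun h _ => ?_
    rw [← Equiv.sum_comp (MulAut.conj h).toEquiv]
    refine Finset.sum_congr rfl fun g _ => ?_
    simp [hψ.isRepChar.conj]
  have e2 : χ 1 * (∑ g, (∑ h, χ (k * (h * g * h⁻¹))) * ψ g)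
      = Fintype.card G * (χ k * ∑ g, χ g * ψ g) := by
    rw [Finset.mul_sum, Finset.mul_sum, Finset.mul_sum]
    refine Finset.sum_congr rfl fun g _ => ?_
    rw [← mul_assoc, hχ.schur]; ring
  apply mul_left_cancel₀ hcard.ne'
  rw [← e2, ← e]; ring

theorem IsIrr.conv_self {χ : G → ℝ} (hχ : IsIrr χ) (k : G) :
    χ 1 * ∑ g, χ (k * g) * χ g = Fintype.card G * χ k := by
  rw [hχ.conv hχ, hχ.sum_sq, mul_comm]

/-- If an irreducible character has zero mean on a subgroup, it has zero mean on all cosets. -/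
theorem IsIrr.sum_coset_eq_zero {χ : G → ℝ} (hχ : IsIrr χ) {S : Type} [Group S] [Fintype S]
    (φ : S →* G) (h : ∑ s, χ (φ s) = 0) (g : G) : ∑ s, χ (g * φ s) = 0 := by
  have hpos := hχ.pos
  have key : χ 1 * ∑ g, (∑ s, χ (g * φ s)) * (∑ s, χ (g * φ s)) = 0 := by
    have e1 : ∀ s t, χ 1 * ∑ g, χ (g * φ s) * χ (g * φ t)
        = Fintype.card G * χ (φ (s⁻¹ * t)) := fun s t => by
      rw [← hχ.conv_self, ← Equiv.sum_comp (Equiv.mulRight (φ s)⁻¹)]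
      congr 1
      refine Finset.sum_congr rfl fun g _ => ?_
      simp only [Equiv.coe_mulRight, inv_mul_cancel_right, map_mul, map_inv]
      rw [mul_comm, mul_assoc g, hχ.isRepChar.apply_mul_comm g]
    simp_rw [Finset.sum_mul_sum]
    rw [Finset.sum_comm, Finset.mul_sum]
    have : ∀ s, χ 1 * ∑ g, ∑ t, χ (g * φ s) * χ (g * φ t) = 0 := fun s => by
      rw [Finset.sum_comm, Finset.mul_sum]
      simp_rw [e1]
      rw [← Finset.mul_sum]
      have := Equiv.sum_comp (Equiv.mulLeft s⁻¹) (fun t => χ (φ t))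
      simp only [Equiv.coe_mulLeft] at this
      rw [this, h, mul_zero]
    simp [this]
  have key' := (mul_eq_zero.1 key).resolve_left hpos.ne'
  have := (Finset.sum_eq_zero_iff_of_nonneg (fun g _ => mul_self_nonneg _)).1 key' g
    (Finset.mem_univ _)
  exact mul_self_eq_zero.1 this

theorem linearIndependent_isIrr :
    LinearIndependent ℝ (fun χ : {χ : G → ℝ // IsIrr χ} => χ.1) := by
  classical
  rw [linearIndependent_iff']
  intro s c hc χ hχ
  have h : ∑ g, (∑ ψ ∈ s, c ψ • ψ.1) g * χ.1 g = c χ * Fintype.card G := by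
    simp only [Finset.sum_apply, Pi.smul_apply, smul_eq_mul, Finset.sum_mul]
    rw [Finset.sum_comm]
    simp_rw [mul_assoc, ← Finset.mul_sum]
    rw [Finset.sum_eq_single χ]
    · rw [χ.2.sum_sq]
    · intro ψ _ hne
      rw [ψ.2.sum_mul_of_ne χ.2 (fun h => hne (Subtype.ext h)), mul_zero]
    · exact fun h => absurd hχ h
  rw [hc] at h
  have hcard : (0 : ℝ) < Fintype.card G := by exact_mod_cast Fintype.card_pos
  simp only [Pi.zero_apply, zero_mul, Finset.sum_const_zero] at h
  exact (mul_eq_zero.1 h.symm).resolve_right hcard.ne'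

theorem finite_isIrr : {χ : G → ℝ | IsIrr χ}.Finite :=
  (linearIndependent_isIrr (G := G)).finite

/-- The column bound: the square of a character value is at most the order of the centralizer. -/
theorem IsIrr.sq_mul_card_le {χ : G → ℝ} (hχ : IsIrr χ) (c : G) (s : Finset G)
    (hs : ∀ g ∈ s, IsConj c g) : χ c ^ 2 * s.card ≤ Fintype.card G := by
  rw [← hχ.sum_sq]
  calc χ c ^ 2 * s.card = ∑ g ∈ s, χ g * χ g := by
        rw [mul_comm, ← nsmul_eq_mul, ← Finset.sum_const]
        refine Finset.sum_congr rfl fun g hg => ?_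
        rw [hχ.isRepChar.eq_of_isConj (hs g hg)]; ring
    _ ≤ _ := Finset.sum_le_sum_of_subset_of_nonneg (Finset.subset_univ _)
        fun g _ _ => mul_self_nonneg _

end Consequences

section Twist

variable {G : Type} [Group G]

/-- The representation `ρ` twisted by a sign character `ε`. -/
noncomputable def twistRep {V : Type} [AddCommGroup V] [Module ℂ V] (ε : G →* ℤˣ)
    (ρ : Representation ℂ G V) : Representation ℂ G V where
  toFun g := (((ε g : ℤˣ) : ℤ) : ℂ) • ρ g
  map_one' := by simp
  map_mul' a b := by
    simp only [map_mul, Units.val_mul, Int.cast_mul, smul_mul_smul_comm]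

theorem IsRepChar.twist (ε : G →* ℤˣ) {f : G → ℝ} (h : IsRepChar f) :
    IsRepChar (fun g => ((ε g : ℤ) : ℝ) * f g) := by
  obtain ⟨V, i1, i2, i3, ρ, h⟩ := h
  refine ⟨V, i1, i2, i3, twistRep ε ρ, fun g => ?_⟩
  simp only [Representation.character, twistRep, MonoidHom.coe_mk, OneHom.coe_mk, map_smul,
    smul_eq_mul]
  have := h g
  simp only [Representation.character] at this
  rw [this]
  push_cast
  rfl

theorem sign_mul_self (u : ℤˣ) : ((u : ℤ) : ℝ) * ((u : ℤ) : ℝ) = 1 := by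
  rcases Int.units_eq_one_or u with rfl | rfl <;> simp

theorem isRepChar_one : IsRepChar (fun _ : G => (1 : ℝ)) :=
  ⟨ℂ, inferInstance, inferInstance, inferInstance, Representation.trivial ℂ G ℂ, fun g => by
    simp [Representation.character]⟩

variable [Fintype G] [Ambivalent G]

theorem isIrr_one : IsIrr (fun _ : G => (1 : ℝ)) :=
  isRepChar_one.isIrr_of_sum_sq (by simp)

theorem IsIrr.twist (ε : G →* ℤˣ) {χ : G → ℝ} (h : IsIrr χ) :
    IsIrr (fun g => ((ε g : ℤ) : ℝ) * χ g) := by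
  refine (h.isRepChar.twist ε).isIrr_of_sum_sq ?_
  rw [← h.sum_sq]
  refine Finset.sum_congr rfl fun g _ => ?_
  linear_combination (χ g * χ g) * sign_mul_self (ε g)

theorem isIrr_sign (ε : G →* ℤˣ) : IsIrr (fun g => ((ε g : ℤ) : ℝ)) := by
  simpa using isIrr_one.twist ε

theorem isIrr_of_simple (V : FDRep ℂ G) (hV : Simple V) :
    ∃ χ : G → ℝ, IsIrr χ ∧ ∀ g, V.character g = χ g := by
  have hreal : ∀ g, V.character g = ((V.character g).re : ℂ) := character_real V.ρ
  have hr : IsRepChar (fun g => (V.character g).re) :=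
    ⟨V, inferInstance, inferInstance, inferInstance, V.ρ, fun g => hreal g⟩
  refine ⟨fun g => (V.character g).re, hr.isIrr_of_sum_sq ?_, hreal⟩
  have h := (FDRep.simple_iff_char_is_norm_one V).1 hV
  have : ((∑ g, (V.character g).re * (V.character g).re : ℝ) : ℂ) = Fintype.card G := by
    rw [← Nat.card_eq_fintype_card, ← h]
    push_cast
    refine Finset.sum_congr rfl fun g _ => ?_
    rw [← hreal g, hreal g⁻¹]
    have := hr.inv g
    rw [this, ← hreal]
  exact_mod_cast this

end Twist

section Product

variable {G H : Type} [Group G] [Group H]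

instance [Ambivalent G] [Ambivalent H] : Ambivalent (G × H) where
  conj_inv g := by
    obtain ⟨c, hc⟩ := isConj_iff.1 (Ambivalent.conj_inv g.1)
    obtain ⟨d, hd⟩ := isConj_iff.1 (Ambivalent.conj_inv g.2)
    exact isConj_iff.2 ⟨(c, d), Prod.ext hc hd⟩

instance {α : Type} [Fintype α] [DecidableEq α] : Ambivalent (Equiv.Perm α) where
  conj_inv g := by
    rw [Equiv.Perm.isConj_iff_cycleType_eq, Equiv.Perm.cycleType_inv]

theorem IsRepChar.conv [Fintype G] [Ambivalent G] {f ψ : G → ℝ} (hf : IsRepChar f) (hψ : IsIrr ψ)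
    (k : G) : ψ 1 * ∑ g, f (k * g) * ψ g = ψ k * ∑ g, f g * ψ g := by
  obtain ⟨m, φ, h1, h2⟩ := hf.decomp
  simp_rw [h2, Finset.sum_mul]
  rw [Finset.sum_comm, Finset.sum_comm (f := fun g i => φ i g * ψ g), Finset.mul_sum,
    Finset.mul_sum]
  refine Finset.sum_congr rfl fun i _ => ?_
  by_cases h : φ i = ψ
  · rw [h]; exact hψ.conv hψ k
  · have h3 := (h1 i).conv hψ k
    rw [(h1 i).sum_mul_of_ne hψ h, mul_zero] at h3
    rw [(h1 i).sum_mul_of_ne hψ h, (mul_eq_zero.1 h3).resolve_left (h1 i).pos.ne', mul_zero,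
      mul_zero]

/-- A character satisfying the spherical function identity is a multiple of an irreducible. -/
theorem IsRepChar.exists_irr_of_spherical [Fintype G] [Ambivalent G] {f : G → ℝ}
    (hf : IsRepChar f) (h1 : 0 < f 1)
    (h : ∀ a b, f 1 * ∑ k, f (a * (k * b * k⁻¹)) = Fintype.card G * (f a * f b)) :
    ∃ ψ : G → ℝ, IsIrr ψ ∧ ∀ s, f s * ψ 1 = f 1 * ψ s := by
  obtain ⟨m, φ, hφ, hsum⟩ := hf.decomp
  have hm : m ≠ 0 := by
    rintro rfl
    rw [hsum] at h1
    simp at h1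
  let i0 : Fin m := ⟨0, Nat.pos_of_ne_zero hm⟩
  set ψ := φ i0 with hψdef
  have hψ : IsIrr ψ := hφ i0
  have hcard : (0 : ℝ) < Fintype.card G := by exact_mod_cast Fintype.card_pos
  refine ⟨ψ, hψ, fun a => ?_⟩
  set c := ∑ g, f g * ψ g with hc
  have hcpos : 0 < c := by
    classical
    have : c = ∑ i, if φ i = ψ then (Fintype.card G : ℝ) else 0 := by
      rw [hc]
      simp_rw [hsum, Finset.sum_mul]
      rw [Finset.sum_comm]
      exact Finset.sum_congr rfl fun i _ => (hφ i).sum_mul hψ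
    rw [this]
    have h3 := Finset.single_le_sum (f := fun i => if φ i = ψ then (Fintype.card G : ℝ) else 0)
      (fun j _ => by positivity) (Finset.mem_univ i0)
    simp only [← hψdef, if_true] at h3
    linarith
  have e : (Fintype.card G : ℝ) * ∑ g, f (a * g) * ψ g
      = ∑ g, (∑ k, f (a * (k * g * k⁻¹))) * ψ g := by
    simp_rw [Finset.sum_mul]
    rw [Finset.sum_comm, ← nsmul_eq_mul, ← Finset.card_univ, ← Finset.sum_const]
    refine Finset.sum_congr rfl fun k _ => ?_
    rw [← Equiv.sum_comp (MulAut.conj k).toEquiv]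
    refine Finset.sum_congr rfl fun g _ => ?_
    simp [hψ.isRepChar.conj]
  have e2 : f 1 * ((Fintype.card G : ℝ) * ∑ g, f (a * g) * ψ g)
      = Fintype.card G * (f a * c) := by
    rw [e, hc, Finset.mul_sum, Finset.mul_sum, Finset.mul_sum]
    refine Finset.sum_congr rfl fun g _ => ?_
    rw [← mul_assoc, h]; ring
  have e3 := hf.conv hψ a
  rw [← hc] at e3
  apply mul_right_cancel₀ (mul_ne_zero hcpos.ne' hcard.ne')
  linear_combination (-ψ 1) * e2 + f 1 * Fintype.card G * e3

variable [Fintype G] [Fintype H] [Ambivalent G] [Ambivalent H]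

theorem IsIrr.exists_prod {X : G × H → ℝ} (hX : IsIrr X) :
    ∃ (ψ : G → ℝ) (φ : H → ℝ), IsIrr ψ ∧ IsIrr φ ∧
      ∀ s t, X (s, t) * (ψ 1 * φ 1) = X 1 * (ψ s * φ t) := by
  have hpos := hX.pos
  have hG : (0 : ℝ) < Fintype.card G := by exact_mod_cast Fintype.card_pos
  have hH : (0 : ℝ) < Fintype.card H := by exact_mod_cast Fintype.card_pos
  have hone : X (1, 1) = X 1 := rfl
  have hmul : ∀ s t, X 1 * X (s, t) = X (s, 1) * X (1, t) := by
    intro s t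
    have h := hX.schur (s, 1) (1, t)
    have e : ∀ k : G × H, X ((s, 1) * (k * (1, t) * k⁻¹)) = X (s, t) := by
      intro k
      rw [← hX.isRepChar.conj (1, k.2) (s, t)]
      congr 1
      ext <;> simp
    simp only [e, Finset.sum_const, Finset.card_univ, nsmul_eq_mul] at h
    have hc : (Fintype.card (G × H) : ℝ) ≠ 0 := by
      rw [Fintype.card_prod]; push_cast; positivity
    apply mul_left_cancel₀ hc
    linarith
  obtain ⟨ψ, hψ, h1⟩ := (hX.isRepChar.comp (MonoidHom.inl G H)).exists_irr_of_spherical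
    (by simpa [hone] using hpos) (fun a b => by
      have h := hX.schur (a, 1) (b, 1)
      rw [Fintype.sum_prod_type] at h
      simp only [Prod.mk_mul_mk, Prod.inv_mk, mul_one, mul_inv_cancel, Finset.sum_const,
        Finset.card_univ, nsmul_eq_mul, Fintype.card_prod, Nat.cast_mul] at h
      rw [← Finset.mul_sum] at h
      simp only [MonoidHom.inl_apply, hone]
      apply mul_left_cancel₀ hH.ne'
      linarith)
  obtain ⟨φ, hφ, h2⟩ := (hX.isRepChar.comp (MonoidHom.inr G H)).exists_irr_of_spherical
    (by simpa [hone] using hpos) (fun a b => by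
      have h := hX.schur (1, a) (1, b)
      rw [Fintype.sum_prod_type] at h
      simp only [Prod.mk_mul_mk, Prod.inv_mk, mul_one, mul_inv_cancel, Finset.sum_const,
        Finset.card_univ, nsmul_eq_mul, Fintype.card_prod, Nat.cast_mul] at h
      simp only [MonoidHom.inr_apply, hone]
      apply mul_left_cancel₀ hG.ne'
      linarith)
  refine ⟨ψ, φ, hψ, hφ, fun s t => ?_⟩
  have h1s := h1 s
  have h2t := h2 t
  simp only [MonoidHom.inl_apply, MonoidHom.inr_apply, hone] at h1s h2t
  apply mul_left_cancel₀ hpos.ne'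
  linear_combination (ψ 1 * φ 1) * hmul s t + X (1, t) * φ 1 * h1s + X 1 * ψ s * h2t

end Product

section Strict

/-- The sign of a permutation as a real number. -/
def sg {n : ℕ} (σ : Equiv.Perm (Fin n)) : ℝ := ((Equiv.Perm.sign σ : ℤ) : ℝ)

/-- The trivial and the sign character. -/
def IsLin {n : ℕ} (χ : Equiv.Perm (Fin n) → ℝ) : Prop := χ = (fun _ => 1) ∨ χ = sg

theorem sg_mul {n : ℕ} (σ τ : Equiv.Perm (Fin n)) : sg (σ * τ) = sg σ * sg τ := by
  simp [sg]

theorem sg_one {n : ℕ} : sg (1 : Equiv.Perm (Fin n)) = 1 := by simp [sg]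

theorem sg_mul_self {n : ℕ} (σ : Equiv.Perm (Fin n)) : sg σ * sg σ = 1 := sign_mul_self _

theorem sg_eq {n : ℕ} (σ : Equiv.Perm (Fin n)) : sg σ = 1 ∨ sg σ = -1 := by
  have := sg_mul_self σ
  rwa [mul_self_eq_one_iff] at this

theorem abs_sg {n : ℕ} (σ : Equiv.Perm (Fin n)) : |sg σ| = 1 := by
  rcases sg_eq σ with h | h <;> simp [h]

theorem isIrr_sg {n : ℕ} : IsIrr (sg : Equiv.Perm (Fin n) → ℝ) := isIrr_sign Equiv.Perm.sign

theorem IsIrr.sg_mul {n : ℕ} {χ : Equiv.Perm (Fin n) → ℝ} (h : IsIrr χ) :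
    IsIrr (fun σ => sg σ * χ σ) := h.twist Equiv.Perm.sign

theorem sg_mul_sg_mul {n : ℕ} (χ : Equiv.Perm (Fin n) → ℝ) :
    (fun σ => sg σ * (sg σ * χ σ)) = χ := by
  funext σ
  rw [← mul_assoc, sg_mul_self, one_mul]

theorem IsIrr.sum_eq_zero {n : ℕ} {χ : Equiv.Perm (Fin n) → ℝ} (h : IsIrr χ) (h0 : ¬ IsLin χ) :
    ∑ σ, χ σ = 0 := by
  have := h.sum_mul_of_ne isIrr_one (fun e => h0 (Or.inl e))
  simpa using this

theorem IsIrr.sum_mul_sg_eq_zero {n : ℕ} {χ : Equiv.Perm (Fin n) → ℝ} (h : IsIrr χ)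
    (h0 : ¬ IsLin χ) : ∑ σ, χ σ * sg σ = 0 :=
  h.sum_mul_of_ne isIrr_sg (fun e => h0 (Or.inr e))

theorem IsIrr.abs_lt {n : ℕ} (hn : 5 ≤ n) {χ : Equiv.Perm (Fin n) → ℝ} (hχ : IsIrr χ)
    (h0 : ¬ IsLin χ) {σ : Equiv.Perm (Fin n)} (hσ : σ ≠ 1) : |χ σ| < χ 1 := by
  refine lt_of_le_of_ne (hχ.abs_le σ) fun heq => ?_
  have hpos := hχ.pos
  have hcard : (0 : ℝ) < Fintype.card (Equiv.Perm (Fin n)) := by exact_mod_cast Fintype.card_pos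
  have hle : ∀ g, χ g ≤ χ 1 := fun g => (le_abs_self _).trans (hχ.abs_le g)
  have key : ∀ a b, χ a * χ b = χ 1 * χ 1 → ∀ k, χ (a * (k * b * k⁻¹)) = χ 1 := by
    intro a b hab
    have h := hχ.schur a b
    rw [hab] at h
    have h2 : ∑ k, χ (a * (k * b * k⁻¹)) = ∑ k : Equiv.Perm (Fin n), χ 1 := by
      simp only [Finset.sum_const, Finset.card_univ, nsmul_eq_mul]
      apply mul_left_cancel₀ hpos.ne'
      linarith
    have h3 := (Finset.sum_eq_sum_iff_of_le (fun k _ => hle (a * (k * b * k⁻¹)))).1 h2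
    exact fun k => h3 k (Finset.mem_univ _)
  let K : Subgroup (Equiv.Perm (Fin n)) :=
    { carrier := {g | χ g = χ 1}
      one_mem' := rfl
      mul_mem' := by
        intro a b ha hb
        have := key a b (by rw [show χ a = χ 1 from ha, show χ b = χ 1 from hb]) 1
        simpa using this
      inv_mem' := by
        intro a ha
        exact (hχ.isRepChar.inv a).trans ha }
  have hK : ∀ g, g ∈ K ↔ χ g = χ 1 := fun g => Iff.rfl
  have hnormal : K.Normal := ⟨fun a ha g => by
    rw [hK, hχ.isRepChar.conj]; exact ha⟩
  have hmem : ∀ k, σ * (k * σ * k⁻¹) ∈ K := fun k => by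
    rw [hK]
    exact key σ σ (by rw [← abs_mul_abs_self, heq]) k
  have hnt : Nontrivial K := by
    rw [Subgroup.nontrivial_iff_ne_bot]
    intro hbot
    have h1 : ∀ k, σ * (k * σ * k⁻¹) = 1 := fun k => by
      have := hmem k
      rwa [hbot, Subgroup.mem_bot] at this
    apply hσ
    have hcomm : ∀ k, k * σ = σ * k := by
      intro k
      have e1 := h1 1
      have e2 := h1 k
      simp only [one_mul, inv_one, mul_one] at e1
      rw [← e1] at e2
      have := mul_left_cancel e2
      rw [mul_inv_eq_iff_eq_mul] at this
      exact this
    by_contra hne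
    obtain ⟨x, hx⟩ : ∃ x, σ x ≠ x := by
      by_contra! hcon
      exact hne (Equiv.ext hcon)
    obtain ⟨z, hz⟩ : ∃ z, z ∉ ({x, σ x} : Finset (Fin n)) := by
      obtain ⟨z, -, hz⟩ := Finset.exists_mem_notMem_of_card_lt_card (s := {x, σ x})
        (t := Finset.univ) (lt_of_le_of_lt Finset.card_le_two (by simp; omega))
      exact ⟨z, hz⟩
    simp only [Finset.mem_insert, Finset.mem_singleton, not_or] at hz
    have := congrArg (fun f => f x) (hcomm (Equiv.swap (σ x) z))
    simp only [Equiv.Perm.mul_apply, Equiv.swap_apply_left] at this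
    rw [Equiv.swap_apply_of_ne_of_ne hx.symm (Ne.symm hz.1)] at this
    exact hz.2 this
  have hA := Equiv.Perm.alternatingGroup_le_of_normal (by simpa using hn) hnt
  have hs : ∑ g, (χ g + χ g * sg g) = ∑ g : Equiv.Perm (Fin n), (χ 1 + χ 1 * sg g) := by
    refine Finset.sum_congr rfl fun g _ => ?_
    rcases Int.units_eq_one_or (Equiv.Perm.sign g) with h | h
    · have : χ g = χ 1 := (hK g).1 (hA (Equiv.Perm.mem_alternatingGroup.2 h))
      rw [this]
    · simp [sg, h]
  rw [Finset.sum_add_distrib, hχ.sum_eq_zero h0, hχ.sum_mul_sg_eq_zero h0] at hs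
  have hge : ∀ g : Equiv.Perm (Fin n), 0 ≤ χ 1 + χ 1 * sg g := fun g => by
    rcases sg_eq g with h | h <;> rw [h] <;> linarith
  have := (Finset.sum_eq_zero_iff_of_nonneg (fun g _ => hge g)).1 (by simpa using hs.symm) 1
    (Finset.mem_univ _)
  rw [sg_one] at this
  linarith

end Strict

section Avg

variable {G : Type} [Group G] [Fintype G]

/-- The average of a function over a finite group. -/
noncomputable def avg (f : G → ℝ) : ℝ := (∑ g, f g) / Fintype.card G

theorem card_pos' : (0 : ℝ) < Fintype.card G := by exact_mod_cast Fintype.card_pos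

theorem avg_add (f g : G → ℝ) : avg (fun x => f x + g x) = avg f + avg g := by
  simp [avg, Finset.sum_add_distrib, add_div]

theorem avg_sub (f g : G → ℝ) : avg (fun x => f x - g x) = avg f - avg g := by
  simp [avg, Finset.sum_sub_distrib, sub_div]

theorem avg_mul_left (c : ℝ) (f : G → ℝ) : avg (fun x => c * f x) = c * avg f := by
  simp [avg, ← Finset.mul_sum, mul_div_assoc]

theorem avg_const (c : ℝ) : avg (fun _ : G => c) = c := by
  have := card_pos' (G := G)
  simp [avg]

theorem avg_sum {ι : Type} (s : Finset ι) (f : ι → G → ℝ) :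
    avg (fun x => ∑ i ∈ s, f i x) = ∑ i ∈ s, avg (f i) := by
  simp only [avg]
  rw [Finset.sum_comm, Finset.sum_div]

theorem avg_le_avg {f g : G → ℝ} (h : ∀ x, f x ≤ g x) : avg f ≤ avg g := by
  have := card_pos' (G := G)
  unfold avg
  gcongr
  exact h _

variable [Ambivalent G]

theorem IsRepChar.exists_avg_mul {f ψ : G → ℝ} (hf : IsRepChar f) (hψ : IsIrr ψ) :
    ∃ m : ℕ, avg (fun g => f g * ψ g) = m := by
  obtain ⟨m, hm⟩ := hf.exists_mult hψ
  refine ⟨m, ?_⟩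
  have := card_pos' (G := G)
  rw [avg, hm]
  field_simp

theorem IsRepChar.exists_avg {f : G → ℝ} (hf : IsRepChar f) : ∃ m : ℕ, avg f = m := by
  obtain ⟨m, hm⟩ := hf.exists_avg_mul isIrr_one
  exact ⟨m, by simpa using hm⟩

theorem IsRepChar.one_le_avg {f : G → ℝ} (hf : IsRepChar f) (h : 0 < avg f) : 1 ≤ avg f := by
  obtain ⟨m, hm⟩ := hf.exists_avg
  rw [hm] at h ⊢
  exact_mod_cast h

theorem IsIrr.avg_sq {χ : G → ℝ} (h : IsIrr χ) : avg (fun g => χ g * χ g) = 1 := by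
  have := card_pos' (G := G)
  rw [avg, h.sum_sq]
  field_simp

theorem IsIrr.avg_mul_of_ne {χ ψ : G → ℝ} (hχ : IsIrr χ) (hψ : IsIrr ψ) (h : χ ≠ ψ) :
    avg (fun g => χ g * ψ g) = 0 := by
  rw [avg, hχ.sum_mul_of_ne hψ h, zero_div]

theorem IsIrr.eq_of_avg {χ f : G → ℝ} (hχ : IsIrr χ) (hf : avg (fun g => f g * f g) = 1)
    (h : 1 ≤ avg (fun g => f g * χ g)) : χ = f := by
  have h1 : avg (fun g => (χ g - f g) * (χ g - f g)) ≤ 0 := by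
    have : (fun g => (χ g - f g) * (χ g - f g))
        = fun g => (χ g * χ g + f g * f g) - 2 * (f g * χ g) := by
      funext g; ring
    rw [this, avg_sub, avg_add, avg_mul_left, hf, hχ.avg_sq]
    linarith
  have h2 : ∑ g, (χ g - f g) * (χ g - f g) ≤ 0 := by
    rw [avg, div_le_iff₀ card_pos'] at h1
    linarith
  have h3 := (Finset.sum_eq_zero_iff_of_nonneg (s := Finset.univ)
    (fun g _ => mul_self_nonneg (χ g - f g))).1
    (le_antisymm h2 (Finset.sum_nonneg fun g _ => mul_self_nonneg _))
  funext g
  have := h3 g (Finset.mem_univ _)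
  have := mul_self_eq_zero.1 this
  linarith

end Avg

section Iota

open Equiv.Perm (decomposeFin)

/-- The embedding of `S_n` in `S_{n+1}` fixing `0`. -/
def iota {n : ℕ} : Equiv.Perm (Fin n) →* Equiv.Perm (Fin (n + 1)) where
  toFun s := decomposeFin.symm (0, s)
  map_one' := by
    ext x
    refine Fin.cases ?_ (fun i => ?_) x <;> simp
  map_mul' s t := by
    ext x
    refine Fin.cases ?_ (fun i => ?_) x <;> simp

@[simp] theorem iota_zero {n : ℕ} (s : Equiv.Perm (Fin n)) : iota s 0 = 0 := by
  simp [iota]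

@[simp] theorem iota_succ {n : ℕ} (s : Equiv.Perm (Fin n)) (i : Fin n) :
    iota s i.succ = (s i).succ := by
  simp [iota]

@[simp] theorem iota_iota_one {n : ℕ} (s : Equiv.Perm (Fin n)) : iota (iota s) 1 = 1 := by
  have := iota_succ (iota s) 0
  simpa using this

theorem sg_iota {n : ℕ} (s : Equiv.Perm (Fin n)) : sg (iota s) = sg s := by
  simp [sg, iota, Equiv.Perm.decomposeFin.symm_sign]

theorem sum_perm_succ {n : ℕ} (F : Equiv.Perm (Fin (n + 1)) → ℝ) :
    (∑ σ, if σ 0 = 0 then F σ else 0) = ∑ s, F (iota s) := by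
  rw [← Equiv.sum_comp decomposeFin.symm, Fintype.sum_prod_type]
  simp only [Equiv.Perm.decomposeFin_symm_apply_zero]
  rw [Finset.sum_eq_single 0]
  · simp [iota]
  · intro b _ hb; simp [hb]
  · simp

/-- Functions constant on conjugacy classes. -/
def IsClass {G : Type} [Group G] (F : G → ℝ) : Prop := ∀ a b, F (a * b * a⁻¹) = F b

theorem IsRepChar.isClass {G : Type} [Group G] {F : G → ℝ} (h : IsRepChar F) : IsClass F := h.conj

theorem IsClass.eq_of_isConj {G : Type} [Group G] {F : G → ℝ} (h : IsClass F) {a b : G}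
    (hab : IsConj a b) : F a = F b := by
  obtain ⟨c, rfl⟩ := isConj_iff.1 hab
  exact (h c a).symm

theorem sum_card_filter {G α : Type} [Group G] [Fintype G] {F : G → ℝ} (hF : IsClass F)
    (X : Finset α) (P : G → α → Prop) [∀ g x, Decidable (P g x)] (x₀ : α)
    (hX : ∀ x ∈ X, ∃ g, ∀ σ, P (g * σ * g⁻¹) x ↔ P σ x₀) :
    ∑ σ, (∑ x ∈ X, if P σ x then (1 : ℝ) else 0) * F σ
      = X.card * ∑ σ, if P σ x₀ then F σ else 0 := by
  simp_rw [Finset.sum_mul, ite_mul, one_mul, zero_mul]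
  rw [Finset.sum_comm, ← nsmul_eq_mul, ← Finset.sum_const]
  refine Finset.sum_congr rfl fun x hx => ?_
  obtain ⟨g, hg⟩ := hX x hx
  rw [← Equiv.sum_comp (MulAut.conj g).toEquiv]
  refine Finset.sum_congr rfl fun σ _ => ?_
  simp [hg, hF g σ]

/-- Number of fixed points. -/
noncomputable def c1 {n : ℕ} (σ : Equiv.Perm (Fin n)) : ℝ := ∑ x, if σ x = x then 1 else 0

/-- Number of points on 2-cycles. -/
noncomputable def d2 {n : ℕ} (σ : Equiv.Perm (Fin n)) : ℝ :=
  ∑ x, if σ (σ x) = x ∧ σ x ≠ x then 1 else 0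

theorem c1_nonneg {n : ℕ} (σ : Equiv.Perm (Fin n)) : 0 ≤ c1 σ :=
  Finset.sum_nonneg fun x _ => by split_ifs <;> norm_num

theorem d2_nonneg {n : ℕ} (σ : Equiv.Perm (Fin n)) : 0 ≤ d2 σ :=
  Finset.sum_nonneg fun x _ => by split_ifs <;> norm_num

theorem c1_add_d2_le {n : ℕ} (σ : Equiv.Perm (Fin n)) : c1 σ + d2 σ ≤ n := by
  rw [c1, d2, ← Finset.sum_add_distrib]
  calc _ ≤ ∑ _x : Fin n, (1 : ℝ) := Finset.sum_le_sum fun x _ => by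
        split_ifs <;> simp_all
    _ = n := by simp

@[simp] theorem c1_one {n : ℕ} : c1 (1 : Equiv.Perm (Fin n)) = n := by simp [c1]

@[simp] theorem d2_one {n : ℕ} : d2 (1 : Equiv.Perm (Fin n)) = 0 := by simp [d2]

theorem isClass_c1 {n : ℕ} : IsClass (c1 : Equiv.Perm (Fin n) → ℝ) := by
  intro a b
  unfold c1
  rw [← Equiv.sum_comp a]
  simp

theorem isClass_d2 {n : ℕ} : IsClass (d2 : Equiv.Perm (Fin n) → ℝ) := by
  intro a b
  unfold d2
  rw [← Equiv.sum_comp a]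
  simp

theorem c1_iota {n : ℕ} (s : Equiv.Perm (Fin n)) : c1 (iota s) = c1 s + 1 := by
  rw [c1, Fin.sum_univ_succ]
  simp [c1, add_comm]

theorem d2_iota {n : ℕ} (s : Equiv.Perm (Fin n)) : d2 (iota s) = d2 s := by
  rw [d2, Fin.sum_univ_succ]
  simp [d2]

/-- The transposition of `0` and `1`. -/
def tau {n : ℕ} : Equiv.Perm (Fin (n + 2)) := Equiv.swap 0 1

@[simp] theorem tau_zero {n : ℕ} : (tau : Equiv.Perm (Fin (n + 2))) 0 = 1 :=
  Equiv.swap_apply_left _ _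

@[simp] theorem tau_one {n : ℕ} : (tau : Equiv.Perm (Fin (n + 2))) 1 = 0 :=
  Equiv.swap_apply_right _ _

@[simp] theorem tau_succ_succ {n : ℕ} (i : Fin n) :
    (tau : Equiv.Perm (Fin (n + 2))) i.succ.succ = i.succ.succ := by
  apply Equiv.swap_apply_of_ne_of_ne
  · exact Fin.succ_ne_zero _
  · rw [← Fin.succ_zero_eq_one, Ne, Fin.succ_inj]
    exact Fin.succ_ne_zero _

@[simp] theorem tau_tau {n : ℕ} : (tau : Equiv.Perm (Fin (n + 2))) * tau = 1 :=
  Equiv.swap_mul_self _ _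

@[simp] theorem sg_tau {n : ℕ} : sg (tau : Equiv.Perm (Fin (n + 2))) = -1 := by
  simp [sg, tau]

theorem c1_tau_iota {n : ℕ} (s : Equiv.Perm (Fin n)) :
    c1 (tau * iota (iota s)) = c1 s := by
  rw [c1, Fin.sum_univ_succ, Fin.sum_univ_succ, Fin.succ_zero_eq_one]
  simp [c1]

theorem d2_tau_iota {n : ℕ} (s : Equiv.Perm (Fin n)) :
    d2 (tau * iota (iota s)) = d2 s + 2 := by
  rw [d2, Fin.sum_univ_succ, Fin.sum_univ_succ, Fin.succ_zero_eq_one]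
  simp [d2]
  ring

theorem card_perm_fin (n : ℕ) : (Fintype.card (Equiv.Perm (Fin n)) : ℝ) = n.factorial := by
  rw [Fintype.card_perm, Fintype.card_fin]

theorem avg_c1_mul {n : ℕ} {F : Equiv.Perm (Fin (n + 1)) → ℝ} (hF : IsClass F) :
    avg (fun σ => c1 σ * F σ) = avg (fun s => F (iota s)) := by
  have h := sum_card_filter hF (Finset.univ : Finset (Fin (n + 1))) (fun σ x => σ x = x) 0
    (fun x _ => ⟨Equiv.swap 0 x, fun σ => by
      simp [Equiv.swap_apply_eq_iff]⟩)
  rw [sum_perm_succ] at h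
  rw [avg, avg, card_perm_fin, card_perm_fin, Nat.factorial_succ, Nat.cast_mul]
  simp only [c1]
  rw [h]
  have : (n.factorial : ℝ) ≠ 0 := by exact_mod_cast n.factorial_ne_zero
  simp
  field_simp

theorem d2_eq_sum {n : ℕ} (σ : Equiv.Perm (Fin n)) : d2 σ =
    ∑ p ∈ (Finset.univ : Finset (Fin n)).offDiag, if σ p.1 = p.2 ∧ σ p.2 = p.1 then 1 else 0 := by
  have hX : (Finset.univ : Finset (Fin n)).offDiag
      = (Finset.univ ×ˢ Finset.univ).filter fun p => p.1 ≠ p.2 := by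
    ext p; simp
  rw [hX, Finset.sum_filter, Finset.univ_product_univ,
    Fintype.sum_prod_type, d2]
  refine Finset.sum_congr rfl fun x _ => ?_
  rw [Finset.sum_eq_single (σ x)]
  · by_cases h : σ x = x
    · simp [h]
    · simp [h, Ne.symm h]
  · intro b _ hb
    simp [Ne.symm hb]
  · simp

theorem exists_perm_pair {n : ℕ} {x y : Fin (n + 2)} (h : x ≠ y) :
    ∃ g : Equiv.Perm (Fin (n + 2)), g 0 = x ∧ g 1 = y := by
  refine ⟨Equiv.swap (Equiv.swap 0 x 1) y * Equiv.swap 0 x, ?_, ?_⟩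
  · rw [Equiv.Perm.mul_apply, Equiv.swap_apply_left, Equiv.swap_apply_of_ne_of_ne _ h]
    intro h1
    rw [eq_comm, Equiv.swap_apply_eq_iff, Equiv.swap_apply_right] at h1
    simp at h1
  · rw [Equiv.Perm.mul_apply, Equiv.swap_apply_left]

theorem avg_d2_mul {n : ℕ} {F : Equiv.Perm (Fin (n + 2)) → ℝ} (hF : IsClass F) :
    avg (fun σ => d2 σ * F σ) = avg (fun s => F (tau * iota (iota s))) := by
  have h := sum_card_filter hF (Finset.univ : Finset (Fin (n + 2))).offDiag
    (fun σ p => σ p.1 = p.2 ∧ σ p.2 = p.1) (0, 1)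
    (fun p hp => by
      obtain ⟨g, h0, h1⟩ := exists_perm_pair (Finset.mem_offDiag.1 hp).2.2
      have h0' : g⁻¹ p.1 = 0 := by rw [← h0]; simp
      have h1' : g⁻¹ p.2 = 1 := by rw [← h1]; simp
      refine ⟨g, fun σ => ?_⟩
      simp only [Equiv.Perm.mul_apply, h0', h1']
      rw [← h0, ← h1]
      simp)
  have h2 : (∑ σ : Equiv.Perm (Fin (n + 2)), if σ 0 = 1 ∧ σ 1 = 0 then F σ else 0)
      = ∑ s, F (tau * iota (iota s)) := by
    rw [← Equiv.sum_comp (Equiv.mulLeft tau),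
      ← sum_perm_succ (fun s => F (tau * iota s)),
      show (∑ s : Equiv.Perm (Fin (n + 1)), if s 0 = 0 then F (tau * iota s) else 0)
        = ∑ s : Equiv.Perm (Fin (n + 1)), if (iota s) 1 = 1 then F (tau * iota s) else 0 from ?_,
      ← sum_perm_succ (fun s => if s 1 = 1 then F (tau * s) else 0)]
    · refine Finset.sum_congr rfl fun σ _ => ?_
      have e0 : (tau * σ : Equiv.Perm (Fin (n + 2))) 0 = 1 ↔ σ 0 = 0 := by
        rw [Equiv.Perm.mul_apply, ← tau_zero, tau.injective.eq_iff]
      have e1 : (tau * σ : Equiv.Perm (Fin (n + 2))) 1 = 0 ↔ σ 1 = 1 := by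
        rw [Equiv.Perm.mul_apply, ← tau_one, tau.injective.eq_iff]
      simp only [Equiv.coe_mulLeft, e0, e1, ite_and]
    · refine Finset.sum_congr rfl fun σ _ => ?_
      have : (iota σ) 1 = 1 ↔ σ 0 = 0 := by
        rw [← Fin.succ_zero_eq_one, iota_succ, Fin.succ_inj]
      simp only [this]
  rw [h2] at h
  rw [avg, avg, card_perm_fin, card_perm_fin, Nat.factorial_succ, Nat.factorial_succ, Nat.cast_mul,
    Nat.cast_mul]
  simp only [d2_eq_sum]
  rw [h]
  have : (n.factorial : ℝ) ≠ 0 := by exact_mod_cast n.factorial_ne_zero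
  have hc : ((Finset.univ : Finset (Fin (n + 2))).offDiag.card : ℝ) = (n + 2) * (n + 1) := by
    rw [Finset.offDiag_card, Nat.cast_sub (by simp)]
    simp
    ring
  rw [hc]
  push_cast
  have h3 : (n : ℝ) + 1 + 1 ≠ 0 := by positivity
  have h4 : (n : ℝ) + 1 ≠ 0 := by positivity
  field_simp
  ring

end Iota

section Low

variable {n : ℕ}

/-- The standard character. -/
noncomputable def std (σ : Equiv.Perm (Fin n)) : ℝ := c1 σ - 1

/-- The character of the partition `(n-2,2)`. -/
noncomputable def psiS (σ : Equiv.Perm (Fin n)) : ℝ := c1 σ * (c1 σ - 3) / 2 + d2 σ / 2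

/-- The character of the partition `(n-2,1,1)`. -/
noncomputable def psiE (σ : Equiv.Perm (Fin n)) : ℝ := (c1 σ - 1) * (c1 σ - 2) / 2 - d2 σ / 2

/-- The product of a function with the sign. -/
def tw (χ : Equiv.Perm (Fin n) → ℝ) : Equiv.Perm (Fin n) → ℝ := fun σ => sg σ * χ σ

theorem tw_tw (χ : Equiv.Perm (Fin n) → ℝ) : tw (tw χ) = χ := sg_mul_sg_mul χ

theorem tw_one (χ : Equiv.Perm (Fin n) → ℝ) : tw χ 1 = χ 1 := by simp [tw, sg_one]

theorem IsIrr.tw {χ : Equiv.Perm (Fin n) → ℝ} (h : IsIrr χ) : IsIrr (tw χ) := h.sg_mul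

theorem abs_tw (χ : Equiv.Perm (Fin n) → ℝ) (σ : Equiv.Perm (Fin n)) : |tw χ σ| = |χ σ| := by
  simp [StdRules.tw, abs_mul, abs_sg]

theorem tw_eq_comm {χ ψ : Equiv.Perm (Fin n) → ℝ} : StdRules.tw χ = ψ ↔ χ = StdRules.tw ψ :=
  ⟨fun h => by rw [← h, tw_tw], fun h => by rw [h, tw_tw]⟩

theorem tw_fun_one : tw (fun _ : Equiv.Perm (Fin n) => (1 : ℝ)) = sg := by
  funext σ; simp [tw]

theorem isClass_sg : IsClass (sg : Equiv.Perm (Fin n) → ℝ) := isIrr_sg.isRepChar.isClass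

theorem isClass_psiS : IsClass (psiS : Equiv.Perm (Fin n) → ℝ) := fun a b => by
  simp [psiS, isClass_c1 a b, isClass_d2 a b]

theorem isClass_psiE : IsClass (psiE : Equiv.Perm (Fin n) → ℝ) := fun a b => by
  simp [psiE, isClass_c1 a b, isClass_d2 a b]

theorem IsClass.mul {G : Type} [Group G] {f g : G → ℝ} (hf : IsClass f) (hg : IsClass g) :
    IsClass (fun x => f x * g x) := fun a b => by
  simp only [hf a b, hg a b]

theorem isClass_const {G : Type} [Group G] (c : ℝ) : IsClass (fun _ : G => c) := fun _ _ => rfl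

theorem IsClass.comp {G H : Type} [Group G] [Group H] {f : G → ℝ} (hf : IsClass f) (φ : H →* G) :
    IsClass (fun x => f (φ x)) := fun a b => by
  simp only [map_mul, map_inv, hf (φ a)]

theorem avg_c1 : avg (c1 : Equiv.Perm (Fin (n + 1)) → ℝ) = 1 := by
  have := avg_c1_mul (n := n) (isClass_const 1)
  simpa [avg_const] using this

theorem avg_c1_sq : avg (fun σ : Equiv.Perm (Fin (n + 2)) => c1 σ * c1 σ) = 2 := by
  rw [avg_c1_mul isClass_c1]
  simp only [c1_iota]
  rw [avg_add, avg_c1, avg_const]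
  norm_num

theorem avg_d2 : avg (d2 : Equiv.Perm (Fin (n + 2)) → ℝ) = 1 := by
  have := avg_d2_mul (n := n) (isClass_const 1)
  simpa [avg_const] using this

theorem avg_quad (a b c d : ℝ) {F : Equiv.Perm (Fin (n + 2)) → ℝ}
    (hF : ∀ σ, F σ = a * (c1 σ * c1 σ) + b * c1 σ + c * d2 σ + d) :
    avg F = 2 * a + b + c + d := by
  rw [show F = fun σ => a * (c1 σ * c1 σ) + b * c1 σ + c * d2 σ + d from funext hF, avg_add,
    avg_add, avg_add, avg_mul_left, avg_mul_left, avg_mul_left, avg_c1_sq, avg_c1, avg_d2,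
    avg_const]
  ring

theorem avg_std_mul {F : Equiv.Perm (Fin (n + 1)) → ℝ} (hF : IsClass F) :
    avg (fun σ => std σ * F σ) = avg (fun s => F (iota s)) - avg F := by
  rw [← avg_c1_mul hF, ← avg_sub]
  congr 1
  funext σ
  simp [std]
  ring

theorem avg_c1_sq_mul {F : Equiv.Perm (Fin (n + 2)) → ℝ} (hF : IsClass F) :
    avg (fun σ => c1 σ * (c1 σ * F σ)) = avg (fun s => F (iota (iota s)))
      + avg (fun s => F (iota s)) := by
  rw [avg_c1_mul (isClass_c1.mul hF)]
  have h := avg_c1_mul (hF.comp iota)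
  simp only [c1_iota, add_mul, one_mul]
  rw [avg_add, h]

theorem avg_psiS_mul {F : Equiv.Perm (Fin (n + 2)) → ℝ} (hF : IsClass F) :
    avg (fun σ => psiS σ * F σ) = (avg (fun s => F (iota (iota s)))
      - 2 * avg (fun s => F (iota s)) + avg (fun s => F (tau * iota (iota s)))) / 2 := by
  have h : (fun σ => psiS σ * F σ) = fun σ => (1/2) * (c1 σ * (c1 σ * F σ))
      - (3/2) * (c1 σ * F σ) + (1/2) * (d2 σ * F σ) := by
    funext σ; simp only [psiS]; ring
  rw [h, avg_add, avg_sub, avg_mul_left, avg_mul_left, avg_mul_left, avg_c1_sq_mul hF,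
    avg_c1_mul hF, avg_d2_mul hF]
  ring

theorem avg_psiE_mul {F : Equiv.Perm (Fin (n + 2)) → ℝ} (hF : IsClass F) :
    avg (fun σ => psiE σ * F σ) = (avg (fun s => F (iota (iota s)))
      - 2 * avg (fun s => F (iota s)) - avg (fun s => F (tau * iota (iota s)))) / 2 + avg F := by
  have h : (fun σ => psiE σ * F σ) = fun σ => (1/2) * (c1 σ * (c1 σ * F σ))
      - (3/2) * (c1 σ * F σ) - (1/2) * (d2 σ * F σ) + F σ := by
    funext σ; simp only [psiE]; ring
  rw [h, avg_add, avg_sub, avg_sub, avg_mul_left, avg_mul_left, avg_mul_left, avg_c1_sq_mul hF,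
    avg_c1_mul hF, avg_d2_mul hF]
  ring

theorem avg_std_sq : avg (fun σ : Equiv.Perm (Fin (n + 2)) => std σ * std σ) = 1 := by
  rw [avg_quad 1 (-2) 0 1 (fun σ => by simp only [std]; ring)]
  norm_num

theorem avg_psiS_sq : avg (fun σ : Equiv.Perm (Fin (n + 4)) => psiS σ * psiS σ) = 1 := by
  rw [avg_psiS_mul isClass_psiS]
  simp only [psiS, c1_iota, d2_iota, c1_tau_iota, d2_tau_iota]
  rw [avg_quad (1/2) (1/2) (1/2) (-1) (fun σ => by ring),
    avg_quad (1/2) (-1/2) (1/2) (-1) (fun σ => by ring),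
    avg_quad (1/2) (-3/2) (1/2) 1 (fun σ => by ring)]
  norm_num

theorem avg_psiE_sq : avg (fun σ : Equiv.Perm (Fin (n + 4)) => psiE σ * psiE σ) = 1 := by
  rw [avg_psiE_mul isClass_psiE]
  simp only [psiE, c1_iota, d2_iota, c1_tau_iota, d2_tau_iota]
  rw [avg_quad (1/2) (1/2) (-1/2) 0 (fun σ => by ring),
    avg_quad (1/2) (-1/2) (-1/2) 0 (fun σ => by ring),
    avg_quad (1/2) (-3/2) (-1/2) 0 (fun σ => by ring),
    avg_quad (1/2) (-3/2) (-1/2) 1 (fun σ => by simp only [psiE]; ring)]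
  norm_num

theorem avg_eq_zero_of_ne {χ : Equiv.Perm (Fin n) → ℝ} (h : IsIrr χ) (h1 : χ ≠ fun _ => 1) :
    avg χ = 0 := by
  have := h.avg_mul_of_ne isIrr_one h1
  simpa using this

theorem IsIrr.avg_iota_eq_zero {χ : Equiv.Perm (Fin (n + 2)) → ℝ} (h : IsIrr χ)
    (h1 : χ ≠ fun _ => 1) (h2 : χ ≠ std) : avg (fun s => χ (iota s)) = 0 := by
  by_contra hne
  obtain ⟨m, hm⟩ := (h.isRepChar.comp iota).exists_avg
  have hpos : 0 < avg (fun s => χ (iota s)) := by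
    rw [hm] at hne ⊢
    exact_mod_cast Nat.pos_of_ne_zero (by exact_mod_cast hne)
  apply h2
  apply h.eq_of_avg avg_std_sq
  rw [avg_std_mul h.isRepChar.isClass, avg_eq_zero_of_ne h h1, sub_zero]
  exact (h.isRepChar.comp iota).one_le_avg hpos

theorem commute_tau_iota (s : Equiv.Perm (Fin n)) : Commute tau (iota (iota s)) := by
  apply Equiv.ext
  intro x
  refine Fin.cases ?_ (fun i => Fin.cases ?_ (fun j => ?_) i) x <;> simp

/-- The homomorphism from the units of `ℤ` with image generated by `tau`. -/
def unitsHom : ℤˣ →* Equiv.Perm (Fin (n + 2)) where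
  toFun u := if u = 1 then 1 else tau
  map_one' := if_pos rfl
  map_mul' u v := by
    rcases Int.units_eq_one_or u with rfl | rfl <;> rcases Int.units_eq_one_or v with rfl | rfl <;>
      simp

/-- The subgroup `S_n × S_2` of `S_{n+2}`. -/
def pairHom : Equiv.Perm (Fin n) × ℤˣ →* Equiv.Perm (Fin (n + 2)) :=
  MonoidHom.noncommCoprod (iota.comp iota) unitsHom fun s u => by
    rcases Int.units_eq_one_or u with rfl | rfl
    · simp
    · exact (commute_tau_iota s).symm

instance : Ambivalent ℤˣ where
  conj_inv g := by rw [Int.units_inv_eq_self]; exact IsConj.refl g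

theorem pairHom_one (s : Equiv.Perm (Fin n)) : pairHom (s, 1) = iota (iota s) := by
  simp [pairHom]

theorem pairHom_neg_one (s : Equiv.Perm (Fin n)) : pairHom (s, -1) = tau * iota (iota s) := by
  rw [(commute_tau_iota s).eq]
  simp [pairHom, unitsHom]

theorem avg_prod_units (f : Equiv.Perm (Fin n) × ℤˣ → ℝ) :
    avg f = (avg (fun s => f (s, 1)) + avg (fun s => f (s, -1))) / 2 := by
  unfold avg
  rw [Fintype.sum_prod_type, Fintype.card_prod]
  have : ∀ s, ∑ u : ℤˣ, f (s, u) = f (s, 1) + f (s, -1) := fun s => by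
    rw [show (Finset.univ : Finset ℤˣ) = {1, -1} from rfl, Finset.sum_pair (by decide)]
  simp_rw [this]
  rw [Finset.sum_add_distrib]
  have := card_pos' (G := Equiv.Perm (Fin n))
  simp
  field_simp

theorem IsRepChar.avg_pair {χ : Equiv.Perm (Fin (n + 2)) → ℝ} (h : IsRepChar χ) :
    ∃ k l : ℕ, avg (fun s => χ (iota (iota s))) + avg (fun s => χ (tau * iota (iota s))) = 2 * k ∧
      avg (fun s => χ (iota (iota s))) - avg (fun s => χ (tau * iota (iota s))) = 2 * l := by
  obtain ⟨k, hk⟩ := (h.comp pairHom).exists_avg_mul isIrr_one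
  obtain ⟨l, hl⟩ := (h.comp pairHom).exists_avg_mul
    (isIrr_sign (MonoidHom.snd (Equiv.Perm (Fin n)) ℤˣ))
  rw [avg_prod_units] at hk hl
  simp only [pairHom_one, pairHom_neg_one, mul_one, MonoidHom.coe_snd, Units.val_one,
    Units.val_neg, Int.cast_neg, Int.cast_one, mul_neg] at hk hl
  refine ⟨k, l, by linarith, ?_⟩
  have : avg (fun s => -χ (tau * iota (iota s))) = - avg (fun s => χ (tau * iota (iota s))) := by
    have := avg_mul_left (-1) (fun s => χ (tau * iota (iota s)))
    simpa using this
  rw [this] at hl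
  linarith

theorem IsIrr.avg_iota_iota_eq_zero {χ : Equiv.Perm (Fin (n + 4)) → ℝ} (h : IsIrr χ)
    (h0 : χ ≠ fun _ => 1) (h1 : χ ≠ std) (h2 : χ ≠ psiS) (h3 : χ ≠ psiE) :
    avg (fun s => χ (iota (iota s))) = 0 ∧ avg (fun s => χ (tau * iota (iota s))) = 0 := by
  obtain ⟨k, l, hk, hl⟩ := h.isRepChar.avg_pair
  have hβ := h.avg_iota_eq_zero h0 h1
  have hα := avg_eq_zero_of_ne h h0
  have hS := avg_psiS_mul h.isRepChar.isClass
  have hE := avg_psiE_mul h.isRepChar.isClass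
  rw [hβ] at hS hE
  rw [hα] at hE
  have hk0 : k = 0 := by
    by_contra hk0
    have : (1 : ℝ) ≤ k := by exact_mod_cast Nat.one_le_iff_ne_zero.2 hk0
    exact h2 (h.eq_of_avg avg_psiS_sq (by rw [hS]; linarith))
  have hl0 : l = 0 := by
    by_contra hl0
    have : (1 : ℝ) ≤ l := by exact_mod_cast Nat.one_le_iff_ne_zero.2 hl0
    exact h3 (h.eq_of_avg avg_psiE_sq (by rw [hE]; linarith))
  subst hk0 hl0
  simp only [Nat.cast_zero, mul_zero] at hk hl
  constructor <;> linarith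

/-- The standard character or its twist. -/
def IsT1 (χ : Equiv.Perm (Fin n) → ℝ) : Prop := χ = std ∨ χ = tw std

/-- The characters of `(n-2,2)`, `(n-2,1,1)` and their twists. -/
def IsT2 (χ : Equiv.Perm (Fin n) → ℝ) : Prop :=
  (χ = psiS ∨ χ = psiE) ∨ (χ = tw psiS ∨ χ = tw psiE)

/-- Irreducible characters not of the previous types. -/
def IsHigh (χ : Equiv.Perm (Fin n) → ℝ) : Prop := IsIrr χ ∧ ¬ IsLin χ ∧ ¬ IsT1 χ ∧ ¬ IsT2 χ

theorem IsLin.tw {χ : Equiv.Perm (Fin n) → ℝ} (h : IsLin χ) : IsLin (tw χ) := by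
  rcases h with rfl | rfl
  · exact Or.inr tw_fun_one
  · left; rw [← tw_fun_one, tw_tw]

theorem IsT1.tw {χ : Equiv.Perm (Fin n) → ℝ} (h : IsT1 χ) : IsT1 (tw χ) := by
  rcases h with rfl | rfl
  · exact Or.inr rfl
  · left; rw [tw_tw]

theorem IsT2.tw {χ : Equiv.Perm (Fin n) → ℝ} (h : IsT2 χ) : IsT2 (tw χ) := by
  rcases h with (rfl | rfl) | (rfl | rfl)
  · exact Or.inr (Or.inl rfl)
  · exact Or.inr (Or.inr rfl)
  · left; left; rw [tw_tw]
  · left; right; rw [tw_tw]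

theorem IsHigh.tw {χ : Equiv.Perm (Fin n) → ℝ} (h : IsHigh χ) : IsHigh (tw χ) := by
  refine ⟨h.1.tw, fun hh => h.2.1 ?_, fun hh => h.2.2.1 ?_, fun hh => h.2.2.2 ?_⟩
  · rw [← tw_tw χ]; exact hh.tw
  · rw [← tw_tw χ]; exact hh.tw
  · rw [← tw_tw χ]; exact hh.tw

theorem IsHigh.avg_iota {χ : Equiv.Perm (Fin (n + 2)) → ℝ} (h : IsHigh χ) :
    avg (fun s => χ (iota s)) = 0 :=
  h.1.avg_iota_eq_zero (fun e => h.2.1 (Or.inl e)) (fun e => h.2.2.1 (Or.inl e))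

theorem IsHigh.avg_iota_iota {χ : Equiv.Perm (Fin (n + 4)) → ℝ} (h : IsHigh χ) :
    avg (fun s => χ (iota (iota s))) = 0 ∧ avg (fun s => χ (tau * iota (iota s))) = 0 :=
  h.1.avg_iota_iota_eq_zero (fun e => h.2.1 (Or.inl e)) (fun e => h.2.2.1 (Or.inl e))
    (fun e => h.2.2.2 (Or.inl (Or.inl e))) (fun e => h.2.2.2 (Or.inl (Or.inr e)))

end Low

section Branching

variable {n : ℕ}

theorem IsRepChar.avg_nonneg {G : Type} [Group G] [Fintype G] [Ambivalent G] {f : G → ℝ}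
    (h : IsRepChar f) : 0 ≤ avg f := by
  obtain ⟨m, hm⟩ := h.exists_avg
  rw [hm]; positivity

theorem tw_comp_iota (χ : Equiv.Perm (Fin (n + 1)) → ℝ) (s : Equiv.Perm (Fin n)) :
    tw χ (iota s) = tw (fun s => χ (iota s)) s := by
  simp [tw, sg_iota]

theorem tw_sum {k : ℕ} {f : Equiv.Perm (Fin n) → ℝ} {ψ : Fin k → Equiv.Perm (Fin n) → ℝ}
    (h : ∀ g, f g = ∑ i, ψ i g) (g : Equiv.Perm (Fin n)) : tw f g = ∑ i, tw (ψ i) g := by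
  simp [tw, h, Finset.mul_sum]

theorem std_iota (s : Equiv.Perm (Fin n)) : std (iota s) = std s + 1 := by
  simp [std, c1_iota]

theorem avg_std : avg (std : Equiv.Perm (Fin (n + 1)) → ℝ) = 0 := by
  unfold std
  rw [avg_sub, avg_c1, avg_const, sub_self]

theorem avg_eq_zero_of_sum {G H : Type} [Group G] [Group H] [Fintype H] [Ambivalent H]
    {f : G → ℝ} {k : ℕ} {ψ : Fin k → G → ℝ} (hψ : ∀ i, IsIrr (ψ i)) (hf : ∀ g, f g = ∑ i, ψ i g)
    (φ : H →* G) (h : avg (fun x => f (φ x)) = 0) (i : Fin k) : avg (fun x => ψ i (φ x)) = 0 := by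
  simp only [hf] at h
  rw [avg_sum] at h
  exact (Finset.sum_eq_zero_iff_of_nonneg
    (fun i _ => ((hψ i).isRepChar.comp φ).avg_nonneg)).1 h i (Finset.mem_univ i)

theorem IsHigh.constituent_aux {χ : Equiv.Perm (Fin (n + 4)) → ℝ} (h : IsHigh χ) {k : ℕ}
    {ψ : Fin k → Equiv.Perm (Fin (n + 3)) → ℝ} (hψ : ∀ i, IsIrr (ψ i))
    (hs : ∀ s, χ (iota s) = ∑ i, ψ i s) (i : Fin k) : ψ i ≠ (fun _ => 1) ∧ ψ i ≠ std := by
  constructor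
  · intro e
    have := avg_eq_zero_of_sum hψ hs (MonoidHom.id _) h.avg_iota i
    simp [e, avg_const] at this
  · intro e
    have := avg_eq_zero_of_sum hψ hs iota h.avg_iota_iota.1 i
    simp only [e, std_iota, avg_add, avg_const, avg_std] at this
    norm_num at this

theorem IsHigh.constituent {χ : Equiv.Perm (Fin (n + 4)) → ℝ} (h : IsHigh χ) {k : ℕ}
    {ψ : Fin k → Equiv.Perm (Fin (n + 3)) → ℝ} (hψ : ∀ i, IsIrr (ψ i))
    (hs : ∀ s, χ (iota s) = ∑ i, ψ i s) (i : Fin k) : IsT2 (ψ i) ∨ IsHigh (ψ i) := by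
  obtain ⟨h1, h2⟩ := h.constituent_aux hψ hs i
  obtain ⟨h3, h4⟩ := h.tw.constituent_aux (fun i => (hψ i).tw)
    (fun s => by rw [tw_comp_iota, tw_sum hs]) i
  rw [Ne, tw_eq_comm] at h3 h4
  by_cases h5 : IsT2 (ψ i)
  · exact Or.inl h5
  · refine Or.inr ⟨hψ i, ?_, ?_, h5⟩
    · rintro (e | e)
      · exact h1 e
      · exact h3 (by rw [e, tw_fun_one])
    · rintro (e | e)
      · exact h2 e
      · exact h4 e

theorem IsIrr.constituent_aux {χ : Equiv.Perm (Fin (n + 2)) → ℝ} (h : IsIrr χ)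
    (h0 : χ ≠ fun _ => 1) (h1 : χ ≠ std) {k : ℕ}
    {ψ : Fin k → Equiv.Perm (Fin (n + 1)) → ℝ} (hψ : ∀ i, IsIrr (ψ i))
    (hs : ∀ s, χ (iota s) = ∑ i, ψ i s) (i : Fin k) : ψ i ≠ (fun _ => 1) := by
  intro e
  have := avg_eq_zero_of_sum hψ hs (MonoidHom.id _) (h.avg_iota_eq_zero h0 h1) i
  simp [e, avg_const] at this

theorem IsIrr.constituent {χ : Equiv.Perm (Fin (n + 2)) → ℝ} (h : IsIrr χ)
    (h0 : ¬ IsLin χ) (h1 : ¬ IsT1 χ) {k : ℕ}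
    {ψ : Fin k → Equiv.Perm (Fin (n + 1)) → ℝ} (hψ : ∀ i, IsIrr (ψ i))
    (hs : ∀ s, χ (iota s) = ∑ i, ψ i s) (i : Fin k) : ¬ IsLin (ψ i) := by
  rintro (e | e)
  · exact h.constituent_aux (fun e => h0 (Or.inl e)) (fun e => h1 (Or.inl e)) hψ hs i e
  · refine h.tw.constituent_aux (fun e => h0 (Or.inr ?_)) (fun e => h1 (Or.inr ?_))
      (fun i => (hψ i).tw) (fun s => by rw [tw_comp_iota, tw_sum hs]) i ?_
    · rw [tw_eq_comm.1 e, tw_fun_one]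
    · exact tw_eq_comm.1 e
    · rw [e, ← tw_fun_one, tw_tw]

/-- The embedding of `S_a` in `S_{a+b}`. -/
def emb (a : ℕ) : (b : ℕ) → Equiv.Perm (Fin a) →* Equiv.Perm (Fin (a + b))
  | 0 => MonoidHom.id _
  | b + 1 => iota.comp (emb a b)

theorem emb_zero (a : ℕ) (s : Equiv.Perm (Fin a)) : emb a 0 s = s := rfl

theorem emb_succ (a b : ℕ) (s : Equiv.Perm (Fin a)) : emb a (b + 1) s = iota (emb a b s) := rfl

theorem c1_emb {a : ℕ} (b : ℕ) (s : Equiv.Perm (Fin a)) : c1 (emb a b s) = c1 s + b := by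
  induction b with
  | zero => simp [emb_zero]
  | succ b ih => rw [emb_succ, c1_iota, ih]; push_cast; ring

theorem d2_emb {a : ℕ} (b : ℕ) (s : Equiv.Perm (Fin a)) : d2 (emb a b s) = d2 s := by
  induction b with
  | zero => simp [emb_zero]
  | succ b ih => rw [emb_succ, d2_iota, ih]

theorem sg_emb {a : ℕ} (b : ℕ) (s : Equiv.Perm (Fin a)) : sg (emb a b s) = sg s := by
  induction b with
  | zero => simp [emb_zero]
  | succ b ih => rw [emb_succ, sg_iota, ih]

end Branching

section Swaps

variable {n : ℕ}

theorem sum_fix_zero_one (F : Equiv.Perm (Fin (n + 2)) → ℝ) :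
    (∑ σ, if σ 0 = 0 ∧ σ 1 = 1 then F σ else 0) = ∑ s, F (iota (iota s)) := by
  have h1 : ∀ σ : Equiv.Perm (Fin (n + 1)), (iota σ) 1 = 1 ↔ σ 0 = 0 := fun σ => by
    rw [← Fin.succ_zero_eq_one, iota_succ, Fin.succ_inj]
  have h := sum_perm_succ (fun s : Equiv.Perm (Fin (n + 2)) => if s 1 = 1 then F s else 0)
  simp only [h1] at h
  rw [sum_perm_succ (fun s => F (iota s))] at h
  simpa only [ite_and] using h

theorem sum_apply_pair (f : Fin (n + 2) × Fin (n + 2) → ℝ) :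
    ∑ k : Equiv.Perm (Fin (n + 2)), f (k 0, k 1)
      = n.factorial * ∑ p ∈ Finset.univ.offDiag, f p := by
  have h1 : ∀ k : Equiv.Perm (Fin (n + 2)), f (k 0, k 1)
      = ∑ p ∈ Finset.univ.offDiag, if (k 0, k 1) = p then f p else 0 := fun k => by
    rw [Finset.sum_ite_eq, if_pos]
    simp
  simp_rw [h1]
  rw [Finset.sum_comm, Finset.mul_sum]
  refine Finset.sum_congr rfl fun p hp => ?_
  obtain ⟨g, h0, h1⟩ := exists_perm_pair (Finset.mem_offDiag.1 hp).2.2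
  rw [← Equiv.sum_comp (Equiv.mulLeft g)]
  have h2 : ∀ k : Equiv.Perm (Fin (n + 2)), (((g * k) 0, (g * k) 1) = p) ↔ k 0 = 0 ∧ k 1 = 1 := by
    intro k
    rw [Prod.ext_iff, ← h0, ← h1]
    simp
  simp only [Equiv.coe_mulLeft, h2]
  rw [sum_fix_zero_one (fun _ => f p)]
  simp [Fintype.card_perm]

theorem IsIrr.sum_swap {χ : Equiv.Perm (Fin (n + 2)) → ℝ} (hχ : IsIrr χ)
    (g : Equiv.Perm (Fin (n + 2))) :
    χ 1 * ∑ p ∈ Finset.univ.offDiag, χ (g * Equiv.swap p.1 p.2)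
      = (n + 2) * (n + 1) * χ tau * χ g := by
  have h := hχ.schur g tau
  have h1 : ∀ k : Equiv.Perm (Fin (n + 2)), k * tau * k⁻¹ = Equiv.swap (k 0) (k 1) := fun k => by
    rw [tau, Equiv.swap_apply_apply]
  simp_rw [h1] at h
  rw [sum_apply_pair (fun p => χ (g * Equiv.swap p.1 p.2)), card_perm_fin, Nat.factorial_succ,
    Nat.factorial_succ] at h
  have : (n.factorial : ℝ) ≠ 0 := by exact_mod_cast n.factorial_ne_zero
  push_cast at h
  apply mul_left_cancel₀ this
  linear_combination h

theorem abs_le_of_eigen {G : Type} [Finite G] {f : G → ℝ} {x c : ℝ} {g₀ : G}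
    (h0 : f g₀ ≠ 0) (h : ∀ M, (∀ g, |f g| ≤ M) → ∀ g, |x * f g| ≤ c * M) : |x| ≤ c := by
  have : Nonempty G := ⟨g₀⟩
  obtain ⟨g₁, hg₁⟩ := Finite.exists_max (fun g => |f g|)
  have h2 := h _ hg₁ g₁
  have hpos : 0 < |f g₁| := lt_of_lt_of_le (abs_pos.2 h0) (hg₁ g₀)
  rw [abs_mul] at h2
  exact le_of_mul_le_mul_right h2 hpos

end Swaps

section Coset

variable {n : ℕ}

theorem decomposeFin_symm_eq (p : Fin (n + 1)) (s : Equiv.Perm (Fin n)) :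
    Equiv.Perm.decomposeFin.symm (p, s) = Equiv.swap 0 p * iota s := by
  ext x
  refine Fin.cases ?_ (fun i => ?_) x <;> simp

theorem sum_perm_decomp (F : Equiv.Perm (Fin (n + 1)) → ℝ) :
    ∑ σ, F σ = ∑ s, F (iota s) + ∑ j : Fin n, ∑ s, F (Equiv.swap 0 j.succ * iota s) := by
  rw [← Equiv.sum_comp Equiv.Perm.decomposeFin.symm, Fintype.sum_prod_type, Fin.sum_univ_succ]
  simp only [decomposeFin_symm_eq, Equiv.swap_self]
  rfl

theorem sum_offDiag_succ (f : Fin (n + 1) → Fin (n + 1) → ℝ) (hf : ∀ i j, f i j = f j i) :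
    ∑ p ∈ (Finset.univ : Finset (Fin (n + 1))).offDiag, f p.1 p.2
      = 2 * ∑ j : Fin n, f 0 j.succ
        + ∑ p ∈ (Finset.univ : Finset (Fin n)).offDiag, f p.1.succ p.2.succ := by
  have h : ∀ (m : ℕ) (f : Fin m → Fin m → ℝ),
      ∑ p ∈ (Finset.univ : Finset (Fin m)).offDiag, f p.1 p.2
        = ∑ i, ∑ j, if i ≠ j then f i j else 0 := fun m f => by
    have hX : (Finset.univ : Finset (Fin m)).offDiag
        = (Finset.univ ×ˢ Finset.univ).filter fun p => p.1 ≠ p.2 := by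
      ext p; simp
    rw [hX, Finset.sum_filter, Finset.univ_product_univ, Fintype.sum_prod_type]
  rw [h, h _ (fun i j => f i.succ j.succ), Fin.sum_univ_succ, Fin.sum_univ_succ]
  simp_rw [Fin.sum_univ_succ]
  simp only [ne_eq, not_true_eq_false, if_false, Fin.succ_inj, Fin.succ_ne_zero,
    (Fin.succ_ne_zero _).symm, not_false_eq_true, if_true, zero_add, Finset.sum_add_distrib]
  simp_rw [fun j : Fin n => hf j.succ 0]
  ring

end Coset

section Eigen

variable {m : ℕ}

/-- The convolution of a function on `S_{n+1}` and a function on `S_n`. -/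
noncomputable def cv {n : ℕ} (χ : Equiv.Perm (Fin (n + 1)) → ℝ) (ψ : Equiv.Perm (Fin n) → ℝ)
    (g : Equiv.Perm (Fin (n + 1))) : ℝ := ∑ h, χ (g * iota h) * ψ h

/-- The difference of the central characters of the class sums of transpositions. -/
noncomputable def jm (χ : Equiv.Perm (Fin (m + 3)) → ℝ) (ψ : Equiv.Perm (Fin (m + 2)) → ℝ) : ℝ :=
  ((m + 3) * (m + 2) * χ tau / χ 1 - (m + 2) * (m + 1) * ψ tau / ψ 1) / 2

theorem swap_mul_iota {n : ℕ} (h : Equiv.Perm (Fin n)) (j : Fin n) :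
    Equiv.swap 0 j.succ * iota h = iota h * Equiv.swap 0 (h⁻¹ j).succ := by
  rw [Equiv.swap_mul_eq_mul_swap, ← map_inv, iota_zero, iota_succ]

theorem iota_swap {n : ℕ} (i j : Fin n) :
    iota (Equiv.swap i j) = Equiv.swap i.succ j.succ := by
  apply Equiv.ext
  intro x
  refine Fin.cases ?_ (fun k => ?_) x
  · rw [iota_zero, Equiv.swap_apply_of_ne_of_ne] <;> exact (Fin.succ_ne_zero _).symm
  · rw [iota_succ, Equiv.swap_apply_def, Equiv.swap_apply_def]
    simp only [Fin.succ_inj]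
    split_ifs <;> rfl

theorem sum_cv_swap {χ : Equiv.Perm (Fin (m + 3)) → ℝ} {ψ : Equiv.Perm (Fin (m + 2)) → ℝ}
    (hχ : IsIrr χ) (hψ : IsIrr ψ) (g : Equiv.Perm (Fin (m + 3))) :
    ∑ j : Fin (m + 2), cv χ ψ (g * Equiv.swap 0 j.succ) = jm χ ψ * cv χ ψ g := by
  have e1 : ∑ j : Fin (m + 2), cv χ ψ (g * Equiv.swap 0 j.succ)
      = ∑ h, (∑ j : Fin (m + 2), χ (g * iota h * Equiv.swap 0 j.succ)) * ψ h := by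
    unfold cv
    rw [Finset.sum_comm]
    refine Finset.sum_congr rfl fun h _ => ?_
    rw [← Finset.sum_mul, ← Equiv.sum_comp h]
    congr 1
    refine Finset.sum_congr rfl fun j _ => ?_
    rw [mul_assoc, swap_mul_iota, ← mul_assoc]
    simp
  have e2 : ∀ g, 2 * ∑ j : Fin (m + 2), χ (g * Equiv.swap 0 j.succ)
      = (m + 3) * (m + 2) * χ tau / χ 1 * χ g
        - ∑ p ∈ (Finset.univ : Finset (Fin (m + 2))).offDiag,
          χ (g * iota (Equiv.swap p.1 p.2)) := fun g => by
    have h1 := hχ.sum_swap g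
    have h2 := sum_offDiag_succ (fun i j => χ (g * Equiv.swap i j)) (fun i j => by
      rw [Equiv.swap_comm])
    rw [h2] at h1
    simp only [iota_swap]
    have := hχ.pos.ne'
    push_cast at h1
    field_simp
    linear_combination h1
  have e3 : ∑ h, (∑ p ∈ (Finset.univ : Finset (Fin (m + 2))).offDiag,
      χ (g * iota h * iota (Equiv.swap p.1 p.2))) * ψ h
      = (m + 2) * (m + 1) * ψ tau / ψ 1 * cv χ ψ g := by
    simp_rw [Finset.sum_mul]
    rw [Finset.sum_comm, cv, Finset.mul_sum]
    have : ∀ p : Fin (m + 2) × Fin (m + 2),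
        ∑ h, χ (g * iota h * iota (Equiv.swap p.1 p.2)) * ψ h
          = ∑ h, χ (g * iota h) * ψ (h * Equiv.swap p.1 p.2) := fun p => by
      rw [← Equiv.sum_comp (Equiv.mulRight (Equiv.swap p.1 p.2))]
      refine Finset.sum_congr rfl fun h _ => ?_
      simp [map_mul, mul_assoc, ← map_mul iota (Equiv.swap p.1 p.2)]
    simp_rw [this]
    rw [Finset.sum_comm]
    refine Finset.sum_congr rfl fun h _ => ?_
    rw [← Finset.mul_sum]
    have h1 := hψ.sum_swap h
    have := hψ.pos.ne'
    field_simp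
    linear_combination χ (g * iota h) * h1
  have e4 : 2 * ∑ h, (∑ j : Fin (m + 2), χ (g * iota h * Equiv.swap 0 j.succ)) * ψ h
      = (m + 3) * (m + 2) * χ tau / χ 1 * cv χ ψ g
        - ∑ h, (∑ p ∈ (Finset.univ : Finset (Fin (m + 2))).offDiag,
          χ (g * iota h * iota (Equiv.swap p.1 p.2))) * ψ h := by
    rw [cv, Finset.mul_sum, Finset.mul_sum, ← Finset.sum_sub_distrib]
    refine Finset.sum_congr rfl fun h _ => ?_
    rw [← mul_assoc, e2]
    ring
  rw [e1, jm]
  rw [e3] at e4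
  linarith

theorem cv_iota {n : ℕ} {χ : Equiv.Perm (Fin (n + 1)) → ℝ} {ψ : Equiv.Perm (Fin n) → ℝ}
    (hχ : IsRepChar χ) (hψ : IsIrr ψ) (k : Equiv.Perm (Fin n)) :
    ψ 1 * cv χ ψ (iota k) = ψ k * cv χ ψ 1 := by
  have := (hχ.comp iota).conv hψ k
  simpa [cv] using this

theorem abs_jm_le {χ : Equiv.Perm (Fin (m + 3)) → ℝ} {ψ : Equiv.Perm (Fin (m + 2)) → ℝ}
    (hχ : IsIrr χ) (hψ : IsIrr ψ) (h : 0 < cv χ ψ 1) : |jm χ ψ| ≤ m + 2 := by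
  refine abs_le_of_eigen h.ne' fun M hM g => ?_
  rw [← sum_cv_swap hχ hψ]
  refine (Finset.abs_sum_le_sum_abs _ _).trans ?_
  refine (Finset.sum_le_sum fun j _ => hM _).trans_eq ?_
  simp

theorem jm_mem {χ : Equiv.Perm (Fin (m + 3)) → ℝ} {ψ : Equiv.Perm (Fin (m + 2)) → ℝ}
    (hχ : IsIrr χ) (hψ : IsIrr ψ) (h : 0 < cv χ ψ 1)
    (hz : avg (fun s : Equiv.Perm (Fin (m + 1)) => χ (iota (iota s))) = 0)
    (hp : 0 < avg (fun s : Equiv.Perm (Fin m) => ψ (iota (iota s)))) :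
    |jm χ ψ + 1| ≤ 2 := by
  set F := cv χ ψ with hF
  set F' : Equiv.Perm (Fin (m + 3)) → ℝ := fun g => ∑ k : Equiv.Perm (Fin m),
    F (g * iota (iota (iota k))) with hF'
  have hF'1 : F' 1 ≠ 0 := by
    have h1 : ψ 1 * F' 1 = (∑ k : Equiv.Perm (Fin m), ψ (iota (iota k))) * F 1 := by
      rw [hF', Finset.mul_sum, Finset.sum_mul]
      refine Finset.sum_congr rfl fun k _ => ?_
      rw [one_mul, hF, cv_iota hχ.isRepChar hψ]
    have h2 : 0 < ∑ k : Equiv.Perm (Fin m), ψ (iota (iota k)) := by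
      rw [avg] at hp
      exact (div_pos_iff_of_pos_right card_pos').1 hp
    intro h0
    rw [h0, mul_zero] at h1
    exact (mul_pos h2 h).ne h1
  have hsum : ∀ g, ∑ j : Fin (m + 2), F' (g * Equiv.swap 0 j.succ) = jm χ ψ * F' g := by
    intro g
    simp only [hF']
    rw [Finset.sum_comm, Finset.mul_sum]
    refine Finset.sum_congr rfl fun k _ => ?_
    rw [hF, ← sum_cv_swap hχ hψ, ← Equiv.sum_comp (iota (iota k))]
    refine Finset.sum_congr rfl fun j _ => ?_
    rw [mul_assoc, swap_mul_iota, ← mul_assoc]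
    simp
  have hzero : ∀ g, F' g + ∑ j : Fin m, F' (g * Equiv.swap 0 j.succ.succ.succ) = 0 := by
    intro g
    let c : Equiv.Perm (Fin (m + 3)) := Equiv.swap 0 2
    let φ : Equiv.Perm (Fin (m + 1)) →* Equiv.Perm (Fin (m + 3)) :=
      (MulAut.conj c).toMonoidHom.comp (iota.comp iota)
    have hφ : ∀ s, φ s = c * iota (iota s) * c⁻¹ := fun s => rfl
    have hc : (2 : Fin (m + 3)) = Fin.succ (Fin.succ 0) := by simp
    have hφ1 : ∀ k : Equiv.Perm (Fin m), φ (iota k) = iota (iota (iota k)) := by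
      intro k
      rw [hφ, mul_inv_eq_iff_eq_mul]
      simp only [c]
      rw [Equiv.mul_swap_eq_swap_mul, hc, iota_zero, iota_succ, iota_succ, iota_zero]
    have hφ2 : ∀ j : Fin m, φ (Equiv.swap 0 j.succ) = Equiv.swap 0 j.succ.succ.succ := by
      intro j
      rw [hφ, iota_swap, iota_swap, ← Equiv.swap_apply_apply]
      simp only [c]
      rw [hc, Equiv.swap_apply_right, Equiv.swap_apply_of_ne_of_ne]
      · exact Fin.succ_ne_zero _
      · simp only [Ne, Fin.succ_inj]; exact Fin.succ_ne_zero _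
    have hz' : ∑ s, χ (φ s) = 0 := by
      simp only [hφ, hχ.isRepChar.conj]
      rw [avg, div_eq_zero_iff] at hz
      exact hz.resolve_right card_pos'.ne'
    have hz2 : ∑ s, F (g * φ s) = 0 := by
      simp only [hF, cv]
      rw [Finset.sum_comm]
      refine Finset.sum_eq_zero fun h _ => ?_
      rw [← Finset.sum_mul]
      have := hχ.sum_coset_eq_zero φ hz' (iota h * g)
      rw [← this, show (∑ s, χ (g * φ s * iota h)) = ∑ s, χ (iota h * g * φ s) from ?_, this,
        zero_mul]
      refine Finset.sum_congr rfl fun s _ => ?_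
      rw [hχ.isRepChar.apply_mul_comm, mul_assoc]
    rw [sum_perm_decomp] at hz2
    simp only [map_mul, hφ1, hφ2] at hz2
    simpa only [hF', mul_assoc] using hz2
  refine abs_le_of_eigen hF'1 fun M hM g => ?_
  have h1 := hsum g
  have h2 := hzero g
  rw [Fin.sum_univ_succ, Fin.sum_univ_succ] at h1
  have : (jm χ ψ + 1) * F' g = F' (g * Equiv.swap 0 (Fin.succ 0))
      + F' (g * Equiv.swap 0 (Fin.succ (Fin.succ 0))) := by linarith
  rw [this]
  have := abs_add_le (F' (g * Equiv.swap 0 (Fin.succ 0)))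
    (F' (g * Equiv.swap 0 (Fin.succ (Fin.succ 0))))
  have h3 := hM (g * Equiv.swap 0 (Fin.succ 0))
  have h4 := hM (g * Equiv.swap 0 (Fin.succ (Fin.succ 0)))
  linarith

end Eigen

section Mass

variable {q : ℕ}

theorem c1_tau {n : ℕ} : c1 (tau : Equiv.Perm (Fin (n + 2))) = n := by
  have := c1_tau_iota (1 : Equiv.Perm (Fin n))
  simpa using this

theorem d2_tau {n : ℕ} : d2 (tau : Equiv.Perm (Fin (n + 2))) = 2 := by
  have := d2_tau_iota (1 : Equiv.Perm (Fin n))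
  simpa using this

theorem jm_tw {m : ℕ} (χ : Equiv.Perm (Fin (m + 3)) → ℝ) (ψ : Equiv.Perm (Fin (m + 2)) → ℝ) :
    jm (tw χ) (tw ψ) = - jm χ ψ := by
  simp only [jm, tw, sg_tau, sg_one]
  ring

theorem cv_one_pos {n k : ℕ} {χ : Equiv.Perm (Fin (n + 1)) → ℝ}
    {ψ : Fin k → Equiv.Perm (Fin n) → ℝ} (hψ : ∀ i, IsIrr (ψ i))
    (hs : ∀ s, χ (iota s) = ∑ i, ψ i s) (i : Fin k) : 0 < cv χ (ψ i) 1 := by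
  classical
  simp only [cv, one_mul, hs, Finset.sum_mul]
  rw [Finset.sum_comm]
  have h : ∀ j, ∑ s, ψ j s * ψ i s = if ψ j = ψ i then
      (Fintype.card (Equiv.Perm (Fin n)) : ℝ) else 0 := fun j => (hψ j).sum_mul (hψ i)
  simp_rw [h]
  refine Finset.sum_pos' (fun j _ => by positivity) ⟨i, Finset.mem_univ i, ?_⟩
  rw [if_pos rfl]
  exact card_pos'

theorem sum_jm {m k : ℕ} {χ : Equiv.Perm (Fin (m + 3)) → ℝ}
    {ψ : Fin k → Equiv.Perm (Fin (m + 2)) → ℝ} (hχ : IsIrr χ) (hψ : ∀ i, IsIrr (ψ i))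
    (hs : ∀ s, χ (iota s) = ∑ i, ψ i s) :
    ∑ i, ψ i 1 * jm χ (ψ i) = (m + 2) * χ tau := by
  have h1 : ∑ i, ψ i 1 = χ 1 := by rw [← hs, map_one]
  have h2 : ∑ i, ψ i tau = χ tau := by
    rw [← hs]
    apply hχ.isRepChar.eq_of_isConj
    rw [tau, iota_swap]
    exact Equiv.Perm.isConj_swap (by rw [Ne, Fin.succ_inj]; simp) (by simp)
  have h3 : ∀ i, ψ i 1 * jm χ (ψ i) = (m + 3) * (m + 2) * χ tau / χ 1 / 2 * ψ i 1
      - (m + 2) * (m + 1) / 2 * ψ i tau := fun i => by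
    have := (hψ i).pos.ne'
    rw [jm]
    field_simp
  simp_rw [h3]
  rw [Finset.sum_sub_distrib, ← Finset.mul_sum, ← Finset.mul_sum, h1, h2]
  have := hχ.pos.ne'
  field_simp
  ring

theorem IsHigh.jm_le_of_T2 {χ : Equiv.Perm (Fin (q + 5)) → ℝ} (h : IsHigh χ)
    {ψ : Equiv.Perm (Fin (q + 4)) → ℝ} (hψ : IsIrr ψ) (h2 : ψ = psiS ∨ ψ = psiE)
    (hc : 0 < cv χ ψ 1) : |jm χ ψ + 1| ≤ 2 := by
  refine jm_mem (m := q + 2) h.1 hψ hc (IsHigh.avg_iota_iota (n := q + 1) h).1 ?_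
  rcases h2 with rfl | rfl
  · simp only [psiS, c1_iota, d2_iota]
    rw [avg_quad (1/2) (1/2) (1/2) (-1) (fun σ => by ring)]
    norm_num
  · simp only [psiE, c1_iota, d2_iota]
    rw [avg_quad (1/2) (1/2) (-1/2) 0 (fun σ => by ring)]
    norm_num

theorem IsHigh.abs_jm_add_le {χ : Equiv.Perm (Fin (q + 5)) → ℝ} (h : IsHigh χ) {k : ℕ}
    {ψ : Fin k → Equiv.Perm (Fin (q + 4)) → ℝ} (hψ : ∀ i, IsIrr (ψ i))
    (hs : ∀ s, χ (iota s) = ∑ i, ψ i s) (i : Fin k) (h2 : ψ i = psiS ∨ ψ i = psiE) :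
    |jm χ (ψ i) + 1| ≤ 2 :=
  h.jm_le_of_T2 (hψ i) h2 (cv_one_pos hψ hs i)

open Classical in
theorem IsHigh.mass_T2_aux {χ : Equiv.Perm (Fin (q + 5)) → ℝ} (h : IsHigh χ) {k : ℕ}
    {ψ : Fin k → Equiv.Perm (Fin (q + 4)) → ℝ} (hψ : ∀ i, IsIrr (ψ i))
    (hs : ∀ s, χ (iota s) = ∑ i, ψ i s) (j : Fin k) (hj : ψ j = psiS ∨ ψ j = psiE) :
    (q + 1) * ∑ i, (if IsT2 (ψ i) then ψ i 1 else 0) ≤ 6 * χ 1 := by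
  have h1 : ∀ i, IsT2 (ψ i) → jm χ (ψ i) ≤ 3 := by
    rintro i (hi | hi)
    · have := abs_le.1 (h.abs_jm_add_le hψ hs i hi)
      linarith
    · have := abs_le.1 (h.tw.abs_jm_add_le (fun i => (hψ i).tw)
        (fun s => by rw [tw_comp_iota, tw_sum hs]) i (by rwa [tw_eq_comm, tw_eq_comm]))
      rw [jm_tw] at this
      linarith
  have h2 : ∀ i, jm χ (ψ i) ≤ q + 4 := fun i => by
    have := (abs_le.1 (abs_jm_le h.1 (hψ i) (cv_one_pos hψ hs i))).2
    push_cast at this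
    linarith
  have h3 : (q - 2) * χ 1 ≤ (q + 4) * χ tau := by
    have e := abs_le.1 (h.abs_jm_add_le hψ hs j hj)
    have hpos := h.1.pos
    have hv : ((q : ℝ) + 4) * (q - 1) ≤ (q + 4) * (q + 3) * ψ j tau / ψ j 1 := by
      have hq : (0 : ℝ) ≤ q := Nat.cast_nonneg q
      rw [le_div_iff₀ (hψ j).pos]
      rcases hj with hj | hj
      · rw [hj]
        simp only [psiS, c1_tau, d2_tau, c1_one, d2_one]
        push_cast
        nlinarith [mul_nonneg hq hq, mul_nonneg hq (mul_nonneg hq hq)]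
      · rw [hj]
        simp only [psiE, c1_tau, d2_tau, c1_one, d2_one]
        push_cast
        nlinarith [mul_nonneg hq hq, mul_nonneg hq (mul_nonneg hq hq)]
    have e1 := e.1
    rw [jm] at e1
    push_cast at e1
    have e2 : ((q : ℝ) + 4) * (q - 1) - 6 ≤ (q + 5) * (q + 4) * χ tau / χ 1 := by
      have c1 : (q : ℝ) + 2 + 1 = q + 3 := by ring
      have c2 : (q : ℝ) + 2 + 2 = q + 4 := by ring
      have c3 : (q : ℝ) + 2 + 3 = q + 5 := by ring
      rw [c1, c2, c3] at e1
      linarith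
    rw [le_div_iff₀ hpos] at e2
    have hq : (0 : ℝ) < (q : ℝ) + 5 := by positivity
    refine le_of_mul_le_mul_left ?_ hq
    linarith
  have h4 := sum_jm (m := q + 2) h.1 hψ hs
  have h5 : ∑ i, ψ i 1 * jm χ (ψ i)
      ≤ ∑ i, ((q + 4) * ψ i 1 - (q + 1) * (if IsT2 (ψ i) then ψ i 1 else 0)) := by
    refine Finset.sum_le_sum fun i _ => ?_
    have hp := (hψ i).pos
    split_ifs with hi
    · nlinarith [h1 i hi]
    · nlinarith [h2 i]
  rw [h4, Finset.sum_sub_distrib, ← Finset.mul_sum, ← Finset.mul_sum, ← hs, map_one] at h5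
  push_cast at h5
  linarith

open Classical in
theorem IsHigh.mass_T2 {χ : Equiv.Perm (Fin (q + 5)) → ℝ} (h : IsHigh χ) {k : ℕ}
    {ψ : Fin k → Equiv.Perm (Fin (q + 4)) → ℝ} (hψ : ∀ i, IsIrr (ψ i))
    (hs : ∀ s, χ (iota s) = ∑ i, ψ i s) :
    (q + 1) * ∑ i, (if IsT2 (ψ i) then ψ i 1 else 0) ≤ 6 * χ 1 := by
  by_cases hex : ∃ j, IsT2 (ψ j)
  · obtain ⟨j, hj | hj⟩ := hex
    · exact h.mass_T2_aux hψ hs j hj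
    · have := h.tw.mass_T2_aux (fun i => (hψ i).tw)
        (fun s => by rw [tw_comp_iota, tw_sum hs]) j (by rwa [tw_eq_comm, tw_eq_comm])
      have e : ∀ i, IsT2 (StdRules.tw (ψ i)) ↔ IsT2 (ψ i) := fun i =>
        ⟨fun hh => by rw [← tw_tw (ψ i)]; exact hh.tw, fun hh => hh.tw⟩
      simpa only [e, tw_one] using this
  · push Not at hex
    simp only [hex, if_false, Finset.sum_const_zero, mul_zero]
    have := h.1.pos
    positivity

end Mass

section Dim

variable {q : ℕ}

theorem exists_constituent {G : Type} [Group G] [Fintype G] [Ambivalent G] {f θ : G → ℝ} {k : ℕ}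
    {ψ : Fin k → G → ℝ} (hψ : ∀ i, IsIrr (ψ i)) (hf : ∀ g, f g = ∑ i, ψ i g) (hθ : IsIrr θ)
    (h : 0 < avg (fun g => f g * θ g)) : ∃ i, ψ i = θ := by
  by_contra! hne
  simp only [hf, Finset.sum_mul] at h
  rw [avg_sum, Finset.sum_eq_zero fun i _ => (hψ i).avg_mul_of_ne hθ (hne i)] at h
  exact lt_irrefl _ h

theorem exists_avg_pos_of_sum {G : Type} [Group G] [Fintype G] {f θ : G → ℝ} {k : ℕ}
    {ψ : Fin k → G → ℝ} (hf : ∀ g, f g = ∑ i, ψ i g)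
    (h : 0 < avg (fun g => f g * θ g)) : ∃ i, 0 < avg (fun g => ψ i g * θ g) := by
  by_contra! hne
  simp only [hf, Finset.sum_mul] at h
  rw [avg_sum] at h
  exact absurd h (not_lt.2 (Finset.sum_nonpos fun i _ => hne i))

theorem avg_sum_mul_pos {G : Type} [Group G] [Fintype G] [Ambivalent G] {f : G → ℝ} {k : ℕ}
    {ψ : Fin k → G → ℝ} (hψ : ∀ i, IsRepChar (ψ i)) (hf : ∀ g, f g = ∑ i, ψ i g) {θ : G → ℝ}
    (hθ : IsIrr θ) (i : Fin k) (h : 0 < avg (fun g => ψ i g * θ g)) :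
    0 < avg (fun g => f g * θ g) := by
  simp only [hf, Finset.sum_mul]
  rw [avg_sum]
  refine Finset.sum_pos' (fun j _ => ?_) ⟨i, Finset.mem_univ i, h⟩
  obtain ⟨m, hm⟩ := (hψ j).exists_avg_mul hθ
  rw [hm]; positivity

theorem IsRepChar.exists_irr_le {G : Type} [Group G] [Fintype G] [Ambivalent G] {f : G → ℝ}
    (hf : IsRepChar f) (h1 : 0 < f 1) :
    ∃ θ, IsIrr θ ∧ θ 1 ≤ f 1 ∧ 0 < avg (fun g => f g * θ g) := by
  obtain ⟨k, ψ, hψ, hs⟩ := hf.decomp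
  have hk : k ≠ 0 := by
    rintro rfl
    rw [hs] at h1
    simp at h1
  let i : Fin k := ⟨0, Nat.pos_of_ne_zero hk⟩
  refine ⟨ψ i, hψ i, ?_, ?_⟩
  · rw [hs]
    exact Finset.single_le_sum (f := fun j => ψ j 1) (fun j _ => (hψ j).pos.le) (Finset.mem_univ i)
  · exact avg_sum_mul_pos (fun j => (hψ j).isRepChar) hs (hψ i) i (by rw [(hψ i).avg_sq]; norm_num)

theorem IsT2.one_ge {χ : Equiv.Perm (Fin (q + 4)) → ℝ} (h : IsT2 χ) :
    ((q : ℝ) + 4) * (q + 1) / 2 ≤ χ 1 := by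
  have h1 : ((q : ℝ) + 4) * (q + 1) / 2 ≤ psiS (1 : Equiv.Perm (Fin (q + 4))) := by
    simp only [psiS, c1_one, d2_one]
    push_cast
    linarith
  have h2 : ((q : ℝ) + 4) * (q + 1) / 2 ≤ psiE (1 : Equiv.Perm (Fin (q + 4))) := by
    simp only [psiE, c1_one, d2_one]
    push_cast
    linarith
  rcases h with (rfl | rfl) | (rfl | rfl)
  · exact h1
  · exact h2
  · rwa [tw_one]
  · rwa [tw_one]

theorem IsHigh.one_ge_of_T2 {χ : Equiv.Perm (Fin (q + 5)) → ℝ} (h : IsHigh χ)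
    {θ : Equiv.Perm (Fin (q + 4)) → ℝ} (hθ : IsT2 θ) (hθ' : IsIrr θ)
    (hp : 0 < avg (fun s => χ (iota s) * θ s)) :
    ((q : ℝ) + 1) * ((q + 4) * (q + 1) / 2) / 6 ≤ χ 1 := by
  classical
  obtain ⟨k, ψ, hψ, hs⟩ := (h.1.isRepChar.comp iota).decomp
  obtain ⟨i, rfl⟩ := exists_constituent hψ hs hθ' hp
  have h1 := h.mass_T2 hψ hs
  have h2 := Finset.single_le_sum (f := fun i => if IsT2 (ψ i) then ψ i 1 else 0)
    (fun j _ => by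
      have := (hψ j).pos
      positivity) (Finset.mem_univ i)
  simp only [hθ, if_true] at h2
  have h3 := hθ.one_ge
  have h4 := mul_le_mul_of_nonneg_left (h3.trans h2) (by positivity : (0 : ℝ) ≤ (q : ℝ) + 1)
  linarith

theorem IsHigh.one_ge_or {χ : Equiv.Perm (Fin (q + 6)) → ℝ} (h : IsHigh χ) :
    ((q : ℝ) + 1) * ((q + 4) * (q + 1) / 2) / 6 ≤ χ 1 ∨
      ∀ θ : Equiv.Perm (Fin (q + 4)) → ℝ, IsIrr θ → 0 < avg (fun s => χ (iota (iota s)) * θ s) →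
        IsHigh θ := by
  by_contra! hcon
  obtain ⟨hlt, θ, hθ, hp, hnot⟩ := hcon
  obtain ⟨k, ψ, hψ, hs⟩ := (h.1.isRepChar.comp iota).decomp
  have hs' : ∀ s, χ (iota (iota s)) = ∑ i, ψ i (iota s) := fun s => hs (iota s)
  obtain ⟨i, hi⟩ := exists_avg_pos_of_sum hs' hp
  have hle : ψ i 1 ≤ χ 1 := by
    have := hs 1
    rw [map_one] at this
    rw [this]
    exact Finset.single_le_sum (f := fun j => ψ j 1) (fun j _ => (hψ j).pos.le) (Finset.mem_univ i)
  have hq : (0 : ℝ) ≤ q := Nat.cast_nonneg q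
  rcases h.constituent hψ hs i with h2 | h3
  · have := h.one_ge_of_T2 (q := q + 1) h2 (hψ i)
      (avg_sum_mul_pos (fun j => (hψ j).isRepChar) hs (hψ i) i (by rw [(hψ i).avg_sq]; norm_num))
    push_cast at this
    nlinarith [mul_nonneg hq hq, mul_nonneg hq (mul_nonneg hq hq)]
  · obtain ⟨l, φ, hφ, ht⟩ := ((hψ i).isRepChar.comp iota).decomp
    obtain ⟨j, rfl⟩ := exists_constituent hφ ht hθ hi
    have h2 := (h3.constituent hφ ht j).resolve_right hnot
    have := h3.one_ge_of_T2 h2 hθ hi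
    linarith

theorem isIrr_units {φ : ℤˣ → ℝ} (h : IsIrr φ) : φ (-1) = φ 1 ∨ φ (-1) = -φ 1 := by
  have h1 := h.schur (-1) (-1)
  have : ∀ k : ℤˣ, -1 * (k * -1 * k⁻¹) = 1 := by decide
  simp only [this, Finset.sum_const, Finset.card_univ, nsmul_eq_mul] at h1
  have h2 : φ (-1) * φ (-1) = φ 1 * φ 1 := by
    apply mul_left_cancel₀ (card_pos' (G := ℤˣ)).ne'
    linarith
  exact mul_self_eq_mul_self_iff.1 h2

theorem IsHigh.one_ge_add {n : ℕ} {χ : Equiv.Perm (Fin (n + 5)) → ℝ} (h : IsHigh χ) :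
    ∃ θ₁ θ₂ : Equiv.Perm (Fin (n + 3)) → ℝ, IsIrr θ₁ ∧ IsIrr θ₂ ∧
      0 < avg (fun s => χ (iota (iota s)) * θ₁ s) ∧ 0 < avg (fun s => χ (iota (iota s)) * θ₂ s) ∧
      θ₁ 1 + θ₂ 1 ≤ χ 1 := by
  obtain ⟨k, X, hX, hs⟩ := (h.1.isRepChar.comp pairHom).decomp
  have hX1 : ∀ i, X i (1, -1) = X i 1 ∨ X i (1, -1) = - X i 1 := fun i => by
    obtain ⟨ψ, φ, hψ, hφ, he⟩ := (hX i).exists_prod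
    have e := he 1 (-1)
    have hne : ψ 1 * φ 1 ≠ 0 := mul_ne_zero hψ.pos.ne' hφ.pos.ne'
    rcases isIrr_units hφ with hu | hu
    · left
      apply mul_right_cancel₀ hne
      rw [e, hu]
    · right
      apply mul_right_cancel₀ hne
      rw [e, hu]; ring
  have hlt := abs_lt.1 (h.1.abs_lt (by omega) h.2.1 (σ := tau) (fun e => by
    have := congrArg (fun f => f 0) e
    simp at this))
  have hone : χ 1 = ∑ i, X i 1 := by rw [← hs, map_one]
  have htau : χ tau = ∑ i, X i (1, -1) := by rw [← hs, pairHom_neg_one]; simp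
  have hplus : ∃ i, X i (1, -1) = X i 1 := by
    by_contra! hno
    have : χ tau = - χ 1 := by
      rw [hone, htau, ← Finset.sum_neg_distrib]
      exact Finset.sum_congr rfl fun i _ => (hX1 i).resolve_left (hno i)
    linarith
  have hminus : ∃ i, X i (1, -1) = - X i 1 := by
    by_contra! hno
    have : χ tau = χ 1 := by
      rw [hone, htau]
      exact Finset.sum_congr rfl fun i _ => (hX1 i).resolve_right (hno i)
    linarith
  obtain ⟨i, hi⟩ := hplus
  obtain ⟨j, hj⟩ := hminus
  have hij : i ≠ j := by
    rintro rfl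
    rw [hi] at hj
    have := (hX i).pos
    linarith
  let inl := MonoidHom.inl (Equiv.Perm (Fin (n + 3))) ℤˣ
  have hs' : ∀ s, χ (iota (iota s)) = ∑ i, X i (inl s) := fun s => by
    rw [← hs, ← pairHom_one]; rfl
  have hr := fun i => (hX i).isRepChar.comp inl
  obtain ⟨θ₁, h1, h1', h1''⟩ := (hr i).exists_irr_le (by rw [map_one]; exact (hX i).pos)
  obtain ⟨θ₂, h2, h2', h2''⟩ := (hr j).exists_irr_le (by rw [map_one]; exact (hX j).pos)
  refine ⟨θ₁, θ₂, h1, h2, avg_sum_mul_pos hr hs' h1 i h1'', avg_sum_mul_pos hr hs' h2 j h2'', ?_⟩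
  rw [map_one] at h1' h2'
  rw [hone]
  refine (add_le_add h1' h2').trans ?_
  rw [← Finset.sum_pair (f := fun i => X i 1) hij]
  exact Finset.sum_le_sum_of_subset_of_nonneg (Finset.subset_univ _) fun i _ _ => (hX i).pos.le

theorem IsHigh.cube_le (n : ℕ) : ∀ {χ : Equiv.Perm (Fin n) → ℝ}, IsHigh χ →
    (n : ℝ) ^ 3 / 1000 ≤ χ 1 := by
  induction n using Nat.strong_induction_on with
  | _ n ih =>
    intro χ h
    rcases Nat.lt_or_ge n 10 with hn | hn
    · have : (n : ℝ) ≤ 10 := by exact_mod_cast hn.le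
      have h1 := h.1.one_le
      have h2 : (n : ℝ) ^ 3 ≤ 10 ^ 3 := by gcongr
      linarith
    · obtain ⟨q, rfl⟩ : ∃ q, n = q + 10 := ⟨n - 10, by omega⟩
      have hq : (0 : ℝ) ≤ q := Nat.cast_nonneg q
      have hq2 := mul_nonneg hq hq
      have hq3 := mul_nonneg hq hq2
      rcases IsHigh.one_ge_or (q := q + 4) h with h1 | h1
      · push_cast at h1 ⊢
        nlinarith
      · obtain ⟨θ₁, θ₂, i1, i2, p1, p2, hle⟩ := IsHigh.one_ge_add (n := q + 5) h
        have a1 := ih (q + 8) (by omega) (h1 θ₁ i1 p1)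
        have a2 := ih (q + 8) (by omega) (h1 θ₂ i2 p2)
        push_cast at a1 a2 ⊢
        nlinarith

end Dim

section Contraction

variable {n : ℕ}

/-- Pairing with `w0` detects the linear characters. -/
noncomputable def w0 (s : Equiv.Perm (Fin n)) : ℝ := 1 + sg s

/-- Pairing with `w1` detects the standard character and its twist. -/
noncomputable def w1 (s : Equiv.Perm (Fin n)) : ℝ := std s * (1 + sg s)

theorem tw_mul_w0 (ψ : Equiv.Perm (Fin n) → ℝ) (s : Equiv.Perm (Fin n)) :
    tw ψ s * w0 s = ψ s * w0 s := by
  simp only [tw, w0]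
  linear_combination ψ s * sg_mul_self s

theorem sg_tau_ne : (sg : Equiv.Perm (Fin (n + 2)) → ℝ) ≠ fun _ => 1 := fun h => by
  have := congrFun h tau
  rw [sg_tau] at this
  norm_num at this

theorem avg_mul_w0 {ψ : Equiv.Perm (Fin (n + 2)) → ℝ} (hψ : IsIrr ψ) [Decidable (IsLin ψ)] :
    avg (fun s => ψ s * w0 s) = if IsLin ψ then 1 else 0 := by
  have e : (fun s => ψ s * w0 s) = fun s => ψ s * (fun _ => 1) s + ψ s * sg s := by
    funext s; simp only [w0]; ring
  have h1 := (isIrr_one (G := Equiv.Perm (Fin (n + 2)))).avg_sq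
  have h2 := (isIrr_sg (n := n + 2)).avg_sq
  have h3 := (isIrr_one (G := Equiv.Perm (Fin (n + 2)))).avg_mul_of_ne isIrr_sg sg_tau_ne.symm
  have h4 := (isIrr_sg (n := n + 2)).avg_mul_of_ne isIrr_one sg_tau_ne
  rw [e, avg_add]
  split_ifs with h
  · rcases h with rfl | rfl
    · rw [h1, h3]; norm_num
    · rw [h4, h2]; norm_num
  · rw [hψ.avg_mul_of_ne isIrr_one fun e => h (Or.inl e),
      hψ.avg_mul_of_ne isIrr_sg fun e => h (Or.inr e)]
    norm_num

theorem IsIrr.avg_std_mul_eq_zero {ψ : Equiv.Perm (Fin (n + 2)) → ℝ} (hψ : IsIrr ψ) (h : ψ ≠ std) :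
    avg (fun s => std s * ψ s) = 0 := by
  by_cases h1 : ψ = fun _ => 1
  · subst h1
    simpa using avg_std
  · rw [avg_std_mul hψ.isRepChar.isClass, hψ.avg_iota_eq_zero h1 h, avg_eq_zero_of_ne hψ h1,
      sub_zero]

theorem std_ne_tw : (std : Equiv.Perm (Fin (n + 4)) → ℝ) ≠ tw std := fun h => by
  have := congrFun h tau
  simp only [tw, sg_tau, std, c1_tau] at this
  push_cast at this
  linarith [(Nat.cast_nonneg n : (0 : ℝ) ≤ n)]

theorem avg_mul_w1 {ψ : Equiv.Perm (Fin (n + 4)) → ℝ} (hψ : IsIrr ψ) [Decidable (IsT1 ψ)] :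
    avg (fun s => ψ s * w1 s) = if IsT1 ψ then 1 else 0 := by
  have e : (fun s => ψ s * w1 s) = fun s => std s * ψ s + std s * tw ψ s := by
    funext s; simp only [w1, tw]; ring
  rw [e, avg_add]
  split_ifs with h
  · rcases h with rfl | rfl
    · rw [avg_std_sq, hψ.tw.avg_std_mul_eq_zero std_ne_tw.symm, add_zero]
    · rw [tw_tw, avg_std_sq, hψ.avg_std_mul_eq_zero std_ne_tw.symm, zero_add]
  · rw [hψ.avg_std_mul_eq_zero fun e => h (Or.inl e),
      hψ.tw.avg_std_mul_eq_zero fun e => h (Or.inr (tw_eq_comm.1 e)), add_zero]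

theorem IsLin.one {ψ : Equiv.Perm (Fin n) → ℝ} (h : IsLin ψ) : ψ 1 = 1 := by
  rcases h with rfl | rfl
  · rfl
  · exact sg_one

theorem IsT1.one {ψ : Equiv.Perm (Fin n) → ℝ} (h : IsT1 ψ) : ψ 1 = n - 1 := by
  rcases h with rfl | rfl
  · simp [std]
  · rw [tw_one]; simp [std]

/-- The contraction factor. -/
noncomputable def cf (x : ℝ) : ℝ := (x - 4) * (x - 5) * (x - 6) * (x - 7) * (x - 8) * (x - 9)

theorem cf_pos {x : ℝ} (hx : 9 < x) : 0 < cf x := by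
  have h1 : 0 < x - 4 := by linarith
  have h2 : 0 < x - 5 := by linarith
  have h3 : 0 < x - 6 := by linarith
  have h4 : 0 < x - 7 := by linarith
  have h5 : 0 < x - 8 := by linarith
  have h6 : 0 < x - 9 := by linarith
  unfold cf
  positivity

theorem cf_succ (x : ℝ) : cf (x + 1) * (x - 9) = cf x * (x - 3) := by
  unfold cf; ring

theorem IsHigh.constituent_of_le (hn : 3 ≤ n) {χ : Equiv.Perm (Fin (n + 1)) → ℝ} (h : IsHigh χ)
    {k : ℕ} {ψ : Fin k → Equiv.Perm (Fin n) → ℝ} (hψ : ∀ i, IsIrr (ψ i))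
    (hs : ∀ s, χ (iota s) = ∑ i, ψ i s) (i : Fin k) : IsT2 (ψ i) ∨ IsHigh (ψ i) := by
  obtain ⟨n, rfl⟩ : ∃ m, n = m + 3 := ⟨n - 3, by omega⟩
  exact IsHigh.constituent (n := n) h hψ hs i

open Classical in
theorem IsHigh.mass_T2_of_le (hn : 4 ≤ n) {χ : Equiv.Perm (Fin (n + 1)) → ℝ} (h : IsHigh χ)
    {k : ℕ} {ψ : Fin k → Equiv.Perm (Fin n) → ℝ} (hψ : ∀ i, IsIrr (ψ i))
    (hs : ∀ s, χ (iota s) = ∑ i, ψ i s) :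
    (n - 3) * ∑ i, (if IsT2 (ψ i) then ψ i 1 else 0) ≤ 6 * χ 1 := by
  obtain ⟨n, rfl⟩ : ∃ m, n = m + 4 := ⟨n - 4, by omega⟩
  have := IsHigh.mass_T2 (q := n) h hψ hs
  push_cast
  convert this using 2
  ring

/-- Contraction of functionals under iterated restriction. -/
theorem IsHigh.avg_emb_le {a : ℕ} (ha : 10 ≤ a) {w : Equiv.Perm (Fin a) → ℝ} {M : ℝ} (hM : 0 ≤ M)
    (h0 : ∀ ψ : Equiv.Perm (Fin a) → ℝ, IsHigh ψ → avg (fun s => ψ s * w s) = 0) (b : ℕ) :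
    (∀ b' < b, ∀ ψ : Equiv.Perm (Fin (a + b')) → ℝ, IsIrr ψ → IsT2 ψ →
      avg (fun s => ψ (emb a b' s) * w s) ≤ M * ψ 1) →
    ∀ χ : Equiv.Perm (Fin (a + b)) → ℝ, IsHigh χ →
      avg (fun s => χ (emb a b s) * w s) ≤ M * (1 - cf a / cf (a + b)) * χ 1 := by
  classical
  have ha' : (10 : ℝ) ≤ a := by exact_mod_cast ha
  induction b with
  | zero =>
    intro _ χ hχ
    have e : avg (fun s => χ (emb a 0 s) * w s) = 0 := h0 χ hχ
    rw [e]
    have := (cf_pos (x := a) (by linarith)).ne'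
    simp [this]
  | succ b ih =>
    intro hT χ hχ
    have hb : (0 : ℝ) ≤ b := Nat.cast_nonneg b
    obtain ⟨k, ψ, hψ, hs⟩ := (hχ.1.isRepChar.comp (iota (n := a + b))).decomp
    have hm := IsHigh.mass_T2_of_le (n := a + b) (by omega) hχ hψ hs
    have ih' := ih fun b' hb' => hT b' (by omega)
    set h := cf a / cf (a + b) with hh
    have hterm : ∀ i, avg (fun s => ψ i (emb a b s) * w s)
        ≤ M * (1 - h) * ψ i 1 + M * h * (if IsT2 (ψ i) then ψ i 1 else 0) := fun i => by
      by_cases h2 : IsT2 (ψ i)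
      · rw [if_pos h2]
        refine (hT b (by omega) (ψ i) (hψ i) h2).trans (le_of_eq ?_)
        ring
      · rw [if_neg h2]
        have h3 := (IsHigh.constituent_of_le (n := a + b) (by omega) hχ hψ hs i).resolve_left h2
        rw [mul_zero, add_zero]
        exact ih' (ψ i) h3
    have e1 : avg (fun s => χ (emb a (b + 1) s) * w s)
        = ∑ i, avg (fun s => ψ i (emb a b s) * w s) := by
      rw [← avg_sum]
      congr 1
      funext s
      rw [emb_succ, hs, Finset.sum_mul]
    have hone : χ 1 = ∑ i, ψ i 1 := by rw [← hs, map_one]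
    have hpos1 := cf_pos (x := a) (by linarith)
    have hpos2 := cf_pos (x := a + b) (by linarith)
    have hpos3 := cf_pos (x := a + b + 1) (by linarith)
    have hhpos : 0 < h := by positivity
    have hab : (0 : ℝ) < a + b - 3 := by linarith
    have hrec : cf a / cf (a + (b + 1 : ℕ)) = h * (1 - 6 / (a + b - 3)) := by
      have := cf_succ (a + b)
      push_cast
      rw [← add_assoc, hh]
      field_simp
      linear_combination -this
    have hmass : ∑ i, (if IsT2 (ψ i) then ψ i 1 else 0) ≤ 6 / (a + b - 3) * χ 1 := by
      rw [div_mul_eq_mul_div, le_div_iff₀ hab]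
      push_cast at hm
      linarith
    calc avg (fun s => χ (emb a (b + 1) s) * w s)
        ≤ ∑ i, (M * (1 - h) * ψ i 1 + M * h * (if IsT2 (ψ i) then ψ i 1 else 0)) := by
          rw [e1]; exact Finset.sum_le_sum fun i _ => hterm i
      _ = M * (1 - h) * χ 1 + M * h * ∑ i, (if IsT2 (ψ i) then ψ i 1 else 0) := by
          rw [Finset.sum_add_distrib, ← Finset.mul_sum, ← Finset.mul_sum, hone]
      _ ≤ M * (1 - h) * χ 1 + M * h * (6 / (a + b - 3) * χ 1) := by gcongr
      _ = M * (1 - cf a / cf (a + (b + 1 : ℕ))) * χ 1 := by rw [hrec]; ring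

end Contraction

section Mass

variable {n : ℕ}

theorem isClass_w0 : IsClass (w0 : Equiv.Perm (Fin n) → ℝ) := fun a b => by
  simp only [w0, isClass_sg a b]

theorem w0_iota (s : Equiv.Perm (Fin n)) : w0 (iota s) = w0 s := by simp [w0, sg_iota]

theorem avg_sg : avg (sg : Equiv.Perm (Fin (n + 2)) → ℝ) = 0 := by
  simpa using (isIrr_sg (n := n + 2)).avg_mul_of_ne isIrr_one sg_tau_ne

theorem avg_w0 : avg (w0 : Equiv.Perm (Fin (n + 2)) → ℝ) = 1 := by
  unfold w0
  rw [avg_add, avg_const, avg_sg, add_zero]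

theorem avg_w0_tau : avg (fun s : Equiv.Perm (Fin (n + 2)) => w0 (tau * iota (iota s))) = 1 := by
  have : (fun s : Equiv.Perm (Fin (n + 2)) => w0 (tau * iota (iota s))) = fun s => 1 - sg s := by
    funext s
    simp only [w0, StdRules.sg_mul, sg_tau, sg_iota]
    ring
  rw [this, avg_sub, avg_const, avg_sg, sub_zero]

theorem avg_std_w0 : avg (fun s : Equiv.Perm (Fin (n + 3)) => std s * w0 s) = 0 := by
  rw [avg_std_mul isClass_w0]
  simp only [w0_iota]
  change avg w0 - avg w0 = 0
  rw [avg_w0, avg_w0, sub_self]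

theorem avg_psiS_w0 : avg (fun s : Equiv.Perm (Fin (n + 4)) => psiS s * w0 s) = 0 := by
  rw [avg_psiS_mul isClass_w0, avg_w0_tau]
  simp only [w0_iota]
  change (avg w0 - 2 * avg w0 + 1) / 2 = 0
  rw [avg_w0, avg_w0]
  norm_num

theorem avg_psiE_w0 : avg (fun s : Equiv.Perm (Fin (n + 4)) => psiE s * w0 s) = 0 := by
  rw [avg_psiE_mul isClass_w0, avg_w0_tau]
  simp only [w0_iota]
  change (avg w0 - 2 * avg w0 - 1) / 2 + avg w0 = 0
  rw [avg_w0, avg_w0, avg_w0]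
  norm_num

theorem psiS_emb {a : ℕ} (b : ℕ) (s : Equiv.Perm (Fin a)) :
    psiS (emb a b s) = psiS s + b * std s + b * (b - 1) / 2 := by
  simp only [psiS, std, c1_emb, d2_emb]
  ring

theorem psiE_emb {a : ℕ} (b : ℕ) (s : Equiv.Perm (Fin a)) :
    psiE (emb a b s) = psiE s + b * std s + b * (b - 1) / 2 := by
  simp only [psiE, std, c1_emb, d2_emb]
  ring

theorem avg_psiS_emb_w0 (b : ℕ) :
    avg (fun s : Equiv.Perm (Fin (n + 4)) => psiS (emb (n + 4) b s) * w0 s) = b * (b - 1) / 2 := by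
  have : (fun s : Equiv.Perm (Fin (n + 4)) => psiS (emb (n + 4) b s) * w0 s)
      = fun s => psiS s * w0 s + b * (std s * w0 s) + b * (b - 1) / 2 * w0 s := by
    funext s
    rw [psiS_emb]; ring
  rw [this, avg_add, avg_add, avg_mul_left, avg_mul_left, avg_psiS_w0, avg_std_w0]
  change 0 + _ + _ * avg w0 = _
  rw [avg_w0]; ring

theorem avg_psiE_emb_w0 (b : ℕ) :
    avg (fun s : Equiv.Perm (Fin (n + 4)) => psiE (emb (n + 4) b s) * w0 s) = b * (b - 1) / 2 := by
  have : (fun s : Equiv.Perm (Fin (n + 4)) => psiE (emb (n + 4) b s) * w0 s)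
      = fun s => psiE s * w0 s + b * (std s * w0 s) + b * (b - 1) / 2 * w0 s := by
    funext s
    rw [psiE_emb]; ring
  rw [this, avg_add, avg_add, avg_mul_left, avg_mul_left, avg_psiE_w0, avg_std_w0]
  change 0 + _ + _ * avg w0 = _
  rw [avg_w0]; ring

theorem IsT2.avg_emb_w0 {b : ℕ} {ψ : Equiv.Perm (Fin (n + 4 + b)) → ℝ} (h : IsT2 ψ) :
    avg (fun s => ψ (emb (n + 4) b s) * w0 s) = b * (b - 1) / 2 := by
  have e : ∀ χ : Equiv.Perm (Fin (n + 4 + b)) → ℝ,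
      avg (fun s => StdRules.tw χ (emb (n + 4) b s) * w0 s)
        = avg (fun s => χ (emb (n + 4) b s) * w0 s) := fun χ => by
    congr 1
    funext s
    have := tw_mul_w0 (fun s => χ (emb (n + 4) b s)) s
    rw [← this, StdRules.tw, StdRules.tw, sg_emb]
  rcases h with (rfl | rfl) | (rfl | rfl)
  · exact avg_psiS_emb_w0 b
  · exact avg_psiE_emb_w0 b
  · rw [e]; exact avg_psiS_emb_w0 b
  · rw [e]; exact avg_psiE_emb_w0 b

theorem IsT2.le_one (hn : 4 ≤ n) {χ : Equiv.Perm (Fin n) → ℝ} (h : IsT2 χ) :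
    (n : ℝ) * (n - 3) / 2 ≤ χ 1 := by
  obtain ⟨n, rfl⟩ : ∃ m, n = m + 4 := ⟨n - 4, by omega⟩
  have := IsT2.one_ge (q := n) h
  push_cast
  linarith

/-- The mass of the linear characters in the restriction to a Young subgroup. -/
theorem IsHigh.mass_lin {a : ℕ} (ha : 10 ≤ a) (b : ℕ) {χ : Equiv.Perm (Fin (a + b)) → ℝ}
    (h : IsHigh χ) : avg (fun s => χ (emb a b s) * w0 s)
      ≤ (b : ℝ) ^ 2 / ((a + b) * (a + b - 3)) * (1 - cf a / cf (a + b)) * χ 1 := by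
  classical
  have ha' : (10 : ℝ) ≤ a := by exact_mod_cast ha
  have hb : (0 : ℝ) ≤ b := Nat.cast_nonneg b
  have hab : (0 : ℝ) < a + b - 3 := by linarith
  refine IsHigh.avg_emb_le ha (by positivity) ?_ b ?_ χ h
  · obtain ⟨n, rfl⟩ : ∃ m, a = m + 2 := ⟨a - 2, by omega⟩
    intro ψ hψ
    rw [avg_mul_w0 hψ.1, if_neg hψ.2.1]
  · intro b' hb' ψ _ h2
    have hone := h2.le_one (by omega)
    obtain ⟨n, rfl⟩ : ∃ m, a = m + 4 := ⟨a - 4, by omega⟩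
    rw [h2.avg_emb_w0]
    push_cast at *
    set A : ℝ := n + 4
    have hc : (b' : ℝ) + 1 ≤ b := by exact_mod_cast hb'
    have hc0 : (0 : ℝ) ≤ b' := Nat.cast_nonneg b'
    refine le_trans ?_ (mul_le_mul_of_nonneg_left hone (by positivity))
    rw [div_mul_eq_mul_div, le_div_iff₀ (by positivity)]
    have k1 : (b' : ℝ) * (A + b) ≤ b * (A + b') := by nlinarith
    have k2 : ((b' : ℝ) - 1) * (A + b - 3) ≤ b * (A + b' - 3) := by nlinarith
    have k3 : 0 ≤ (b' : ℝ) * (b' - 1) := by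
      rcases Nat.eq_zero_or_pos b' with h0 | h0
      · simp [h0]
      · have : (1 : ℝ) ≤ b' := by exact_mod_cast h0
        exact mul_nonneg hc0 (by linarith)
    rcases le_or_gt (1 : ℝ) b' with h1 | h1
    · have := mul_le_mul k1 k2 (mul_nonneg (by linarith) (by linarith)) (by positivity)
      linarith
    · have h3 : (b' : ℝ) * (b' - 1) ≤ 0 := by nlinarith
      have h4 : 0 ≤ (b : ℝ) ^ 2 * ((A + b') * (A + b' - 3) / 2) := by
        have : 0 ≤ A + b' - 3 := by linarith
        positivity
      refine le_trans (mul_nonpos_of_nonpos_of_nonneg (by linarith) (by positivity)) h4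

theorem IsRepChar.avg_mul_w1_le (hn : 4 ≤ n) {f : Equiv.Perm (Fin n) → ℝ} (hf : IsRepChar f) :
    avg (fun s => f s * ((n - 1) * w1 s)) ≤ f 1 := by
  classical
  obtain ⟨k, ψ, hψ, hs⟩ := hf.decomp
  have e : avg (fun s => f s * ((n - 1) * w1 s))
      = ∑ i, ((n : ℝ) - 1) * avg (fun s => ψ i s * w1 s) := by
    rw [← Finset.mul_sum, ← avg_sum, ← avg_mul_left]
    congr 1
    funext s
    rw [hs, ← Finset.sum_mul]; ring
  rw [e, hs]
  refine Finset.sum_le_sum fun i _ => ?_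
  obtain ⟨n, rfl⟩ : ∃ m, n = m + 4 := ⟨n - 4, by omega⟩
  rw [avg_mul_w1 (hψ i)]
  split_ifs with h
  · rw [h.one]; simp
  · simp [(hψ i).pos.le]

/-- The mass of the standard characters in the restriction to a symmetric subgroup. -/
theorem IsHigh.mass_std {a : ℕ} (ha : 10 ≤ a) (b : ℕ) {χ : Equiv.Perm (Fin (a + b)) → ℝ}
    (h : IsHigh χ) : avg (fun s => χ (emb a b s) * ((a - 1) * w1 s))
      ≤ (1 - cf a / cf (a + b)) * χ 1 := by
  classical
  rw [← one_mul (1 - _)]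
  refine IsHigh.avg_emb_le ha zero_le_one ?_ b ?_ χ h
  · intro ψ hψ
    have e : avg (fun s => ψ s * ((a - 1) * w1 s)) = (a - 1) * avg (fun s => ψ s * w1 s) := by
      rw [← avg_mul_left]
      congr 1
      funext s; ring
    obtain ⟨n, rfl⟩ : ∃ m, a = m + 4 := ⟨a - 4, by omega⟩
    rw [e, avg_mul_w1 hψ.1, if_neg hψ.2.2.1, mul_zero]
  · intro b' _ ψ hψ _
    rw [one_mul]
    have := (hψ.isRepChar.comp (emb a b')).avg_mul_w1_le (by omega)
    rwa [map_one] at this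

end Mass

section Young

open Equiv.Perm (cycleType viaEmbedding viaEmbeddingHom)

variable {a b n : ℕ}

theorem cycleType_viaEmbedding {α β : Type} [Fintype α] [DecidableEq α] [Fintype β] [DecidableEq β]
    (e : Equiv.Perm α) (ι : α ↪ β) : (e.viaEmbedding ι).cycleType = e.cycleType := by
  classical
  unfold viaEmbedding
  exact @Equiv.Perm.cycleType_extendDomain _ _ _ _ _ _ _ (fun _ => Classical.propDecidable _) _ _

theorem cycleType_iota (s : Equiv.Perm (Fin n)) : (iota s).cycleType = s.cycleType := by
  rw [← cycleType_viaEmbedding s (Fin.succEmb n)]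
  congr 1
  apply Equiv.ext
  intro x
  refine Fin.cases ?_ (fun i => ?_) x
  · rw [iota_zero, Equiv.Perm.viaEmbedding_apply_of_notMem]
    rintro ⟨y, hy⟩
    exact Fin.succ_ne_zero y hy
  · rw [iota_succ]
    exact (Equiv.Perm.viaEmbedding_apply s (Fin.succEmb n) i).symm

theorem cycleType_emb (b : ℕ) (s : Equiv.Perm (Fin a)) :
    (emb a b s).cycleType = s.cycleType := by
  induction b with
  | zero => rfl
  | succ b ih => rw [emb_succ, cycleType_iota, ih]

theorem IsClass.eq_of_cycleType {F : Equiv.Perm (Fin n) → ℝ} (hF : IsClass F)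
    {s t : Equiv.Perm (Fin n)} (h : s.cycleType = t.cycleType) : F s = F t :=
  hF.eq_of_isConj (Equiv.Perm.isConj_iff_cycleType_eq.2 h)

theorem disjoint_via (s : Equiv.Perm (Fin a)) (t : Equiv.Perm (Fin b)) :
    Equiv.Perm.Disjoint (viaEmbeddingHom (Fin.castAddEmb b : Fin a ↪ Fin (a + b)) s)
      (viaEmbeddingHom (Fin.natAddEmb a : Fin b ↪ Fin (a + b)) t) := by
  intro x
  refine Fin.addCases (fun i => Or.inr ?_) (fun j => Or.inl ?_) x
  · refine Equiv.Perm.viaEmbedding_apply_of_notMem _ _ _ ?_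
    rintro ⟨y, hy⟩
    have := congrArg Fin.val hy
    simp at this
    omega
  · refine Equiv.Perm.viaEmbedding_apply_of_notMem _ _ _ ?_
    rintro ⟨y, hy⟩
    have := congrArg Fin.val hy
    simp at this
    omega

/-- The Young subgroup `S_a × S_b` of `S_{a+b}`. -/
noncomputable def young (a b : ℕ) :
    Equiv.Perm (Fin a) × Equiv.Perm (Fin b) →* Equiv.Perm (Fin (a + b)) :=
  MonoidHom.noncommCoprod (viaEmbeddingHom (Fin.castAddEmb b)) (viaEmbeddingHom (Fin.natAddEmb a))
    fun s t => (disjoint_via s t).commute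

theorem cycleType_young (s : Equiv.Perm (Fin a)) (t : Equiv.Perm (Fin b)) :
    (young a b (s, t)).cycleType = s.cycleType + t.cycleType := by
  rw [young, MonoidHom.noncommCoprod_apply, (disjoint_via s t).cycleType_mul]
  congr 1
  · exact cycleType_viaEmbedding _ _
  · exact cycleType_viaEmbedding _ _

theorem young_injective : Function.Injective (young a b) := by
  rw [injective_iff_map_eq_one]
  rintro ⟨s, t⟩ h
  have := cycleType_young s t
  rw [h, Equiv.Perm.cycleType_one, eq_comm, add_eq_zero, Equiv.Perm.cycleType_eq_zero,
    Equiv.Perm.cycleType_eq_zero] at this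
  rw [this.1, this.2]
  rfl

theorem young_castAdd (s : Equiv.Perm (Fin a)) (t : Equiv.Perm (Fin b)) (i : Fin a) :
    young a b (s, t) (Fin.castAdd b i) = Fin.castAdd b (s i) := by
  rw [young, MonoidHom.noncommCoprod_apply, Equiv.Perm.mul_apply]
  have h : viaEmbeddingHom (Fin.natAddEmb a) t (Fin.castAdd b i) = Fin.castAdd b i := by
    refine Equiv.Perm.viaEmbedding_apply_of_notMem _ _ _ ?_
    rintro ⟨y, hy⟩
    have := congrArg Fin.val hy
    simp at this
    omega
  rw [h]
  exact Equiv.Perm.viaEmbedding_apply s (Fin.castAddEmb b) i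

theorem young_natAdd (s : Equiv.Perm (Fin a)) (t : Equiv.Perm (Fin b)) (j : Fin b) :
    young a b (s, t) (Fin.natAdd a j) = Fin.natAdd a (t j) := by
  rw [young, MonoidHom.noncommCoprod_apply, Equiv.Perm.mul_apply]
  have h : viaEmbeddingHom (Fin.natAddEmb a) t (Fin.natAdd a j) = Fin.natAdd a (t j) :=
    Equiv.Perm.viaEmbedding_apply t (Fin.natAddEmb a) j
  rw [h]
  refine Equiv.Perm.viaEmbedding_apply_of_notMem _ _ _ ?_
  rintro ⟨y, hy⟩
  have := congrArg Fin.val hy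
  simp at this
  omega

/-- The indicator of the first `a` points. -/
def half (a b : ℕ) (x : Fin (a + b)) : Bool := decide (x.val < a)

theorem half_young (s : Equiv.Perm (Fin a)) (t : Equiv.Perm (Fin b)) :
    half a b ∘ young a b (s, t) = half a b := by
  funext x
  refine Fin.addCases (fun i => ?_) (fun j => ?_) x
  · simp [half, young_castAdd]
  · simp [half, young_natAdd]

theorem card_stab_half : Fintype.card {g : Equiv.Perm (Fin (a + b)) // half a b ∘ g = half a b}
    = a.factorial * b.factorial := by
  rw [DomMulAct.stabilizer_card, Fintype.prod_bool]
  have h1 : Fintype.card {x // half a b x = true} = a := by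
    have e : {x // half a b x = true} ≃ Fin a :=
      { toFun := fun x => ⟨x.1.val, by simpa [half] using x.2⟩
        invFun := fun i => ⟨Fin.castAdd b i, by simp [half]⟩
        left_inv := fun x => rfl
        right_inv := fun i => rfl }
    rw [Fintype.card_congr e, Fintype.card_fin]
  have h2 : Fintype.card {x // half a b x = false} = b := by
    have := Fintype.card_subtype_compl (fun x => half a b x = true)
    simp only [Bool.not_eq_true, h1, Fintype.card_fin] at this
    omega
  rw [h1, h2]

/-- The number of two-colourings fixed by a permutation. -/
def colours {n : ℕ} (σ : Equiv.Perm (Fin n)) : ℝ :=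
  ∑ f : Fin n → Bool, if f ∘ σ = f then 1 else 0

theorem avg_young_le {F : Equiv.Perm (Fin (a + b)) → ℝ} (hF : IsClass F) (h0 : ∀ g, 0 ≤ F g) :
    avg (fun p => F (young a b p)) ≤ avg (fun g => colours g * F g) := by
  classical
  set X : Finset (Fin (a + b) → Bool) :=
    Finset.univ.image fun g : Equiv.Perm (Fin (a + b)) => half a b ∘ ⇑(g⁻¹) with hX
  have key := sum_card_filter hF X (fun σ f => f ∘ ⇑σ = f) (half a b) (by
    intro x hx
    obtain ⟨g, -, rfl⟩ := Finset.mem_image.1 hx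
    refine ⟨g, fun σ => ?_⟩
    constructor
    · intro h
      funext y
      have := congrFun h (g y)
      simpa using this
    · intro h
      funext y
      have := congrFun h (g⁻¹ y)
      simpa using this)
  have h1 : ∑ g : Equiv.Perm (Fin (a + b)), (∑ x ∈ X, if x ∘ ⇑g = x then (1 : ℝ) else 0) * F g ≤ ∑ g, colours g * F g := by
    refine Finset.sum_le_sum fun g _ => mul_le_mul_of_nonneg_right ?_ (h0 g)
    refine Finset.sum_le_sum_of_subset_of_nonneg (Finset.subset_univ _) fun f _ _ => ?_
    split_ifs <;> norm_num
  have h2 : ∑ p, F (young a b p) ≤ ∑ g : Equiv.Perm (Fin (a + b)),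
      if half a b ∘ ⇑g = half a b then F g else 0 := by
    rw [← Finset.sum_filter, ← Finset.sum_image (f := F) (g := young a b) (s := Finset.univ)
      (fun x _ y _ h => young_injective h)]
    refine Finset.sum_le_sum_of_subset_of_nonneg ?_ fun g _ _ => h0 g
    intro g hg
    obtain ⟨⟨s, t⟩, -, rfl⟩ := Finset.mem_image.1 hg
    exact Finset.mem_filter.2 ⟨Finset.mem_univ _, half_young s t⟩
  have h3 : (a + b).factorial ≤ (a.factorial * b.factorial) * X.card := by
    have := Finset.card_le_mul_card_image (f := fun g : Equiv.Perm (Fin (a + b)) => half a b ∘ ⇑(g⁻¹))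
      (Finset.univ) (a.factorial * b.factorial) (by
        intro x hx
        obtain ⟨g₁, -, rfl⟩ := Finset.mem_image.1 hx
        rw [← card_stab_half, Fintype.card_subtype]
        refine Finset.card_le_card_of_injOn (fun g => g⁻¹ * g₁) ?_ ?_
        · intro g hg
          have hg := (Finset.mem_filter.1 hg).2
          refine Finset.mem_coe.2 (Finset.mem_filter.2 ⟨Finset.mem_univ _, ?_⟩)
          funext y
          have := congrFun hg (g₁ y)
          simpa using this
        · intro g _ g' _ h
          simpa using h)
    rwa [Finset.card_univ, Fintype.card_perm, Fintype.card_fin] at this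
  have hX0 : (0 : ℝ) ≤ X.card := by positivity
  have h4 : 0 ≤ ∑ p, F (young a b p) := Finset.sum_nonneg fun _ _ => h0 _
  have h5 := mul_le_mul_of_nonneg_left h2 hX0
  rw [← key] at h5
  have h6 := h5.trans h1
  unfold avg
  rw [Fintype.card_prod, Nat.cast_mul, card_perm_fin, card_perm_fin, card_perm_fin]
  have e1 : (0 : ℝ) < ((a.factorial : ℝ) * b.factorial) := by positivity
  have e2 : (0 : ℝ) < ((a + b).factorial : ℝ) := by positivity
  have e3 : ((a + b).factorial : ℝ) ≤ ((a.factorial : ℝ) * b.factorial) * X.card := by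
    exact_mod_cast h3
  rw [div_le_div_iff₀ e1 e2]
  calc _ ≤ (∑ p, F (young a b p)) * (((a.factorial : ℝ) * b.factorial) * X.card) :=
        mul_le_mul_of_nonneg_left e3 h4
    _ ≤ _ := by
        rw [mul_comm (∑ g, colours g * F g)]
        nlinarith

end Young

section Burnside

variable {n : ℕ}

/-- The number of points of each of the first three colours. -/
def counts (F : Fin n → Bool × Bool) : Fin (n + 1) × Fin (n + 1) × Fin (n + 1) :=
  let c : Bool × Bool → Fin (n + 1) := fun i =>
    ⟨Fintype.card {x // F x = i}, by
      have := Fintype.card_subtype_le (fun x => F x = i)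
      rw [Fintype.card_fin] at this
      omega⟩
  (c (true, true), c (true, false), c (false, true))

theorem exists_perm_of_counts {F F' : Fin n → Bool × Bool} (h : counts F = counts F') :
    ∃ σ : Equiv.Perm (Fin n), F' ∘ σ = F := by
  have hc (f : Fin n → Bool × Bool) : Fintype.card {x // f x = (true, true)}
      + Fintype.card {x // f x = (true, false)} + Fintype.card {x // f x = (false, true)}
      + Fintype.card {x // f x = (false, false)} = n := by
    have := Fintype.card_congr (Equiv.sigmaFiberEquiv f)
    rw [Fintype.card_sigma, Fintype.sum_prod_type, Fintype.card_fin] at this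
    simp only [Fintype.sum_bool] at this
    omega
  have hF := hc F
  have hF' := hc F'
  simp only [counts, Prod.mk.injEq, Fin.mk.injEq] at h
  obtain ⟨h1, h2, h3⟩ := h
  have h4 : Fintype.card {x // F x = (false, false)}
      = Fintype.card {x // F' x = (false, false)} := by omega
  have h5 (c : Bool × Bool) : Fintype.card {x // F x = c} = Fintype.card {x // F' x = c} := by
    rcases c with ⟨_ | _, _ | _⟩ <;> assumption
  exact ⟨Equiv.ofFiberEquiv fun c => Fintype.equivOfCardEq (h5 c),
    funext fun x => Equiv.ofFiberEquiv_map _ x⟩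

theorem sum_fixed_colourings_le :
    ∑ σ : Equiv.Perm (Fin n), (Finset.univ.filter fun F : Fin n → Bool × Bool => F ∘ σ = F).card
      ≤ (n + 1) ^ 3 * n.factorial := by
  classical
  let _ : MulAction (Equiv.Perm (Fin n)) (Fin n → Bool × Bool) := arrowAction
  have hB := MulAction.sum_card_fixedBy_eq_card_orbits_mul_card_group (Equiv.Perm (Fin n))
    (Fin n → Bool × Bool)
  have h1 (σ : Equiv.Perm (Fin n)) :
      (Finset.univ.filter fun F : Fin n → Bool × Bool => F ∘ σ = F).card
        = Fintype.card (MulAction.fixedBy (Fin n → Bool × Bool) σ) := by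
    rw [← Fintype.card_subtype]
    refine Fintype.card_congr (Equiv.subtypeEquivRight fun F => ?_)
    rw [MulAction.mem_fixedBy]
    constructor
    · intro h
      funext x
      have := congrFun h (σ⁻¹ x)
      change F (σ⁻¹ x) = F x
      simpa using this.symm
    · intro h
      funext x
      have := congrFun h (σ x)
      change F (σ⁻¹ (σ x)) = _ at this
      simpa using this.symm
  rw [Finset.sum_congr rfl fun σ _ => h1 σ, hB, Fintype.card_perm, Fintype.card_fin]
  refine Nat.mul_le_mul_right _ ?_
  have hle : Fintype.card (Quotient (MulAction.orbitRel (Equiv.Perm (Fin n)) (Fin n → Bool × Bool)))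
      ≤ Fintype.card (Fin (n + 1) × Fin (n + 1) × Fin (n + 1)) := by
    refine Fintype.card_le_of_injective (fun q => counts q.out) fun q q' h => ?_
    obtain ⟨σ, hσ⟩ := exists_perm_of_counts h
    rw [← q.out_eq, ← q'.out_eq]
    refine Quotient.sound ⟨σ⁻¹, ?_⟩
    rw [← hσ]
    funext x
    change q'.out ((σ⁻¹)⁻¹ x) = _
    simp
  refine hle.trans (le_of_eq ?_)
  simp only [Fintype.card_prod, Fintype.card_fin]
  ring

theorem colours_sq (σ : Equiv.Perm (Fin n)) : colours σ ^ 2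
    = (Finset.univ.filter fun F : Fin n → Bool × Bool => F ∘ σ = F).card := by
  have h : colours σ = (Finset.univ.filter fun f : Fin n → Bool => f ∘ σ = f).card := by
    rw [colours, Finset.sum_boole]
  rw [h, sq, ← Nat.cast_mul, ← Finset.card_product]
  congr 1
  symm
  refine Finset.card_bij (fun F _ => (fun x => (F x).1, fun x => (F x).2)) ?_ ?_ ?_
  · intro F hF
    have hF := (Finset.mem_filter.1 hF).2
    simp only [Finset.mem_product, Finset.mem_filter, Finset.mem_univ, true_and]
    exact ⟨funext fun x => congrArg Prod.fst (congrFun hF x),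
      funext fun x => congrArg Prod.snd (congrFun hF x)⟩
  · intro F _ F' _ h
    rw [Prod.mk.injEq] at h
    exact funext fun x => Prod.ext (congrFun h.1 x) (congrFun h.2 x)
  · rintro ⟨f, g⟩ h
    simp only [Finset.mem_product, Finset.mem_filter, Finset.mem_univ, true_and] at h
    refine ⟨fun x => (f x, g x), ?_, rfl⟩
    refine Finset.mem_filter.2 ⟨Finset.mem_univ _, ?_⟩
    funext x
    exact Prod.ext (congrFun h.1 x) (congrFun h.2 x)

theorem avg_colours_sq_le (n : ℕ) :
    avg (fun σ : Equiv.Perm (Fin n) => colours σ ^ 2) ≤ ((n : ℝ) + 1) ^ 3 := by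
  unfold avg
  rw [card_perm_fin, div_le_iff₀ (by positivity)]
  simp_rw [colours_sq]
  exact_mod_cast sum_fixed_colourings_le (n := n)

theorem IsIrr.avg_abs_young_le {a b : ℕ} {χ : Equiv.Perm (Fin (a + b)) → ℝ} (h : IsIrr χ) :
    avg (fun p => |χ (young a b p)|) ≤ √(((a : ℝ) + b + 1) ^ 3) := by
  have hcl : IsClass (fun g => |χ g|) := fun x y => by
    change |χ _| = |χ _|
    rw [h.isRepChar.isClass]
  refine (avg_young_le hcl fun g => abs_nonneg _).trans (Real.le_sqrt_of_sq_le ?_)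
  have hc := avg_colours_sq_le (a + b)
  push_cast at hc
  refine le_trans ?_ hc
  have hq := h.avg_sq
  have hG := card_pos' (G := Equiv.Perm (Fin (a + b)))
  unfold avg at hq ⊢
  rw [div_eq_one_iff_eq hG.ne'] at hq
  rw [div_pow, div_le_div_iff₀ (by positivity) hG]
  have := Finset.sum_mul_sq_le_sq_mul_sq Finset.univ (fun g : Equiv.Perm (Fin (a + b)) => colours g)
    (fun g => |χ g|)
  have e : ∑ g, |χ g| ^ 2 = Fintype.card (Equiv.Perm (Fin (a + b))) := by
    rw [← hq]
    exact Finset.sum_congr rfl fun g _ => by rw [sq_abs, sq]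
  rw [e] at this
  nlinarith

end Burnside

section Split

open Classical in
/-- The `{0,1}`-valued indicator of a proposition. -/
noncomputable def ind (p : Prop) : ℝ := if p then 1 else 0

theorem ind_of {p : Prop} (h : p) : ind p = 1 := if_pos h

theorem ind_of_not {p : Prop} (h : ¬p) : ind p = 0 := if_neg h

theorem ind_nonneg (p : Prop) : 0 ≤ ind p := by unfold ind; split_ifs <;> norm_num

theorem avg_prod_mul {G H : Type} [Group G] [Fintype G] [Group H] [Fintype H] (f : G → ℝ)
    (g : H → ℝ) : avg (fun p : G × H => f p.1 * g p.2) = avg f * avg g := by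
  unfold avg
  rw [Fintype.sum_prod_type, Fintype.card_prod, Nat.cast_mul, div_mul_div_comm,
    Finset.sum_mul_sum]

variable {n a b : ℕ}

theorem ind_le_avg_mul_w0 {ψ : Equiv.Perm (Fin n) → ℝ} (hψ : IsIrr ψ) :
    ind (IsLin ψ) ≤ avg (fun s => ψ s * w0 s) := by
  have e : avg (fun s => ψ s * w0 s)
      = avg (fun s => ψ s * (fun _ => (1 : ℝ)) s) + avg (fun s => ψ s * sg s) := by
    rw [← avg_add]
    congr 1
    funext s
    simp only [w0]
    ring
  obtain ⟨m, hm⟩ := hψ.isRepChar.exists_avg_mul isIrr_one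
  obtain ⟨k, hk⟩ := hψ.isRepChar.exists_avg_mul (isIrr_sg (n := n))
  rw [e, hm, hk]
  have hm0 : (0 : ℝ) ≤ m := m.cast_nonneg
  have hk0 : (0 : ℝ) ≤ k := k.cast_nonneg
  by_cases h : IsLin ψ
  · rw [ind_of h]
    rcases h with h | h
    · have : (m : ℝ) = 1 := by
        rw [← hm, h]
        exact isIrr_one.avg_sq
      linarith
    · have : (k : ℝ) = 1 := by
        rw [← hk, h]
        exact isIrr_sg.avg_sq
      linarith
  · rw [ind_of_not h]
    linarith

theorem abs_w0_le (s : Equiv.Perm (Fin n)) : |w0 s| ≤ 2 := by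
  unfold w0
  rcases sg_eq s with h | h <;> rw [h] <;> norm_num

theorem w0_nonneg (s : Equiv.Perm (Fin n)) : 0 ≤ w0 s := by
  unfold w0
  rcases sg_eq s with h | h <;> rw [h] <;> norm_num

/-- The bound for the share of the linear characters of `S_a` in a character of `S_{a+b}`. -/
noncomputable def linShare (a b : ℕ) : ℝ :=
  (b : ℝ) ^ 2 / ((a + b) * (a + b - 3)) * (1 - cf a / cf (a + b))

theorem IsHigh.mass_lin_of_cycleType (ha : 10 ≤ a) (hn : n = a + b)
    {χ : Equiv.Perm (Fin n) → ℝ} (h : IsHigh χ) (f : Equiv.Perm (Fin a) → Equiv.Perm (Fin n))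
    (hf : ∀ s, (f s).cycleType = s.cycleType) :
    avg (fun s => χ (f s) * w0 s) ≤ linShare a b * χ 1 := by
  subst hn
  refine le_trans (le_of_eq ?_) (h.mass_lin ha b)
  congr 1
  funext s
  rw [h.1.isRepChar.isClass.eq_of_cycleType ((hf s).trans (cycleType_emb b s).symm)]

theorem IsHigh.mass_std_of_cycleType (ha : 10 ≤ a) (hn : n = a + b)
    {χ : Equiv.Perm (Fin n) → ℝ} (h : IsHigh χ) (f : Equiv.Perm (Fin a) → Equiv.Perm (Fin n))
    (hf : ∀ s, (f s).cycleType = s.cycleType) :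
    avg (fun s => χ (f s) * ((a - 1) * w1 s)) ≤ (1 - cf a / cf (a + b)) * χ 1 := by
  subst hn
  refine le_trans (le_of_eq ?_) (h.mass_std ha b)
  congr 1
  funext s
  rw [h.1.isRepChar.isClass.eq_of_cycleType ((hf s).trans (cycleType_emb b s).symm)]

theorem cycleType_young_left (s : Equiv.Perm (Fin a)) :
    (young a b (s, 1)).cycleType = s.cycleType := by
  rw [cycleType_young, Equiv.Perm.cycleType_one, add_zero]

theorem cycleType_young_right (t : Equiv.Perm (Fin b)) :
    (young a b (1, t)).cycleType = t.cycleType := by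
  rw [cycleType_young, Equiv.Perm.cycleType_one, zero_add]

theorem IsHigh.split (ha : 10 ≤ a) {χ : Equiv.Perm (Fin (a + b)) → ℝ} (h : IsHigh χ) :
    ∃ (k : ℕ) (X : Fin k → ℝ) (ψ : Fin k → Equiv.Perm (Fin a) → ℝ)
      (φ : Fin k → Equiv.Perm (Fin b) → ℝ),
      (∀ i, 0 ≤ X i ∧ IsIrr (ψ i) ∧ IsIrr (φ i)) ∧
      (∀ s t, χ (young a b (s, t)) = ∑ i, X i * ((ψ i s / ψ i 1) * (φ i t / φ i 1))) ∧
      ∑ i, X i = χ 1 ∧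
      ∑ i, X i * ind (IsLin (ψ i)) ≤ linShare a b * χ 1 ∧
      ∑ i, X i * ind (IsT1 (ψ i)) ≤ (1 - cf a / cf (a + b)) * χ 1 ∧
      (10 ≤ b → ∑ i, X i * ind (IsLin (φ i)) ≤ linShare b a * χ 1) ∧
      ∑ i, X i * (ind (IsLin (ψ i)) * ind (IsLin (φ i))) ≤ 4 * √(((a : ℝ) + b + 1) ^ 3) := by
  obtain ⟨k, Y, hY, hsum⟩ := (h.1.isRepChar.comp (young a b)).decomp
  choose ψ φ hψ hφ hmul using fun i => (hY i).exists_prod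
  have hX0 (i) : 0 ≤ Y i 1 := (hY i).pos.le
  have hψ0 (i) := (hψ i).pos
  have hφ0 (i) := (hφ i).pos
  have hval (s t) : χ (young a b (s, t)) = ∑ i, Y i 1 * ((ψ i s / ψ i 1) * (φ i t / φ i 1)) := by
    rw [hsum]
    refine Finset.sum_congr rfl fun i _ => ?_
    have := hmul i s t
    have h1 := (hψ0 i).ne'
    have h2 := (hφ0 i).ne'
    field_simp
    linarith
  have hone : ∑ i, Y i 1 = χ 1 := by
    have := hval 1 1
    rw [show ((1, 1) : Equiv.Perm (Fin a) × Equiv.Perm (Fin b)) = 1 from rfl, map_one] at this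
    rw [this]
    refine Finset.sum_congr rfl fun i _ => ?_
    rw [div_self (hψ0 i).ne', div_self (hφ0 i).ne', one_mul, mul_one]
  have hL (w : Equiv.Perm (Fin a) → ℝ) : avg (fun s => χ (young a b (s, 1)) * w s)
      = ∑ i, Y i 1 * (avg (fun s => ψ i s * w s) / ψ i 1) := by
    simp_rw [hval, Finset.sum_mul]
    rw [avg_sum]
    refine Finset.sum_congr rfl fun i _ => ?_
    have : (fun s => Y i 1 * (ψ i s / ψ i 1 * (φ i 1 / φ i 1)) * w s)
        = fun s => (Y i 1 / ψ i 1) * (ψ i s * w s) := by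
      funext s
      rw [div_self (hφ0 i).ne']
      ring
    rw [this, avg_mul_left]
    ring
  have hR (w : Equiv.Perm (Fin b) → ℝ) : avg (fun t => χ (young a b (1, t)) * w t)
      = ∑ i, Y i 1 * (avg (fun s => φ i s * w s) / φ i 1) := by
    simp_rw [hval, Finset.sum_mul]
    rw [avg_sum]
    refine Finset.sum_congr rfl fun i _ => ?_
    have : (fun t => Y i 1 * (ψ i 1 / ψ i 1 * (φ i t / φ i 1)) * w t)
        = fun t => (Y i 1 / φ i 1) * (φ i t * w t) := by
      funext t
      rw [div_self (hψ0 i).ne']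
      ring
    rw [this, avg_mul_left]
    ring
  have hle {m : ℕ} {f : Equiv.Perm (Fin m) → ℝ} (hf : IsIrr f) :
      ind (IsLin f) ≤ avg (fun s => f s * w0 s) / f 1 := by
    rw [le_div_iff₀ hf.pos]
    refine le_trans (le_of_eq ?_) (ind_le_avg_mul_w0 hf)
    by_cases hl : IsLin f
    · rw [hl.one, mul_one]
    · rw [ind_of_not hl, zero_mul]
  refine ⟨k, fun i => Y i 1, ψ, φ, fun i => ⟨hX0 i, hψ i, hφ i⟩, hval, hone, ?_, ?_, ?_, ?_⟩
  · refine le_trans ?_ (h.mass_lin_of_cycleType ha rfl (fun s => young a b (s, 1))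
      cycleType_young_left)
    rw [hL]
    exact Finset.sum_le_sum fun i _ => mul_le_mul_of_nonneg_left (hle (hψ i)) (hX0 i)
  · refine le_trans (le_of_eq ?_) (h.mass_std_of_cycleType ha rfl (fun s => young a b (s, 1))
      cycleType_young_left)
    rw [hL]
    refine Finset.sum_congr rfl fun i _ => ?_
    congr 1
    have e : avg (fun s => ψ i s * (((a : ℝ) - 1) * w1 s))
        = ((a : ℝ) - 1) * avg (fun s => ψ i s * w1 s) := by
      rw [← avg_mul_left]
      congr 1
      funext s
      ring
    have e2 : avg (fun s => ψ i s * w1 s) = ind (IsT1 (ψ i)) := by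
      classical
      obtain ⟨m, rfl⟩ := Nat.exists_eq_add_of_le' (show 4 ≤ a by omega)
      unfold ind
      rw [avg_mul_w1 (hψ i)]
    rw [e, e2, eq_div_iff (hψ0 i).ne']
    by_cases hl : IsT1 (ψ i)
    · rw [hl.one]
      ring
    · rw [ind_of_not hl, zero_mul, mul_zero]
  · intro hb
    refine le_trans ?_ (h.mass_lin_of_cycleType hb (add_comm a b) (fun t => young a b (1, t))
      cycleType_young_right)
    rw [hR]
    exact Finset.sum_le_sum fun i _ => mul_le_mul_of_nonneg_left (hle (hφ i)) (hX0 i)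
  · have e : avg (fun p : Equiv.Perm (Fin a) × Equiv.Perm (Fin b) =>
        χ (young a b p) * (w0 p.1 * w0 p.2))
        = ∑ i, Y i 1 * ((avg (fun s => ψ i s * w0 s) / ψ i 1)
          * (avg (fun s => φ i s * w0 s) / φ i 1)) := by
      have : (fun p : Equiv.Perm (Fin a) × Equiv.Perm (Fin b) =>
          χ (young a b p) * (w0 p.1 * w0 p.2))
          = fun p => ∑ i, (Y i 1 / (ψ i 1 * φ i 1)) * ((ψ i p.1 * w0 p.1) * (φ i p.2 * w0 p.2)) := by
        funext ⟨s, t⟩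
        rw [hval, Finset.sum_mul]
        refine Finset.sum_congr rfl fun i _ => ?_
        ring
      rw [this, avg_sum]
      refine Finset.sum_congr rfl fun i _ => ?_
      rw [avg_mul_left, avg_prod_mul (fun s => ψ i s * w0 s) (fun t => φ i t * w0 t)]
      ring
    calc _ ≤ ∑ i, Y i 1 * ((avg (fun s => ψ i s * w0 s) / ψ i 1)
          * (avg (fun s => φ i s * w0 s) / φ i 1)) :=
        Finset.sum_le_sum fun i _ => mul_le_mul_of_nonneg_left
          (mul_le_mul (hle (hψ i)) (hle (hφ i)) (ind_nonneg _) ((ind_nonneg _).trans (hle (hψ i))))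
          (hX0 i)
      _ ≤ 4 * avg (fun p => |χ (young a b p)|) := by
        rw [← e, ← avg_mul_left]
        refine avg_le_avg fun p => ?_
        have h1 : w0 p.1 * w0 p.2 ≤ 4 := by
          have := mul_le_mul ((le_abs_self _).trans (abs_w0_le p.1))
            ((le_abs_self _).trans (abs_w0_le p.2)) (w0_nonneg _) (by norm_num)
          linarith
        have h2 := mul_nonneg (w0_nonneg p.1) (w0_nonneg p.2)
        calc _ ≤ |χ (young a b p)| * (w0 p.1 * w0 p.2) :=
              mul_le_mul_of_nonneg_right (le_abs_self _) h2
          _ ≤ |χ (young a b p)| * 4 := mul_le_mul_of_nonneg_left h1 (abs_nonneg _)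
          _ = _ := mul_comm _ _
      _ ≤ _ := mul_le_mul_of_nonneg_left h.1.avg_abs_young_le (by norm_num)

end Split

section Bounds

variable {n a b : ℕ}

/-- `ε` bounds the normalized nonlinear characters at permutations with at most two fixed
points. -/
def Bd (n : ℕ) (ε : ℝ) : Prop :=
  ∀ σ : Equiv.Perm (Fin n), c1 σ ≤ 2 → ∀ χ, IsIrr χ → ¬IsLin χ → |χ σ| ≤ ε * χ 1

theorem Bd.mono {ε δ : ℝ} (h : Bd n ε) (hε : ε ≤ δ) : Bd n δ := fun σ hσ χ hχ hl =>
  (h σ hσ χ hχ hl).trans (mul_le_mul_of_nonneg_right hε hχ.pos.le)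

theorem bd_one (n : ℕ) : Bd n 1 := fun σ _ χ hχ _ => by
  rw [one_mul]
  exact hχ.abs_le σ

theorem c1_eq (σ : Equiv.Perm (Fin n)) : c1 σ = n - σ.cycleType.sum := by
  rw [Equiv.Perm.sum_cycleType, c1, Finset.sum_boole]
  have h : σ.support.card + (Finset.univ.filter fun x => σ x = x).card = n := by
    have := Finset.card_filter_add_card_filter_not (s := Finset.univ) (fun x => σ x = x)
    rw [Finset.card_univ, Fintype.card_fin] at this
    have e : σ.support = Finset.univ.filter fun x => ¬σ x = x := by
      ext x
      simp
    rw [e]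
    omega
  rw [eq_sub_iff_add_eq, add_comm]
  exact_mod_cast h

theorem IsT1.abs_le {χ : Equiv.Perm (Fin n) → ℝ} (h : IsT1 χ) {σ : Equiv.Perm (Fin n)}
    (hσ : c1 σ ≤ 2) : |χ σ| ≤ 1 := by
  have h1 : |std σ| ≤ 1 := by
    have := c1_nonneg σ
    rw [_root_.abs_le, std]
    constructor <;> linarith
  rcases h with rfl | rfl
  · exact h1
  · rwa [abs_tw]

theorem IsT2.abs_le (hn : 4 ≤ n) {χ : Equiv.Perm (Fin n) → ℝ} (h : IsT2 χ)
    {σ : Equiv.Perm (Fin n)} (hσ : c1 σ ≤ 2) : |χ σ| ≤ n / 2 := by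
  have h0 := c1_nonneg σ
  have hd := d2_nonneg σ
  have hcd := c1_add_d2_le σ
  have hn' : (4 : ℝ) ≤ n := by exact_mod_cast hn
  have h1 : |psiS σ| ≤ n / 2 := by
    rw [_root_.abs_le, psiS]
    constructor <;> nlinarith [mul_nonneg h0 (sub_nonneg.2 hσ), sq_nonneg (2 * c1 σ - 3)]
  have h2 : |psiE σ| ≤ n / 2 := by
    rw [_root_.abs_le, psiE]
    constructor <;> nlinarith [mul_nonneg h0 (sub_nonneg.2 hσ), sq_nonneg (2 * c1 σ - 3)]
  rcases h with (rfl | rfl) | (rfl | rfl)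
  · exact h1
  · exact h2
  · rwa [abs_tw]
  · rwa [abs_tw]

theorem IsHigh.abs_young_le_of_bounds (ha : 10 ≤ a) (hb : 10 ≤ b)
    {χ : Equiv.Perm (Fin (a + b)) → ℝ} (h : IsHigh χ) {s : Equiv.Perm (Fin a)}
    {t : Equiv.Perm (Fin b)} {α β : ℝ} (hα : 0 ≤ α) (hα1 : α ≤ 1) (hβ : 0 ≤ β) (hβ1 : β ≤ 1)
    (hs : ∀ ψ, IsIrr ψ → ¬IsLin ψ → |ψ s| ≤ α * ψ 1)
    (ht : ∀ φ, IsIrr φ → ¬IsLin φ → |φ t| ≤ β * φ 1) :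
    |χ (young a b (s, t))| ≤ (α * β + (1 - α) * β * linShare a b + α * (1 - β) * linShare b a) * χ 1
      + (1 - α) * (1 - β) * (4 * √(((a : ℝ) + b + 1) ^ 3)) := by
  obtain ⟨k, X, ψ, φ, hX, hval, hone, hA, -, hB, hAB⟩ := h.split ha
  have hB := hB hb
  have hbound {m : ℕ} {g : Equiv.Perm (Fin m)} {γ : ℝ} (hγ : γ ≤ 1)
      (hg : ∀ ψ, IsIrr ψ → ¬IsLin ψ → |ψ g| ≤ γ * ψ 1) {ψ} (hψ : IsIrr ψ) :
      |ψ g / ψ 1| ≤ γ + (1 - γ) * ind (IsLin ψ) := by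
    rw [abs_div, abs_of_pos hψ.pos, div_le_iff₀ hψ.pos]
    by_cases hl : IsLin ψ
    · rw [ind_of hl]
      linarith [hψ.abs_le g]
    · rw [ind_of_not hl]
      linarith [hg ψ hψ hl]
  rw [hval]
  calc |∑ i, X i * (ψ i s / ψ i 1 * (φ i t / φ i 1))|
      ≤ ∑ i, X i * ((α + (1 - α) * ind (IsLin (ψ i))) * (β + (1 - β) * ind (IsLin (φ i)))) := by
        refine (Finset.abs_sum_le_sum_abs _ _).trans (Finset.sum_le_sum fun i _ => ?_)
        rw [abs_mul, abs_mul, abs_of_nonneg (hX i).1]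
        exact mul_le_mul_of_nonneg_left (mul_le_mul (hbound hα1 hs (hX i).2.1)
          (hbound hβ1 ht (hX i).2.2) (abs_nonneg _)
          ((abs_nonneg _).trans (hbound hα1 hs (hX i).2.1))) (hX i).1
    _ = α * β * ∑ i, X i + (1 - α) * β * ∑ i, X i * ind (IsLin (ψ i))
        + α * (1 - β) * ∑ i, X i * ind (IsLin (φ i))
        + (1 - α) * (1 - β) * ∑ i, X i * (ind (IsLin (ψ i)) * ind (IsLin (φ i))) := by
        simp_rw [Finset.mul_sum, ← Finset.sum_add_distrib]
        exact Finset.sum_congr rfl fun i _ => by ring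
    _ ≤ _ := by
        have e1 : 0 ≤ 1 - α := sub_nonneg.2 hα1
        have e2 : 0 ≤ 1 - β := sub_nonneg.2 hβ1
        have h1 := mul_le_mul_of_nonneg_left hA (mul_nonneg e1 hβ)
        have h2 := mul_le_mul_of_nonneg_left hB (mul_nonneg hα e2)
        have h3 := mul_le_mul_of_nonneg_left hAB (mul_nonneg e1 e2)
        rw [hone]
        linarith

theorem d2_eq_zero_of_cycle (ha : 3 ≤ a) {s : Equiv.Perm (Fin a)} (hs : s.cycleType = {a}) :
    d2 s = 0 := by
  have hc : s.IsCycle := by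
    rw [← Equiv.Perm.card_cycleType_eq_one, hs, Multiset.card_singleton]
  unfold d2
  refine Finset.sum_eq_zero fun x _ => if_neg ?_
  rintro ⟨h1, h2⟩
  have h3 : s ^ 2 = 1 := hc.pow_eq_one_iff.2 ⟨x, h2, by rw [sq, Equiv.Perm.mul_apply, h1]⟩
  have h4 := orderOf_dvd_of_pow_eq_one h3
  rw [← Equiv.Perm.lcm_cycleType, hs, Multiset.lcm_singleton, normalize_eq] at h4
  have := Nat.le_of_dvd (by norm_num) h4
  omega

theorem c1_eq_zero_of_cycle {s : Equiv.Perm (Fin a)} (hs : s.cycleType = {a}) : c1 s = 0 := by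
  rw [c1_eq, hs, Multiset.sum_singleton, sub_self]

theorem IsIrr.abs_cycle_le (ha : 2 ≤ a) {ψ : Equiv.Perm (Fin a) → ℝ} (hψ : IsIrr ψ)
    {s : Equiv.Perm (Fin a)} (hs : s.cycleType = {a}) : |ψ s| ≤ a := by
  have h := hψ.sq_mul_card_le s (Finset.univ.filter fun g => g.cycleType = {a}) fun g hg => by
    rw [Equiv.Perm.isConj_iff_cycleType_eq, hs, (Finset.mem_filter.1 hg).2]
  rw [Equiv.Perm.card_of_cycleType_singleton ha (by simp), Fintype.card_fin, Nat.choose_self,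
    mul_one, card_perm_fin, ← Nat.mul_factorial_pred (by omega : a ≠ 0), Nat.cast_mul] at h
  have h2 : ψ s ^ 2 ≤ a := le_of_mul_le_mul_right h (by positivity)
  have ha' : (2 : ℝ) ≤ a := by exact_mod_cast ha
  exact abs_le_of_sq_le_sq (by nlinarith) (by linarith)

theorem IsIrr.cycle_le (ha : 10 ≤ a) {ψ : Equiv.Perm (Fin a) → ℝ} (hψ : IsIrr ψ)
    {s : Equiv.Perm (Fin a)} (hs : s.cycleType = {a}) :
    |ψ s / ψ 1| ≤ 1000 / (a : ℝ) ^ 2 + 1 / (a - 1) * ind (IsT1 ψ) + ind (IsLin ψ) := by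
  have ha' : (10 : ℝ) ≤ a := by exact_mod_cast ha
  have h0 : 0 ≤ 1000 / (a : ℝ) ^ 2 := by positivity
  have h1 : 0 ≤ 1 / ((a : ℝ) - 1) := div_nonneg zero_le_one (by linarith)
  have hp := hψ.pos
  have hc := c1_eq_zero_of_cycle hs
  have hd := d2_eq_zero_of_cycle (by omega) hs
  rw [abs_div, abs_of_pos hp]
  by_cases hl : IsLin ψ
  · rw [ind_of hl]
    have : |ψ s| / ψ 1 ≤ 1 := by
      rw [div_le_one hp]
      exact hψ.abs_le s
    have := mul_nonneg h1 (ind_nonneg (IsT1 ψ))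
    linarith
  rw [ind_of_not hl, add_zero]
  by_cases h1 : IsT1 ψ
  · rw [ind_of h1, h1.one, mul_one]
    have : |ψ s| / ((a : ℝ) - 1) ≤ 1 / (a - 1) :=
      div_le_div_of_nonneg_right (h1.abs_le (by rw [hc]; norm_num)) (by linarith)
    linarith
  rw [ind_of_not h1, mul_zero, add_zero, div_le_div_iff₀ hp (by positivity)]
  by_cases h2 : IsT2 ψ
  · have e : |ψ s| ≤ 1 := by
      have hS : psiS s = 0 := by rw [psiS, hc, hd]; norm_num
      have hE : psiE s = 1 := by rw [psiE, hc, hd]; norm_num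
      rcases h2 with (rfl | rfl) | (rfl | rfl)
      · rw [hS]; norm_num
      · rw [hE]; norm_num
      · rw [abs_tw, hS]; norm_num
      · rw [abs_tw, hE]; norm_num
    have := h2.le_one (by omega)
    nlinarith [mul_le_mul_of_nonneg_right e (sq_nonneg (a : ℝ))]
  · have e := hψ.abs_cycle_le (by omega) hs
    have := IsHigh.cube_le a ⟨hψ, hl, h1, h2⟩
    nlinarith [mul_le_mul_of_nonneg_right e (sq_nonneg (a : ℝ))]

theorem IsHigh.abs_young_cycle_le (ha : 10 ≤ a) {χ : Equiv.Perm (Fin (a + b)) → ℝ} (h : IsHigh χ)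
    {s : Equiv.Perm (Fin a)} (hs : s.cycleType = {a})
    {t : Equiv.Perm (Fin b)} {β : ℝ} (hβ : 0 ≤ β)
    (ht : ∀ φ, IsIrr φ → ¬IsLin φ → |φ t| ≤ β * φ 1) :
    |χ (young a b (s, t))| ≤ (1000 / (a : ℝ) ^ 2 + (1 - cf a / cf (a + b)) / (a - 1)
      + β * linShare a b) * χ 1 + 4 * √(((a : ℝ) + b + 1) ^ 3) := by
  obtain ⟨k, X, ψ, φ, hX, hval, hone, hA, hT, -, hAB⟩ := h.split ha
  have ha' : (10 : ℝ) ≤ a := by exact_mod_cast ha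
  have h1 : 0 ≤ 1 / ((a : ℝ) - 1) := div_nonneg zero_le_one (by linarith)
  have hone' (i) : |φ i t / φ i 1| ≤ 1 := by
    have hp := (hX i).2.2.pos
    rw [abs_div, abs_of_pos hp, div_le_one hp]
    exact (hX i).2.2.abs_le t
  have hφ (i) : |φ i t / φ i 1| ≤ β + ind (IsLin (φ i)) := by
    by_cases hl : IsLin (φ i)
    · rw [ind_of hl]
      linarith [hone' i]
    · have hp := (hX i).2.2.pos
      rw [ind_of_not hl, abs_div, abs_of_pos hp, div_le_iff₀ hp]
      linarith [ht _ (hX i).2.2 hl]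
  rw [hval]
  calc |∑ i, X i * (ψ i s / ψ i 1 * (φ i t / φ i 1))|
      ≤ ∑ i, X i * (1000 / (a : ℝ) ^ 2 + 1 / (a - 1) * ind (IsT1 (ψ i))
        + ind (IsLin (ψ i)) * (β + ind (IsLin (φ i)))) := by
        refine (Finset.abs_sum_le_sum_abs _ _).trans (Finset.sum_le_sum fun i _ => ?_)
        rw [abs_mul, abs_mul, abs_of_nonneg (hX i).1]
        refine mul_le_mul_of_nonneg_left ?_ (hX i).1
        have e1 := mul_le_mul_of_nonneg_right ((hX i).2.1.cycle_le ha hs) (abs_nonneg (φ i t / φ i 1))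
        have e2 := mul_le_mul_of_nonneg_left (hφ i) (ind_nonneg (IsLin (ψ i)))
        have e3 : 0 ≤ 1000 / (a : ℝ) ^ 2 + 1 / (a - 1) * ind (IsT1 (ψ i)) :=
          add_nonneg (by positivity) (mul_nonneg h1 (ind_nonneg _))
        have e4 := mul_le_mul_of_nonneg_left (hone' i) e3
        linarith
    _ = 1000 / (a : ℝ) ^ 2 * ∑ i, X i + 1 / (a - 1) * ∑ i, X i * ind (IsT1 (ψ i))
        + β * ∑ i, X i * ind (IsLin (ψ i))
        + ∑ i, X i * (ind (IsLin (ψ i)) * ind (IsLin (φ i))) := by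
        simp_rw [Finset.mul_sum, ← Finset.sum_add_distrib]
        exact Finset.sum_congr rfl fun i _ => by ring
    _ ≤ _ := by
        have h2 := mul_le_mul_of_nonneg_left hA hβ
        have h3 := mul_le_mul_of_nonneg_left hT h1
        rw [hone]
        have e : (1 - cf a / cf (a + b)) / ((a : ℝ) - 1) * χ 1
            = 1 / ((a : ℝ) - 1) * ((1 - cf a / cf (a + b)) * χ 1) := by ring
        rw [add_mul, add_mul, e]
        linarith

end Bounds

section Step

variable {n a b : ℕ}

/-- The error term coming from the trivial and sign characters of a Young subgroup. -/
noncomputable def err (n : ℕ) : ℝ := 12000 / (n * √n)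

theorem IsHigh.sqrt_le (hn : 1 ≤ n) {χ : Equiv.Perm (Fin n) → ℝ} (h : IsHigh χ) :
    4 * √(((n : ℝ) + 1) ^ 3) ≤ err n * χ 1 := by
  have hn' : (1 : ℝ) ≤ n := by exact_mod_cast hn
  have hc := h.cube_le n
  have h1 : √(((n : ℝ) + 1) ^ 3) ≤ 3 * (n * √n) := by
    have e : 3 * ((n : ℝ) * √n) = √(9 * n ^ 3) := by
      rw [show (9 : ℝ) * (n : ℝ) ^ 3 = (3 * n) ^ 2 * n by ring, Real.sqrt_mul (by positivity),
        Real.sqrt_sq (by positivity)]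
      ring
    rw [e]
    refine Real.sqrt_le_sqrt ?_
    have : ((n : ℝ) + 1) ^ 3 ≤ (2 * n) ^ 3 := pow_le_pow_left₀ (by positivity) (by linarith) 3
    nlinarith [pow_pos (show (0 : ℝ) < n by linarith) 3]
  have hs : 0 < √(n : ℝ) := Real.sqrt_pos.2 (by linarith)
  have hss : √(n : ℝ) * √n = n := Real.mul_self_sqrt (by linarith)
  have he : err n * ((n : ℝ) ^ 3 / 1000) = 12 * (n * √n) := by
    unfold err
    field_simp
    rw [sq, hss]
    ring
  have : err n * ((n : ℝ) ^ 3 / 1000) ≤ err n * χ 1 :=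
    mul_le_mul_of_nonneg_left hc (by unfold err; positivity)
  linarith

theorem exists_submultiset_sum (M : Multiset ℕ) (h : n ≤ 100 * M.sum)
    (hM : ∀ x ∈ M, 100 * x < n) : ∃ m ≤ M, n ≤ 100 * m.sum ∧ 100 * m.sum ≤ 2 * n := by
  induction M using Multiset.induction with
  | empty => exact ⟨0, le_rfl, h, by simp⟩
  | cons x M ih =>
    by_cases h' : n ≤ 100 * M.sum
    · obtain ⟨m, hm, h1⟩ := ih h' fun y hy => hM y (Multiset.mem_cons_of_mem hy)
      exact ⟨m, hm.trans (Multiset.le_cons_self _ _), h1⟩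
    · refine ⟨x ::ₘ M, le_rfl, h, ?_⟩
      have := hM x (Multiset.mem_cons_self _ _)
      rw [Multiset.sum_cons]
      omega

theorem exists_split_of_le (σ : Equiv.Perm (Fin n)) {m : Multiset ℕ} (hm : m ≤ σ.cycleType) :
    ∃ (b : ℕ) (s : Equiv.Perm (Fin m.sum)) (t : Equiv.Perm (Fin b)),
      n = m.sum + b ∧ s.cycleType = m ∧ σ.cycleType = s.cycleType + t.cycleType ∧
        c1 s = 0 ∧ c1 t = c1 σ := by
  have hσ := (Equiv.Perm.exists_with_cycleType_iff _).1 ⟨σ, rfl⟩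
  rw [Fintype.card_fin] at hσ
  obtain ⟨hsum, htwo⟩ := hσ
  obtain ⟨m', hm'⟩ := Multiset.le_iff_exists_add.1 hm
  rw [hm', Multiset.sum_add] at hsum
  rw [hm'] at htwo
  obtain ⟨s, hs⟩ := (Equiv.Perm.exists_with_cycleType_iff (Fin m.sum) (m := m)).2
    ⟨by simp, fun x hx => htwo x (Multiset.mem_add.2 (Or.inl hx))⟩
  obtain ⟨t, ht⟩ := (Equiv.Perm.exists_with_cycleType_iff (Fin (n - m.sum)) (m := m')).2
    ⟨by rw [Fintype.card_fin]; omega, fun x hx => htwo x (Multiset.mem_add.2 (Or.inr hx))⟩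
  refine ⟨n - m.sum, s, t, by omega, hs, by rw [hm', hs, ht], ?_, ?_⟩
  · rw [c1_eq, hs, sub_self]
  · rw [c1_eq, c1_eq, ht, hm', Multiset.sum_add, Nat.cast_sub (by omega)]
    push_cast
    ring

theorem exists_split (hn : 200 ≤ n) {σ : Equiv.Perm (Fin n)} (hσ : c1 σ ≤ 2) :
    ∃ (a b : ℕ) (s : Equiv.Perm (Fin a)) (t : Equiv.Perm (Fin b)), n = a + b ∧
      σ.cycleType = s.cycleType + t.cycleType ∧ c1 s ≤ 2 ∧ c1 t ≤ 2 ∧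
      ((n ≤ 100 * a ∧ 100 * a ≤ 95 * n) ∨ (95 * n < 100 * a ∧ s.cycleType = {a})) := by
  have hsum : n ≤ 100 * σ.cycleType.sum := by
    rw [c1_eq] at hσ
    have : (n : ℝ) ≤ (σ.cycleType.sum : ℝ) + 2 := by linarith
    have : n ≤ σ.cycleType.sum + 2 := by exact_mod_cast this
    omega
  obtain ⟨m, hm, h⟩ : ∃ m ≤ σ.cycleType, (n ≤ 100 * m.sum ∧ 100 * m.sum ≤ 95 * n) ∨
      (95 * n < 100 * m.sum ∧ m = {m.sum}) := by
    by_cases hx : ∃ x ∈ σ.cycleType, n ≤ 100 * x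
    · obtain ⟨x, hx, hnx⟩ := hx
      refine ⟨{x}, Multiset.singleton_le.2 hx, ?_⟩
      rw [Multiset.sum_singleton]
      by_cases h : 100 * x ≤ 95 * n
      · exact Or.inl ⟨hnx, h⟩
      · exact Or.inr ⟨by omega, rfl⟩
    · push Not at hx
      obtain ⟨m, hm, h1, h2⟩ := exists_submultiset_sum _ hsum hx
      exact ⟨m, hm, Or.inl ⟨h1, by omega⟩⟩
  obtain ⟨b, s, t, h1, h2, h3, h4, h5⟩ := exists_split_of_le σ hm
  refine ⟨m.sum, b, s, t, h1, h3, by rw [h4]; norm_num, by rw [h5]; exact hσ, ?_⟩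
  rcases h with h | h
  · exact Or.inl h
  · exact Or.inr ⟨h.1, h2.trans h.2⟩

theorem IsHigh.abs_le_of_bd (hn : 1000 ≤ n) {χ : Equiv.Perm (Fin n) → ℝ} (h : IsHigh χ)
    {σ : Equiv.Perm (Fin n)} (hσ : c1 σ ≤ 2) :
    (∃ a b : ℕ, a + b = n ∧ n ≤ 100 * a ∧ 100 * a ≤ 95 * n ∧ ∀ α β : ℝ, 0 ≤ α → α ≤ 1 → 0 ≤ β →
      β ≤ 1 → Bd a α → Bd b β → |χ σ| ≤
        (α * β + (1 - α) * β * linShare a b + α * (1 - β) * linShare b a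
          + (1 - α) * (1 - β) * err n) * χ 1) ∨
    (∃ a b : ℕ, a + b = n ∧ 95 * n < 100 * a ∧ ∀ β : ℝ, 0 ≤ β → Bd b β → |χ σ| ≤
        (1000 / (a : ℝ) ^ 2 + (1 - cf a / cf n) / (a - 1) + β * linShare a b + err n) * χ 1) := by
  obtain ⟨a, b, s, t, hab, hct, hs, ht, hcase⟩ := exists_split (by omega) hσ
  subst hab
  have e := h.1.isRepChar.isClass.eq_of_cycleType (hct.trans (cycleType_young s t).symm)
  have hq := h.sqrt_le (by omega)
  rw [e]
  push_cast at hq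
  rcases hcase with ⟨h1, h2⟩ | ⟨h1, h2⟩
  · refine Or.inl ⟨a, b, rfl, h1, h2, fun α β hα hα1 hβ hβ1 hA hB => ?_⟩
    have := h.abs_young_le_of_bounds (by omega) (by omega) hα hα1 hβ hβ1 (fun ψ => hA s hs ψ)
      (fun φ => hB t ht φ)
    have h3 := mul_le_mul_of_nonneg_left hq (mul_nonneg (sub_nonneg.2 hα1) (sub_nonneg.2 hβ1))
    rw [add_mul _ (_ * err _)]
    linarith
  · refine Or.inr ⟨a, b, rfl, h1, fun β hβ hB => ?_⟩
    have := h.abs_young_cycle_le (by omega) h2 hβ (fun φ => hB t ht φ)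
    rw [add_mul _ (err _)]
    push_cast
    linarith

end Step

section Estimates

variable {n a b : ℕ}

theorem cf_ratio_ge {x y θ : ℝ} (hx : 9 < x) (hy : 9 < y) (hθ : 0 ≤ θ) (hθ1 : θ ≤ 1)
    (h : θ * (y - 9) ≤ x - 9) : θ ^ 6 ≤ cf x / cf y := by
  rw [le_div_iff₀ (cf_pos hy)]
  have hk (k : ℝ) (hk : k ≤ 9) : 0 ≤ θ * (y - k) ∧ θ * (y - k) ≤ x - k :=
    ⟨mul_nonneg hθ (by linarith), by nlinarith⟩
  have e : θ ^ 6 * cf y = θ * (y - 4) * (θ * (y - 5)) * (θ * (y - 6)) * (θ * (y - 7))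
      * (θ * (y - 8)) * (θ * (y - 9)) := by
    unfold cf
    ring
  rw [e, cf]
  obtain ⟨p4, q4⟩ := hk 4 (by norm_num)
  obtain ⟨p5, q5⟩ := hk 5 (by norm_num)
  obtain ⟨p6, q6⟩ := hk 6 (by norm_num)
  obtain ⟨p7, q7⟩ := hk 7 (by norm_num)
  obtain ⟨p8, q8⟩ := hk 8 (by norm_num)
  obtain ⟨p9, q9⟩ := hk 9 (by norm_num)
  have r4 := p4.trans q4
  have r5 := p5.trans q5
  have r6 := p6.trans q6
  have r7 := p7.trans q7
  have r8 := p8.trans q8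
  exact mul_le_mul (mul_le_mul (mul_le_mul (mul_le_mul (mul_le_mul q4 q5 p5 r4) q6 p6
    (mul_nonneg r4 r5)) q7 p7 (mul_nonneg (mul_nonneg r4 r5) r6)) q8 p8
    (mul_nonneg (mul_nonneg (mul_nonneg r4 r5) r6) r7)) q9 p9
    (mul_nonneg (mul_nonneg (mul_nonneg (mul_nonneg r4 r5) r6) r7) r8)

theorem cf_le_cf {x y : ℝ} (hx : 9 < x) (h : x ≤ y) : cf x ≤ cf y := by
  unfold cf
  have h4 : 0 ≤ x - 4 := by linarith
  have h5 : 0 ≤ x - 5 := by linarith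
  have h6 : 0 ≤ x - 6 := by linarith
  have h7 : 0 ≤ x - 7 := by linarith
  have h8 : 0 ≤ x - 8 := by linarith
  have h9 : 0 ≤ x - 9 := by linarith
  have k4 : 0 ≤ y - 4 := by linarith
  have k5 : 0 ≤ y - 5 := by linarith
  have k6 : 0 ≤ y - 6 := by linarith
  have k7 : 0 ≤ y - 7 := by linarith
  have k8 : 0 ≤ y - 8 := by linarith
  have k9 : 0 ≤ y - 9 := by linarith
  gcongr

theorem linShare_nonneg (ha : 10 ≤ a) : 0 ≤ linShare a b := by
  have ha' : (10 : ℝ) ≤ a := by exact_mod_cast ha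
  have hb : (0 : ℝ) ≤ b := b.cast_nonneg
  refine mul_nonneg (div_nonneg (sq_nonneg _) (mul_nonneg (by linarith) (by linarith))) ?_
  rw [sub_nonneg, div_le_one (cf_pos (by linarith))]
  exact cf_le_cf (by linarith) (by linarith)

theorem linShare_le (ha : 10 ≤ a) {θ : ℝ} (hθ : 0 ≤ θ) (hθ1 : θ ≤ 1)
    (h : θ * ((a : ℝ) + b - 9) ≤ a - 9) :
    linShare a b ≤ (b : ℝ) ^ 2 / ((a + b) * (a + b - 3)) * (1 - θ ^ 6) := by
  have ha' : (10 : ℝ) ≤ a := by exact_mod_cast ha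
  have hb : (0 : ℝ) ≤ b := b.cast_nonneg
  refine mul_le_mul_of_nonneg_left ?_
    (div_nonneg (sq_nonneg _) (mul_nonneg (by linarith) (by linarith)))
  have := cf_ratio_ge (x := a) (y := a + b) (by linarith) (by linarith) hθ hθ1 h
  linarith

/-- The contraction factor for balanced splittings. -/
noncomputable def kap : ℝ := 1 - (1 / 200) ^ 6

theorem IsHigh.abs_le_or (hn : 20000 ≤ n) {χ : Equiv.Perm (Fin n) → ℝ} (h : IsHigh χ)
    {σ : Equiv.Perm (Fin n)} (hσ : c1 σ ≤ 2) :
    (∃ a b : ℕ, a + b = n ∧ n ≤ 100 * a ∧ n ≤ 100 * b ∧ ∃ P Q : ℝ, 0 ≤ P ∧ 0 ≤ Q ∧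
      P + Q ≤ 985 / 1000 ∧ P ≤ (b : ℝ) ^ 2 / (n * (n - 3)) * kap ∧
      Q ≤ (a : ℝ) ^ 2 / (n * (n - 3)) * kap ∧ ∀ α β : ℝ, 0 ≤ α → α ≤ 1 → 0 ≤ β →
      β ≤ 1 → Bd a α → Bd b β → |χ σ| ≤
        (α * β + (1 - α) * β * P + α * (1 - β) * Q + (1 - α) * (1 - β) * err n) * χ 1) ∨
    (∃ b : ℕ, 100 * b ≤ 5 * n ∧ ∀ β : ℝ, 0 ≤ β → Bd b β → |χ σ| ≤
        (2 / 5 / n + β * ((b : ℝ) ^ 2 / (n * (n - 3))) + err n) * χ 1) := by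
  rcases h.abs_le_of_bd (by omega) hσ with ⟨a, b, hab, h1, h2, hB⟩ | ⟨a, b, hab, h1, hB⟩
  · left
    have h3 : n ≤ 100 * b := by omega
    have hnr : (a : ℝ) + b = n := by exact_mod_cast hab
    have hn' : (20000 : ℝ) ≤ n := by exact_mod_cast hn
    have h1' : (n : ℝ) ≤ 100 * a := by exact_mod_cast h1
    have h3' : (n : ℝ) ≤ 100 * b := by exact_mod_cast h3
    have eP := linShare_le (a := a) (b := b) (θ := 1 / 200) (by omega) (by norm_num) (by norm_num)
      (by rw [hnr]; linarith)
    have eQ := linShare_le (a := b) (b := a) (θ := 1 / 200) (by omega) (by norm_num) (by norm_num)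
      (by rw [add_comm, hnr]; linarith)
    rw [hnr] at eP
    rw [add_comm (b : ℝ), hnr] at eQ
    refine ⟨a, b, hab, h1, h3, linShare a b, linShare b a, linShare_nonneg (by omega),
      linShare_nonneg (by omega), ?_, eP, eQ, hB⟩
    have hd : (0 : ℝ) < n * (n - 3) := mul_pos (by linarith) (by linarith)
    have e : (b : ℝ) ^ 2 / (n * (n - 3)) + (a : ℝ) ^ 2 / (n * (n - 3)) ≤ 985 / 1000 := by
      rw [← add_div, div_le_iff₀ hd]
      have hb : (b : ℝ) = n - a := by linarith
      have : 0 ≤ (100 * (a : ℝ) - n) * (100 * b - n) :=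
        mul_nonneg (by linarith) (by linarith)
      rw [hb] at this ⊢
      nlinarith
    have k1 : kap ≤ 1 := by unfold kap; norm_num
    have e1 : (b : ℝ) ^ 2 / (n * (n - 3)) * kap ≤ (b : ℝ) ^ 2 / (n * (n - 3)) * 1 :=
      mul_le_mul_of_nonneg_left k1 (div_nonneg (sq_nonneg _) hd.le)
    have e2 : (a : ℝ) ^ 2 / (n * (n - 3)) * kap ≤ (a : ℝ) ^ 2 / (n * (n - 3)) * 1 :=
      mul_le_mul_of_nonneg_left k1 (div_nonneg (sq_nonneg _) hd.le)
    unfold kap at e1 e2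
    linarith
  · right
    refine ⟨b, by omega, fun β hβ hb => (hB β hβ hb).trans
      (mul_le_mul_of_nonneg_right ?_ h.1.pos.le)⟩
    have hnr : (a : ℝ) + b = n := by exact_mod_cast hab
    have hn' : (20000 : ℝ) ≤ n := by exact_mod_cast hn
    have h1' : (95 : ℝ) * n ≤ 100 * a := by exact_mod_cast h1.le
    have e1 := linShare_le (a := a) (b := b) (θ := 0) (by omega) le_rfl zero_le_one
      (by rw [zero_mul]; linarith)
    have e2 := cf_ratio_ge (x := a) (y := n) (θ := 94 / 100) (by linarith) (by linarith)
      (by norm_num) (by norm_num) (by linarith)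
    have e3 : (1 - cf a / cf n) / ((a : ℝ) - 1) ≤ 341 / 1000 / n := by
      rw [div_le_div_iff₀ (by linarith) (by linarith)]
      have : 1 - cf a / cf n ≤ 32 / 100 := by
        have : (68 / 100 : ℝ) ≤ (94 / 100) ^ 6 := by norm_num
        linarith
      nlinarith
    have e4 : 1000 / (a : ℝ) ^ 2 ≤ 59 / 1000 / n := by
      rw [div_le_div_iff₀ (pow_pos (by linarith) 2) (by linarith)]
      nlinarith
    have e5 := mul_le_mul_of_nonneg_left e1 hβ
    rw [hnr] at e5
    have e6 : (2 / 5 / n : ℝ) = 341 / 1000 / n + 59 / 1000 / n := by ring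
    rw [e6]
    linarith

theorem exists_err_le {δ : ℝ} (hδ : 0 < δ) : ∃ N : ℕ, ∀ n ≥ N, err n ≤ δ / n := by
  obtain ⟨N, hN⟩ := exists_nat_ge ((12000 / δ) ^ 2)
  refine ⟨N + 1, fun n hn => ?_⟩
  have hn1 : (N : ℝ) ≤ n := by exact_mod_cast (by omega : N ≤ n)
  have hn0 : (0 : ℝ) < n := by exact_mod_cast (by omega : 0 < n)
  have h : 12000 / δ ≤ √(n : ℝ) := Real.le_sqrt_of_sq_le (hN.trans hn1)
  have hs : 0 < √(n : ℝ) := Real.sqrt_pos.2 hn0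
  rw [div_le_iff₀ hδ] at h
  rw [err, div_le_div_iff₀ (by positivity) hn0]
  nlinarith [mul_le_mul_of_nonneg_right h hn0.le]

theorem err_nonneg (n : ℕ) : 0 ≤ err n := by unfold err; positivity

end Estimates

section Uniform

variable {n : ℕ}

theorem abs_le_of_low (hn : 4 ≤ n) {χ : Equiv.Perm (Fin n) → ℝ} (h : IsT1 χ ∨ IsT2 χ)
    {σ : Equiv.Perm (Fin n)} (hσ : c1 σ ≤ 2) : |χ σ| ≤ 1 / ((n : ℝ) - 3) * χ 1 := by
  have hn' : (4 : ℝ) ≤ n := by exact_mod_cast hn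
  rw [div_mul_eq_mul_div, one_mul, le_div_iff₀ (by linarith)]
  rcases h with h | h
  · rw [h.one]
    nlinarith [h.abs_le hσ]
  · nlinarith [h.abs_le hn hσ, h.le_one hn]

theorem bd_of_high (hn : 4 ≤ n) {ε : ℝ} (hε : 1 / ((n : ℝ) - 3) ≤ ε)
    (h : ∀ χ : Equiv.Perm (Fin n) → ℝ, IsHigh χ → ∀ σ, c1 σ ≤ 2 → |χ σ| ≤ ε * χ 1) : Bd n ε := by
  intro σ hσ χ hχ hl
  by_cases h1 : IsT1 χ ∨ IsT2 χ
  · exact (abs_le_of_low hn h1 hσ).trans (mul_le_mul_of_nonneg_right hε hχ.pos.le)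
  · rw [not_or] at h1
    exact h χ ⟨hχ, hl, h1.1, h1.2⟩ σ hσ

theorem exists_lt_one_of_finite {α : Type} {s : Set α} (hs : s.Finite) (f : α → ℝ)
    (h : ∀ x ∈ s, f x < 1) : ∃ ε < 1, ∀ x ∈ s, f x ≤ ε := by
  rcases s.eq_empty_or_nonempty with rfl | hne
  · exact ⟨0, zero_lt_one, fun x hx => hx.elim⟩
  · obtain ⟨x, hx, hmax⟩ := hs.exists_maximalFor f s hne |>.imp fun x hx => hx
    exact ⟨f x, h x hx, fun y hy => (le_total (f x) (f y)).elim (fun h => hmax hy h) id⟩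

theorem exists_abs_le_lt_one (hn : 5 ≤ n) : ∃ ε < 1, ∀ σ : Equiv.Perm (Fin n), σ ≠ 1 →
    ∀ χ, IsIrr χ → ¬IsLin χ → |χ σ| ≤ ε * χ 1 := by
  obtain ⟨ε, h1, h⟩ := exists_lt_one_of_finite
    (s := {p : Equiv.Perm (Fin n) × (Equiv.Perm (Fin n) → ℝ) |
      p.1 ≠ 1 ∧ IsIrr p.2 ∧ ¬IsLin p.2})
    ((Set.finite_univ.prod finite_isIrr).subset fun p hp => ⟨Set.mem_univ _, hp.2.1⟩)
    (fun p => |p.2 p.1| / p.2 1) (fun p hp => by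
      rw [div_lt_one hp.2.1.pos]
      exact hp.2.1.abs_lt hn hp.2.2 hp.1)
  refine ⟨ε, h1, fun σ hσ χ hχ hl => ?_⟩
  rw [← div_le_iff₀ hχ.pos]
  exact h (σ, χ) ⟨hσ, hχ, hl⟩

theorem exists_bd_lt_one (hn : 5 ≤ n) : ∃ ε < 1, Bd n ε := by
  obtain ⟨ε, h1, h⟩ := exists_abs_le_lt_one hn
  refine ⟨ε, h1, fun σ hσ => h σ ?_⟩
  rintro rfl
  rw [c1_one] at hσ
  have : n ≤ 2 := by exact_mod_cast hσ
  omega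

theorem exists_bd_Icc {m : ℕ} (hm : 5 ≤ m) (M : ℕ) : ∃ ε < 1, ∀ n, m ≤ n → n ≤ M → Bd n ε := by
  have : ∀ n, ∃ ε : ℝ, ε < 1 ∧ (5 ≤ n → Bd n ε) := fun n => by
    by_cases hn : 5 ≤ n
    · obtain ⟨ε, h1, h⟩ := exists_bd_lt_one hn
      exact ⟨ε, h1, fun _ => h⟩
    · exact ⟨0, zero_lt_one, fun h => absurd h hn⟩
  choose f hf hfB using this
  obtain ⟨ε, h1, h⟩ := exists_lt_one_of_finite (Set.finite_Icc m M) f fun n _ => hf n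
  exact ⟨ε, h1, fun n h2 h3 => (hfB n (by omega)).mono (h n ⟨h2, h3⟩)⟩

theorem exists_bd_uniform : ∃ ε : ℝ, 0 < ε ∧ ε < 1 ∧ ∃ N : ℕ, ∀ n ≥ N, Bd n ε := by
  obtain ⟨N, hN⟩ := exists_err_le (δ := 1 / 1000) (by norm_num)
  set n₀ := max N 20000 with hn₀
  obtain ⟨ε₁, hε₁, hw⟩ := exists_bd_Icc (m := n₀) (by omega) (100 * n₀)
  refine ⟨max (1 / 2) ε₁, by positivity, max_lt (by norm_num) hε₁, n₀, ?_⟩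
  have h2 : (1 / 2 : ℝ) ≤ max (1 / 2) ε₁ := le_max_left _ _
  have h3 : max (1 / 2) ε₁ < 1 := max_lt (by norm_num) hε₁
  have hw : ∀ n, n₀ ≤ n → n ≤ 100 * n₀ → Bd n (max (1 / 2) ε₁) :=
    fun n h1 h2 => (hw n h1 h2).mono (le_max_right _ _)
  generalize max (1 / 2) ε₁ = ε at h2 h3 hw
  intro n
  induction n using Nat.strong_induction_on with
  | _ n ih =>
    intro hn
    by_cases hnw : n ≤ 100 * n₀
    · exact hw n hn hnw
    have hn2 : 20000 ≤ n := by omega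
    have hnr : (20000 : ℝ) ≤ n := by exact_mod_cast hn2
    have he : err n ≤ 1 / 1000 := (hN n (by omega)).trans
      (div_le_self (by norm_num) (by linarith))
    have he0 := err_nonneg n
    refine bd_of_high (by omega) (le_trans ?_ h2) fun χ hχ σ hσ => ?_
    · exact div_le_div_of_nonneg_left zero_le_one (by norm_num) (by linarith)
    rcases hχ.abs_le_or hn2 hσ with ⟨a, b, hab, ha, hb, P, Q, hP, hQ, hPQ, -, -, h⟩ | ⟨b, hb, h⟩
    · refine (h ε ε (by linarith) h3.le (by linarith) h3.le (ih a (by omega) (by omega))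
        (ih b (by omega) (by omega))).trans (mul_le_mul_of_nonneg_right ?_ hχ.1.pos.le)
      have h4 : 0 ≤ 1 - ε := by linarith
      have h5 : (1 - ε) * err n ≤ 15 / 1000 * ε := by nlinarith
      nlinarith [mul_le_mul_of_nonneg_left h5 h4, mul_le_mul_of_nonneg_left hPQ
        (mul_nonneg h4 (by linarith : 0 ≤ ε))]
    · refine (h 1 zero_le_one (bd_one b)).trans (mul_le_mul_of_nonneg_right ?_ hχ.1.pos.le)
      have hbr : 100 * (b : ℝ) ≤ 5 * n := by exact_mod_cast hb
      have h4 : (b : ℝ) ^ 2 / (n * (n - 3)) ≤ 1 / 100 := by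
        rw [div_le_iff₀ (mul_pos (by linarith) (by linarith))]
        nlinarith [(b.cast_nonneg : (0 : ℝ) ≤ b)]
      have h5 : (2 / 5 / n : ℝ) ≤ 2 / 5 := div_le_self (by norm_num) (by linarith)
      linarith

/-- Improving a uniform bound by a constant factor. -/
theorem exists_bd_improve {ε : ℝ} (h0 : 0 < ε) (h1 : ε < 1) {N : ℕ} (hB : ∀ n ≥ N, Bd n ε) :
    ∃ N' : ℕ, ∀ n ≥ N', Bd n (ε * (1 - 5 / 1000 * (1 - ε))) := by
  have hδ : 0 < 1 / 1000 * ε * (1 - ε) := mul_pos (by positivity) (by linarith)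
  obtain ⟨N₁, hN₁⟩ := exists_err_le hδ
  obtain ⟨K, hK⟩ := exists_nat_ge (1 / (ε / 1000))
  refine ⟨max (max N₁ 20000) (max (100 * N) (max ((N + 1) * (N + 1)) 1 * (K + 10))), fun n hn => ?_⟩
  have hn2 : 20000 ≤ n := by omega
  have hnr : (20000 : ℝ) ≤ n := by exact_mod_cast hn2
  have hnK : (K : ℝ) + 10 ≤ n := by
    have : max ((N + 1) * (N + 1)) 1 * (K + 10) ≤ n := by omega
    have : 1 * (K + 10) ≤ n := (Nat.mul_le_mul_right _ (le_max_right _ _)).trans this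
    exact_mod_cast (by omega : K + 10 ≤ n)
  have he : err n ≤ 1 / 1000 * ε * (1 - ε) := (hN₁ n (by omega)).trans
      (div_le_self hδ.le (by linarith))
  have he0 := err_nonneg n
  have hinv : 1 / ((n : ℝ) - 3) ≤ ε / 1000 := by
    rw [div_le_iff₀ (by positivity)] at hK
    rw [div_le_iff₀ (by linarith)]
    nlinarith
  have hq : ε * (1 - 5 / 1000 * (1 - ε)) ≥ 995 / 1000 * ε := by nlinarith
  refine bd_of_high (by omega) (by linarith) fun χ hχ σ hσ => ?_
  rcases hχ.abs_le_or hn2 hσ with ⟨a, b, hab, ha, hb, P, Q, hP, hQ, hPQ, -, -, h⟩ | ⟨b, hb, h⟩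
  · refine (h ε ε h0.le h1.le h0.le h1.le (hB a (by omega)) (hB b (by omega))).trans
      (mul_le_mul_of_nonneg_right ?_ hχ.1.pos.le)
    have h4 : 0 ≤ 1 - ε := by linarith
    have h6 : (1 - ε) * (1 - ε) * err n ≤ 1 * err n :=
      mul_le_mul_of_nonneg_right (by nlinarith) he0
    nlinarith [mul_le_mul_of_nonneg_left hPQ (mul_nonneg h4 h0.le)]
  · have hbr : 100 * (b : ℝ) ≤ 5 * n := by exact_mod_cast hb
    have hb0 : (0 : ℝ) ≤ b := b.cast_nonneg
    have hd : (0 : ℝ) < n * (n - 3) := mul_pos (by linarith) (by linarith)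
    have h5 : (2 / 5 / n : ℝ) ≤ 1 / (n - 3) := by
      rw [div_div, div_le_div_iff₀ (by positivity) (by linarith)]
      nlinarith
    by_cases hbN : N ≤ b
    · refine (h ε h0.le (hB b hbN)).trans (mul_le_mul_of_nonneg_right ?_ hχ.1.pos.le)
      have h4 : (b : ℝ) ^ 2 / (n * (n - 3)) ≤ 1 / 100 := by
        rw [div_le_iff₀ hd]
        nlinarith
      nlinarith
    · refine (h 1 zero_le_one (bd_one b)).trans (mul_le_mul_of_nonneg_right ?_ hχ.1.pos.le)
      have hbn : b * b ≤ n := by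
        have e1 : max ((N + 1) * (N + 1)) 1 * (K + 10) ≤ n := by omega
        have e2 : (N + 1) * (N + 1) * 1 ≤ n :=
          (Nat.mul_le_mul (le_max_left _ _) (by omega)).trans e1
        nlinarith
      have hbn' : (b : ℝ) * b ≤ n := by exact_mod_cast hbn
      have h4 : (b : ℝ) ^ 2 / (n * (n - 3)) ≤ 1 / (n - 3) := by
        rw [div_le_div_iff₀ hd (by linarith)]
        nlinarith [mul_le_mul_of_nonneg_right hbn' (by linarith : (0 : ℝ) ≤ n - 3)]
      nlinarith

end Uniform

section Decay

variable {n : ℕ}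

theorem exists_bd_of_pos {η : ℝ} (hη : 0 < η) : ∃ N : ℕ, ∀ n ≥ N, Bd n η := by
  obtain ⟨ε, h0, h1, N, hN⟩ := exists_bd_uniform
  have q0 : 0 < 1 - 5 / 1000 * (1 - ε) := by linarith
  have q1 : 1 - 5 / 1000 * (1 - ε) < 1 := by linarith
  have key (k : ℕ) : ∃ N : ℕ, ∀ n ≥ N, Bd n (ε * (1 - 5 / 1000 * (1 - ε)) ^ k) := by
    induction k with
    | zero => exact ⟨N, by simpa using hN⟩
    | succ k ih =>
      obtain ⟨M, hM⟩ := ih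
      have p0 := pow_pos q0 k
      have p1 : ε * (1 - 5 / 1000 * (1 - ε)) ^ k ≤ ε :=
        mul_le_of_le_one_right h0.le (pow_le_one₀ q0.le q1.le)
      obtain ⟨M', hM'⟩ := exists_bd_improve (mul_pos h0 p0) (p1.trans_lt h1) hM
      refine ⟨M', fun n hn => (hM' n hn).mono ?_⟩
      rw [pow_succ, ← mul_assoc]
      exact mul_le_mul_of_nonneg_left (by linarith) (mul_pos h0 p0).le
  obtain ⟨k, hk⟩ := exists_pow_lt_of_lt_one hη q1
  obtain ⟨M, hM⟩ := key k
  refine ⟨M, fun n hn => (hM n hn).mono ?_⟩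
  have := mul_le_of_le_one_left (pow_pos q0 k).le h1.le
  linarith

/-- The contraction factor of the decay recursion. -/
noncomputable def decayRate : ℝ := 1 - (1 / 200) ^ 6 / 2

set_option maxHeartbeats 2000000 in
theorem exists_high_le (N : ℕ) : ∃ N₀ : ℕ, ∀ n ≥ N₀, ∀ U : ℝ, 1 ≤ U →
    (∀ m, N ≤ m → m < n → Bd m (U / m)) → ∀ χ : Equiv.Perm (Fin n) → ℝ, IsHigh χ →
      ∀ σ, c1 σ ≤ 2 → |χ σ| ≤ decayRate * U / n * χ 1 := by
  obtain ⟨h₀, hh⟩ : ∃ h : ℝ, h = (1 / 200) ^ 6 := ⟨_, rfl⟩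
  have h0 : 0 < h₀ := by rw [hh]; norm_num
  have h1 : h₀ ≤ 1 / 1000 := by rw [hh]; norm_num
  have ek : kap = 1 - h₀ := by rw [kap, hh]
  have ek' : decayRate = 1 - h₀ / 2 := by rw [decayRate, hh]
  have hη : 0 < h₀ / 1000 := by positivity
  obtain ⟨N₁, hN₁⟩ := exists_bd_of_pos hη
  obtain ⟨N₂, hN₂⟩ := exists_err_le (δ := h₀ / 10) (by positivity)
  obtain ⟨N₃, hN₃⟩ := exists_nat_ge (60 / h₀)
  refine ⟨20000 + 100 * N₁ + N₂ + N₃ + 20 * (N * N) + 100 * N, fun n hn U hU hB χ hχ σ hσ => ?_⟩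
  have hn2 : 20000 ≤ n := by omega
  have hnr : (20000 : ℝ) ≤ n := by exact_mod_cast hn2
  have he := hN₂ n (by omega)
  have he0 := err_nonneg n
  have hn3 : (20000 : ℝ) + 60 / h₀ ≤ n := by
    have : (20000 : ℝ) + N₃ ≤ n := by exact_mod_cast (by omega : 20000 + N₃ ≤ n)
    linarith
  have hd : (0 : ℝ) < n * (n - 3) := mul_pos (by linarith) (by linarith)
  have hn0 : (0 : ℝ) < n := by linarith
  have heU : err n ≤ h₀ / 10 * (U / n) := by
    refine he.trans ?_
    rw [div_eq_mul_one_div (h₀ / 10)]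
    exact mul_le_mul_of_nonneg_left (div_le_div_of_nonneg_right hU hn0.le) (by positivity)
  have hUn : 0 < U / n := div_pos (by linarith) hn0
  have h3 : U / ((n : ℝ) - 3) ≤ (1 + h₀ / 10) * (U / n) := by
    have hpos : 60 / h₀ * h₀ = 60 := by field_simp
    rw [mul_div_assoc', div_le_div_iff₀ (by linarith) hn0]
    have : (n : ℝ) ≤ (1 + h₀ / 10) * (n - 3) := by nlinarith
    nlinarith
  rw [mul_div_assoc]
  rcases hχ.abs_le_or hn2 hσ with ⟨a, b, hab, ha, hb, P, Q, hP, hQ, hPQ, hPb, hQa, h⟩ | ⟨b, hb, h⟩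
  · have har : (n : ℝ) ≤ 100 * a := by exact_mod_cast ha
    have hbr : (n : ℝ) ≤ 100 * b := by exact_mod_cast hb
    have ha0 : (0 : ℝ) < a := by linarith
    have hb0 : (0 : ℝ) < b := by linarith
    have habr : (a : ℝ) + b = n := by exact_mod_cast hab
    have hmin {m : ℕ} (h2 : N₁ ≤ m) (h3 : N ≤ m) (h4 : m < n) : Bd m (min (h₀ / 1000) (U / m)) := by
      rcases min_choice (h₀ / 1000) (U / m) with e | e
      · rw [e]
        exact hN₁ m h2
      · rw [e]
        exact hB m h3 h4
    have hA := hmin (m := a) (by omega) (by omega) (by omega)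
    have hB' := hmin (m := b) (by omega) (by omega) (by omega)
    have a1 : min (h₀ / 1000) (U / a) ≤ h₀ / 1000 := min_le_left _ _
    have a2 : min (h₀ / 1000) (U / a) ≤ U / a := min_le_right _ _
    have a0 : 0 ≤ min (h₀ / 1000) (U / a) := le_min hη.le (div_nonneg (by linarith) ha0.le)
    have b1 : min (h₀ / 1000) (U / b) ≤ h₀ / 1000 := min_le_left _ _
    have b2 : min (h₀ / 1000) (U / b) ≤ U / b := min_le_right _ _
    have b0 : 0 ≤ min (h₀ / 1000) (U / b) := le_min hη.le (div_nonneg (by linarith) hb0.le)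
    generalize min (h₀ / 1000) (U / a) = α at hA a0 a1 a2
    generalize min (h₀ / 1000) (U / b) = β at hB' b0 b1 b2
    refine (h α β a0 (by linarith) b0 (by linarith) hA hB').trans
      (mul_le_mul_of_nonneg_right ?_ hχ.1.pos.le)
    have e1 : α * β ≤ h₀ / 10 * (U / n) := by
      have : U / b ≤ 100 * (U / n) := by
        rw [mul_div_assoc', div_le_div_iff₀ hb0 hn0]
        nlinarith
      calc α * β ≤ h₀ / 1000 * (100 * (U / n)) :=
            mul_le_mul a1 (b2.trans this) b0 hη.le
        _ = _ := by ring
    have e2 : (1 - α) * β * P ≤ U * b / (n * (n - 3)) * kap := by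
      calc (1 - α) * β * P ≤ 1 * (U / b) * ((b : ℝ) ^ 2 / (n * (n - 3)) * kap) :=
            mul_le_mul (mul_le_mul (by linarith) b2 b0 zero_le_one) hPb hP
              (by positivity)
        _ = _ := by field_simp
    have e3 : α * (1 - β) * Q ≤ U * a / (n * (n - 3)) * kap := by
      calc α * (1 - β) * Q ≤ U / a * 1 * ((a : ℝ) ^ 2 / (n * (n - 3)) * kap) :=
            mul_le_mul (mul_le_mul a2 (by linarith) (by linarith) (by positivity)) hQa hQ
              (by positivity)
        _ = _ := by field_simp
    have e4 : U * b / (n * (n - 3)) * kap + U * a / (n * (n - 3)) * kap = U / (n - 3) * kap := by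
      rw [← add_mul, ← add_div, ← mul_add, add_comm (b : ℝ), habr, mul_comm U,
        mul_div_mul_left _ _ hn0.ne']
    have e5 : (1 - α) * (1 - β) * err n ≤ 1 * err n :=
      mul_le_mul_of_nonneg_right (mul_le_one₀ (by linarith) (by linarith) (by linarith)) he0
    have e6 : U / (n - 3) * kap ≤ (1 + h₀ / 10) * (U / n) * (1 - h₀) := by
      rw [ek]
      exact mul_le_mul_of_nonneg_right h3 (by linarith)
    rw [ek']
    nlinarith [mul_nonneg (mul_nonneg h0.le h0.le) hUn.le]
  · have hb0 : (0 : ℝ) ≤ b := b.cast_nonneg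
    have hbr : 100 * (b : ℝ) ≤ 5 * n := by exact_mod_cast hb
    have e0 : (2 / 5 / n : ℝ) ≤ 2 / 5 * (U / n) := by
      rw [mul_div_assoc']
      exact div_le_div_of_nonneg_right (by linarith) hn0.le
    by_cases hbN : N ≤ b
    · refine (h (U / b) (div_nonneg (by linarith) hb0) (hB b hbN (by omega))).trans
        (mul_le_mul_of_nonneg_right ?_ hχ.1.pos.le)
      have e1 : U / b * ((b : ℝ) ^ 2 / (n * (n - 3))) ≤ 1 / 20 * (U / (n - 3)) := by
        have e : U / b * ((b : ℝ) ^ 2 / (n * (n - 3))) = U / (n - 3) * (b / n) := by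
          rcases hb0.eq_or_lt with hb | hb
          · rw [← hb]
            simp
          · have : (0 : ℝ) < n - 3 := by linarith
            field_simp
        rw [e, mul_comm]
        refine mul_le_mul_of_nonneg_right ?_ (div_nonneg (by linarith) (by linarith))
        rw [div_le_div_iff₀ hn0 (by norm_num)]
        linarith
      rw [ek']
      nlinarith
    · refine (h 1 zero_le_one (bd_one b)).trans
        (mul_le_mul_of_nonneg_right ?_ hχ.1.pos.le)
      have e1 : (b : ℝ) ^ 2 / (n * (n - 3)) ≤ 1 / 20 * (U / (n - 3)) := by
        rw [mul_div_assoc', div_le_div_iff₀ hd (by linarith)]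
        have h2 : 20 * (b * b) ≤ n := by
          have : b * b ≤ N * N := Nat.mul_le_mul (by omega) (by omega)
          omega
        have h2' : 20 * ((b : ℝ) * b) ≤ n := by exact_mod_cast h2
        have h4 : 0 ≤ (n : ℝ) - 3 := by linarith
        nlinarith [mul_le_mul_of_nonneg_right h2' h4,
          mul_le_mul_of_nonneg_right hU (mul_nonneg hn0.le h4)]
      rw [ek', one_mul]
      nlinarith

theorem decayRate_pos : 0 < decayRate := by unfold decayRate; norm_num

theorem decayRate_lt_one : decayRate < 1 := by unfold decayRate; norm_num

theorem exists_bd_div : ∃ V : ℝ, 1 ≤ V ∧ ∀ n : ℕ, 1 ≤ n → Bd n (V / n) := by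
  obtain ⟨N₀, hN₀⟩ := exists_high_le 1
  have hU : (4 : ℝ) ≤ ((N₀ + 4 : ℕ) : ℝ) := by push_cast; linarith [(N₀.cast_nonneg : (0 : ℝ) ≤ N₀)]
  refine ⟨(N₀ + 4 : ℕ), by linarith, fun n => ?_⟩
  induction n using Nat.strong_induction_on with
  | _ n ih =>
    intro hn
    have hn0 : (0 : ℝ) < n := by exact_mod_cast hn
    by_cases hnU : n ≤ N₀ + 4
    · refine (bd_one n).mono ?_
      rw [le_div_iff₀ hn0, one_mul]
      exact_mod_cast hnU
    · have hn4 : (4 : ℝ) ≤ n := by exact_mod_cast (by omega : 4 ≤ n)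
      refine bd_of_high (by omega) ?_ fun χ hχ σ hσ => ?_
      · rw [div_le_div_iff₀ (by linarith) hn0]
        nlinarith
      · refine (hN₀ n (by omega) _ (by linarith) (fun m h1 h2 => ih m h2 h1) χ hχ σ hσ).trans
          (mul_le_mul_of_nonneg_right (div_le_div_of_nonneg_right ?_ hn0.le) hχ.1.pos.le)
        exact mul_le_of_le_one_left (by linarith) decayRate_lt_one.le

theorem exists_high_le_inv : ∃ N : ℕ, ∀ n ≥ N, ∀ χ : Equiv.Perm (Fin n) → ℝ, IsHigh χ →
    ∀ σ, c1 σ ≤ 2 → |χ σ| ≤ 1 / n * χ 1 := by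
  obtain ⟨V, hV1, hV⟩ := exists_bd_div
  obtain ⟨δ, hδ, hδk⟩ : ∃ δ : ℝ, 0 < δ ∧ decayRate * (1 + δ) ≤ 1 :=
    ⟨1 - decayRate, by linarith [decayRate_lt_one], by nlinarith [sq_nonneg (1 - decayRate)]⟩
  have k0 := decayRate_pos
  have k1 := decayRate_lt_one
  obtain ⟨M, hM⟩ := exists_nat_ge (3 * (1 + δ) / δ)
  have key (k : ℕ) : ∃ N : ℕ, ∀ n ≥ N, Bd n (max (1 + δ) (decayRate ^ k * V) / n) := by
    induction k with
    | zero =>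
      refine ⟨1, fun n hn => (hV n hn).mono (div_le_div_of_nonneg_right ?_ n.cast_nonneg)⟩
      rw [pow_zero, one_mul]
      exact le_max_right _ _
    | succ k ih =>
      obtain ⟨N, hN⟩ := ih
      obtain ⟨N₀, hN₀⟩ := exists_high_le N
      refine ⟨N₀ + M + 4, fun n hn => ?_⟩
      have hn4 : (4 : ℝ) ≤ n := by exact_mod_cast (by omega : 4 ≤ n)
      have hnM : (M : ℝ) ≤ n := by exact_mod_cast (by omega : M ≤ n)
      have hn0 : (0 : ℝ) < n := by linarith
      have hmax : 1 + δ ≤ max (1 + δ) (decayRate ^ (k + 1) * V) := le_max_left _ _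
      refine bd_of_high (by omega) ?_ fun χ hχ σ hσ => ?_
      · rw [div_le_div_iff₀ (by linarith) hn0]
        have : 3 * (1 + δ) ≤ n * δ := by
          rw [← div_le_iff₀ hδ]
          exact hM.trans hnM
        nlinarith
      · refine (hN₀ n (by omega) _ (le_trans (by linarith) (le_max_left _ _))
          (fun m h1 _ => hN m h1) χ hχ σ hσ).trans
          (mul_le_mul_of_nonneg_right (div_le_div_of_nonneg_right ?_ hn0.le) hχ.1.pos.le)
        rw [mul_max_of_nonneg _ _ k0.le]
        refine max_le (by linarith) (le_trans (le_of_eq ?_) (le_max_right _ _))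
        ring
  obtain ⟨k, hk⟩ := exists_pow_lt_of_lt_one (show 0 < 1 / V by positivity) k1
  obtain ⟨N, hN⟩ := key k
  obtain ⟨N₀, hN₀⟩ := exists_high_le N
  have hkV : max (1 + δ) (decayRate ^ k * V) = 1 + δ := by
    refine max_eq_left ?_
    rw [lt_div_iff₀ (by linarith)] at hk
    linarith
  rw [hkV] at hN
  refine ⟨N₀, fun n hn χ hχ σ hσ => (hN₀ n hn (1 + δ) (by linarith) (fun m h1 _ => hN m h1) χ hχ σ
    hσ).trans (mul_le_mul_of_nonneg_right (div_le_div_of_nonneg_right hδk n.cast_nonneg)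
    hχ.1.pos.le)⟩

end Decay

section Main

variable {n : ℕ}

theorem c1_le (σ : Equiv.Perm (Fin n)) : c1 σ ≤ n := by
  linarith [c1_add_d2_le σ, d2_nonneg σ]

/-- The standard character rules for `σ`, up to the error `θ`. -/
def Rules (θ : ℝ) (σ : Equiv.Perm (Fin n)) : Prop :=
  ∀ χ, IsIrr χ → ¬IsLin χ → χ σ ≤ max θ ((c1 σ - 1) / (n - 1)) * χ 1

theorem Rules.iota {θ : ℝ} (hn : 2 ≤ n) {s : Equiv.Perm (Fin n)} (h : Rules θ s) :
    Rules θ (iota s) := by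
  obtain ⟨m, rfl⟩ : ∃ m, n = m + 1 := ⟨n - 1, by omega⟩
  intro χ hχ h0
  have hm : (1 : ℝ) ≤ m := by exact_mod_cast (by omega : 1 ≤ m)
  have hc := c1_le s
  have hc0 := c1_nonneg s
  push_cast at hc
  have e : c1 (StdRules.iota s) - 1 = c1 s := by rw [c1_iota]; ring
  by_cases h1 : IsT1 χ
  · rw [h1.one, e]
    refine le_trans ?_ (mul_le_mul_of_nonneg_right (le_max_right _ _) (by push_cast; linarith))
    rw [div_mul_cancel₀ _ (by push_cast; linarith)]
    have ha : |std (StdRules.iota s)| ≤ c1 s := by rw [std, e, abs_of_nonneg hc0]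
    rcases h1 with rfl | rfl
    · exact (le_abs_self _).trans ha
    · exact (le_abs_self _).trans (by rwa [abs_tw])
  · obtain ⟨k, ψ, hψ, hs⟩ := (hχ.isRepChar.comp StdRules.iota).decomp
    have hlin := hχ.constituent h0 h1 hψ hs
    have hone : χ 1 = ∑ i, ψ i 1 := by simpa using hs 1
    rw [show χ (StdRules.iota s) = _ from hs s, hone, Finset.mul_sum]
    refine Finset.sum_le_sum fun i _ => (h _ (hψ i) (hlin i)).trans
      (mul_le_mul_of_nonneg_right (max_le_max_left _ ?_) (hψ i).pos.le)
    rw [e]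
    push_cast
    rw [div_le_div_iff₀ (by linarith) (by linarith)]
    linarith

theorem Rules.emb {θ : ℝ} (hn : 2 ≤ n) {s : Equiv.Perm (Fin n)} (h : Rules θ s) (b : ℕ) :
    Rules θ (emb n b s) := by
  induction b with
  | zero => exact h
  | succ b ih => exact ih.iota (by omega)

theorem Rules.of_cycleType_eq {m : ℕ} {θ : ℝ} (hm : 2 ≤ m) (hmn : m ≤ n)
    {s : Equiv.Perm (Fin m)} {σ : Equiv.Perm (Fin n)} (hs : s.cycleType = σ.cycleType)
    (h : Rules θ s) : Rules θ σ := by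
  obtain ⟨b, rfl⟩ := Nat.exists_eq_add_of_le hmn
  intro χ hχ h0
  have := h.emb hm b χ hχ h0
  have e : (StdRules.emb m b s).cycleType = σ.cycleType := by rw [cycleType_emb, hs]
  rwa [hχ.isRepChar.isClass.eq_of_cycleType e, show c1 (StdRules.emb m b s) = c1 σ by
    rw [c1_eq, c1_eq, e]] at this

theorem IsT2.le_of_c1_eq_two (hn : 8 ≤ n) {χ : Equiv.Perm (Fin n) → ℝ} (h : IsT2 χ)
    {σ : Equiv.Perm (Fin n)} (hσ : c1 σ = 2) : χ σ ≤ 1 / (n - 1) * χ 1 := by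
  have hn' : (8 : ℝ) ≤ n := by exact_mod_cast hn
  have hd := d2_nonneg σ
  have hcd := c1_add_d2_le σ
  rw [hσ] at hcd
  have hS : |psiS σ| ≤ 1 / (n - 1) * psiS (1 : Equiv.Perm (Fin n)) := by
    rw [one_div_mul_eq_div, le_div_iff₀ (by linarith), psiS, psiS, hσ, c1_one, d2_one]
    have : |2 * (2 - 3) / 2 + d2 σ / 2| ≤ ((n : ℝ) - 4) / 2 := by
      rw [_root_.abs_le]
      constructor <;> linarith
    nlinarith
  have hE : |psiE σ| ≤ 1 / (n - 1) * psiE (1 : Equiv.Perm (Fin n)) := by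
    rw [one_div_mul_eq_div, le_div_iff₀ (by linarith), psiE, psiE, hσ, c1_one, d2_one]
    have : |(2 - 1) * (2 - 2) / 2 - d2 σ / 2| ≤ ((n : ℝ) - 2) / 2 := by
      rw [_root_.abs_le]
      constructor <;> linarith
    nlinarith
  refine (le_abs_self _).trans ?_
  rcases h with (rfl | rfl) | (rfl | rfl)
  · exact hS
  · exact hE
  · rwa [abs_tw, tw_one]
  · rwa [abs_tw, tw_one]

theorem exists_rules_of_c1_eq_two : ∃ N : ℕ, ∀ n ≥ N, ∀ σ : Equiv.Perm (Fin n), c1 σ = 2 →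
    Rules 0 σ := by
  obtain ⟨N, hN⟩ := exists_high_le_inv
  refine ⟨max N 8, fun n hn σ hσ χ hχ h0 => ?_⟩
  have hn8 : 8 ≤ n := by omega
  have hn' : (8 : ℝ) ≤ n := by exact_mod_cast hn8
  refine le_trans ?_ (mul_le_mul_of_nonneg_right (le_max_right _ _) hχ.pos.le)
  rw [hσ, show (2 : ℝ) - 1 = 1 by norm_num]
  by_cases h1 : IsT1 χ
  · rw [h1.one, div_mul_cancel₀ _ (by linarith)]
    exact (le_abs_self _).trans (h1.abs_le hσ.le)
  by_cases h2 : IsT2 χ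
  · exact h2.le_of_c1_eq_two hn8 hσ
  refine (le_abs_self _).trans ((hN n (by omega) χ ⟨hχ, h0, h1, h2⟩ σ hσ.le).trans
    (mul_le_mul_of_nonneg_right ?_ hχ.pos.le))
  exact one_div_le_one_div_of_le (by linarith) (by linarith)

theorem exists_cycleType_eq (σ : Equiv.Perm (Fin n)) {m : ℕ} (h : σ.cycleType.sum ≤ m) :
    ∃ s : Equiv.Perm (Fin m), s.cycleType = σ.cycleType := by
  refine (Equiv.Perm.exists_with_cycleType_iff (Fin m)).2 ⟨?_, fun a ha => ?_⟩
  · rwa [Fintype.card_fin]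
  · exact Equiv.Perm.two_le_of_mem_cycleType ha

theorem exists_rules : ∃ N : ℕ, 2 ≤ N ∧ ∀ n ≥ N, ∀ σ : Equiv.Perm (Fin n), 2 ≤ c1 σ →
    Rules 0 σ := by
  obtain ⟨N₀, hN₀⟩ := exists_rules_of_c1_eq_two
  obtain ⟨N, hN, hN5⟩ : ∃ N, N₀ ≤ N ∧ 5 ≤ N := ⟨max N₀ 5, by omega, by omega⟩
  obtain ⟨ε, hε, hεN⟩ := exists_abs_le_lt_one hN5
  obtain ⟨K, hK⟩ := exists_nat_ge (N / (1 - ε))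
  refine ⟨max N (K + 2), by omega, fun n hn σ hσ => ?_⟩
  have hnK : (K : ℝ) + 2 ≤ n := by exact_mod_cast (by omega : K + 2 ≤ n)
  have hK0 : (0 : ℝ) ≤ K := K.cast_nonneg
  have hc := c1_eq σ
  by_cases hs : N ≤ σ.cycleType.sum + 2
  · obtain ⟨s, hsσ⟩ := exists_cycleType_eq σ (m := σ.cycleType.sum + 2) (by omega)
    have hle : σ.cycleType.sum + 2 ≤ n := by
      have : (σ.cycleType.sum : ℝ) + 2 ≤ n := by linarith
      exact_mod_cast this
    refine (hN₀ _ (by omega) s ?_).of_cycleType_eq (by omega) hle hsσ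
    rw [c1_eq, hsσ]
    push_cast
    ring
  · obtain ⟨s, hsσ⟩ := exists_cycleType_eq σ (m := N) (by omega)
    have hsum : (σ.cycleType.sum : ℝ) ≤ N := by exact_mod_cast (by omega)
    intro χ hχ h0
    refine le_trans ?_ (mul_le_mul_of_nonneg_right (le_max_right _ _) hχ.pos.le)
    by_cases h1 : σ = 1
    · rw [h1, c1_one, div_self (by linarith), one_mul]
    have hs1 : s ≠ 1 := by
      rintro rfl
      rw [Equiv.Perm.cycleType_one] at hsσ
      exact h1 (Equiv.Perm.cycleType_eq_zero.1 hsσ.symm)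
    have hr : Rules ε s := fun ψ hψ hl => (le_abs_self _).trans ((hεN s hs1 ψ hψ hl).trans
      (mul_le_mul_of_nonneg_right (le_max_left _ _) hψ.pos.le))
    have := hr.of_cycleType_eq (by omega) (by omega) hsσ χ hχ h0
    rwa [max_eq_right] at this
    rw [le_div_iff₀ (by linarith)]
    rw [div_le_iff₀ (by linarith)] at hK
    nlinarith

end Main

end StdRules

/-- **Proposition (c₁ ≥ 2).** There is `N₁` such that for every `n ≥ N₁` and every
`σ ∈ S_n` with at least two fixed points, the standard representation rules:
`χ̃(σ) ≤ (c₁(σ)-1)/(n-1)` for every irreducible character `χ ∉ {triv, sgn}`. -/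
theorem std_rules_of_two_fixed_points :
    ∃ N₁ : ℕ, ∀ n : ℕ, n ≥ N₁ → ∀ σ : Equiv.Perm (Fin n), 2 ≤ fixCount σ →
      ∀ V : FDRep ℂ (Equiv.Perm (Fin n)), IsNontrivIrr V →
        normChar V σ ≤ ((fixCount σ : ℝ) - 1) / ((n : ℝ) - 1) := by
  obtain ⟨N, hN2, hN⟩ := StdRules.exists_rules
  refine ⟨N, fun n hn σ hσ V hV => ?_⟩
  obtain ⟨χ, hχ, hVχ⟩ := StdRules.isIrr_of_simple V hV.1
  have hlin : ¬StdRules.IsLin χ := by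
    rintro (e | e)
    · exact hV.2.1 (funext fun g => by rw [hVχ, e, Complex.ofReal_one])
    · exact hV.2.2 (funext fun g => by rw [hVχ, e, StdRules.sg, Complex.ofReal_intCast])
  have hc : (fixCount σ : ℝ) = StdRules.c1 σ := by
    rw [StdRules.c1, Finset.sum_boole, fixCount]
  have hn' : (2 : ℝ) ≤ n := by exact_mod_cast hN2.trans hn
  have hσ' : 2 ≤ StdRules.c1 σ := by
    rw [← hc]
    exact_mod_cast hσ
  have h := hN n hn σ hσ' χ hχ hlin
  rw [max_eq_right (div_nonneg (by linarith) (by linarith))] at h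
  rw [normChar, hVχ, hVχ, ← Complex.ofReal_div, Complex.ofReal_re, hc, div_le_iff₀ hχ.pos]
  exact h
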